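/- arXiv:2306.07359 — 6 statements merged into one kernel-verified Lean document; each statement's English description precedes it below -/
import Mathlib

section
/- Let B₁ = {4, −4} and B₂ = {4, 4i}. The fundamental groups π₁(U_{B₁}) and π₁(U_{B₂}) are not isomorphic (so the curves F_{B₁} and F_{B₂} form a Zariski pair distinguished by the fundamental group of the complement). -/
open Complex

/-- The polynomial map `f(x,y) = x⁶ + y⁶ + 6xy` on `ℂ²`. -/
noncomputable def f : ℂ × ℂ → ℂ := fun p => p.1 ^ 6 + p.2 ^ 6 + 6 * p.1 * p.2

/-- `U B = ℂ² \ f⁻¹(B)`, the complement of the union of fibers of `f` over `B`. -/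
def U (B : Set ℂ) : Set (ℂ × ℂ) := {p | f p ∉ B}

open unitInterval Topology Set

abbrev HQ {X : Type*} [TopologicalSpace X] (a b : X) := Path.Homotopic.Quotient a b

open CategoryTheory in
theorem GL_aux {X : Type*} [TopologicalSpace X] {x0 : X} (H : Subgroup (FundamentalGroup X x0))
    {ι : Type*} (O : ι → Set X) 
    (δ : ∀ i q, q ∈ O i → HQ x0 q)
    (compat : ∀ i q q' (h : q ∈ O i) (h' : q' ∈ O i) (γ : Path q q'), (∀ t, γ t ∈ O i) →
      (δ i q h).trans (.mk γ) = δ i q' h')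
    (trans : ∀ i j q h h', (FundamentalGroup.fromPath <| (δ i q h).trans (δ j q h').symm) ∈ H)
    (base : ∃ i h, (FundamentalGroup.fromPath <| δ i x0 h) ∈ H)
    (γ : Path x0 x0) (t : ℕ → I) (ht0 : t 0 = 0) (htm : Monotone t)
    (htc : ∀ n, ∃ i, Set.Icc (t n) (t (n+1)) ⊆ γ ⁻¹' (O i)) (n : ℕ) :
    ∃ i, ∃ h : γ (t n) ∈ O i, (FundamentalGroup.fromPath <|
      ((Path.Homotopic.Quotient.mk (γ.subpath 0 (t n))).cast γ.source.symm rfl).trans (δ i _ h).symm) ∈ H := by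
  induction n with
  | zero =>
    obtain ⟨i, h, hb⟩ := base
    rw [ht0]
    have e : x0 = γ 0 := γ.source.symm
    refine ⟨i, by rw [γ.source]; exact h, ?_⟩
    have key : (FundamentalGroup.fromPath <|
      ((Path.Homotopic.Quotient.mk (γ.subpath 0 0)).cast γ.source.symm rfl).trans
        (δ i (γ 0) (by rw [γ.source]; exact h)).symm) = (FundamentalGroup.fromPath <| δ i x0 h)⁻¹ := by
      rw [γ.subpath_self]
      rw [FundamentalGroup.inv_def]
      have : ∀ (z : X) (e : x0 = z) (hz : z ∈ O i), Path.Homotopic.Quotient.trans ((Path.Homotopic.Quotient.mk (Path.refl z)).cast e rfl)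
          (δ i z hz).symm = (δ i x0 h).symm := by
        intro z e hz
        subst e
        simp [Path.Homotopic.Quotient.refl_trans]
      exact this _ _ _
    rw [key]
    exact H.inv_mem hb
  | succ n ih =>
    obtain ⟨i, h, hi⟩ := ih
    obtain ⟨j, hj⟩ := htc n
    have h0 : γ (t n) ∈ O j := hj ⟨le_rfl, htm (Nat.le_succ n)⟩
    have h1 : γ (t (n+1)) ∈ O j := hj ⟨htm (Nat.le_succ n), le_rfl⟩
    refine ⟨j, h1, ?_⟩
    have c1 := compat j _ _ h0 h1 (γ.subpath (t n) (t (n+1))) (by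
      intro s
      have : γ.subpath (t n) (t (n+1)) s ∈ Set.range (γ.subpath (t n) (t (n+1))) := ⟨s, rfl⟩
      rw [γ.range_subpath_of_le _ _ (htm (Nat.le_succ n))] at this
      obtain ⟨u, hu, hu2⟩ := this
      rw [← hu2]; exact hj hu)
    have c2 : (Path.Homotopic.Quotient.mk (γ.subpath 0 (t n))).trans (.mk (γ.subpath (t n) (t (n+1)))) =
        .mk (γ.subpath 0 (t (n+1))) := by
      rw [← Path.Homotopic.Quotient.mk_trans]
      exact Path.Homotopic.Quotient.eq.2 ⟨Path.Homotopy.subpathTransSubpath γ _ _ _⟩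
    have c3 := trans i j _ h h0
    have key := H.mul_mem c3 hi
    convert key using 1
    rw [FundamentalGroup.mul_def]
    show Path.Homotopic.Quotient.trans _ _ = Path.Homotopic.Quotient.trans (Path.Homotopic.Quotient.trans _ _) (Path.Homotopic.Quotient.trans _ _)
    rw [← c1, ← c2]
    have gen : ∀ (z : X) (e : x0 = z) (w w' : X) (p : HQ z w) (q : HQ w w') (d d' : HQ x0 w),
      ((p.trans q).cast e rfl).trans (d'.trans q).symm = ((p.cast e rfl).trans d.symm).trans (d.trans d'.symm) := by
      intro z e w w' p q d d'
      subst e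
      simp only [Path.Homotopic.Quotient.cast_rfl_rfl]
      let p' : FundamentalGroupoid.mk x0 ⟶ FundamentalGroupoid.mk w := p
      let q' : FundamentalGroupoid.mk w ⟶ FundamentalGroupoid.mk w' := q
      let e' : FundamentalGroupoid.mk x0 ⟶ FundamentalGroupoid.mk w := d
      let e'' : FundamentalGroupoid.mk x0 ⟶ FundamentalGroupoid.mk w := d'
      show (p' ≫ q') ≫ (CategoryTheory.Groupoid.inv (e'' ≫ q')) = (p' ≫ CategoryTheory.Groupoid.inv e') ≫ (e' ≫ CategoryTheory.Groupoid.inv e'')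
      simp only [CategoryTheory.Groupoid.inv_eq_inv, CategoryTheory.IsIso.inv_comp, CategoryTheory.Category.assoc, CategoryTheory.IsIso.hom_inv_id_assoc, CategoryTheory.IsIso.inv_hom_id_assoc]
    exact gen _ _ _ _ _ _ _ _

open CategoryTheory in
theorem genLemma {X : Type*} [TopologicalSpace X] {x0 : X} (H : Subgroup (FundamentalGroup X x0))
    {ι : Type*} (O : ι → Set X) (hO : ∀ i, IsOpen (O i)) (hcov : ∀ x, ∃ i, x ∈ O i)
    (δ : ∀ i q, q ∈ O i → HQ x0 q)
    (compat : ∀ i q q' (h : q ∈ O i) (h' : q' ∈ O i) (γ : Path q q'), (∀ t, γ t ∈ O i) →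
      (δ i q h).trans (.mk γ) = δ i q' h')
    (trans : ∀ i j q h h', (FundamentalGroup.fromPath <| (δ i q h).trans (δ j q h').symm) ∈ H)
    (base : ∃ i h, (FundamentalGroup.fromPath <| δ i x0 h) ∈ H) : H = ⊤ := by
  rw [eq_top_iff]
  intro g _
  induction g using Path.Homotopic.Quotient.ind with
  | mk γ =>
  obtain ⟨t, ht0, htm, ⟨n, hn⟩, htc⟩ := exists_monotone_Icc_subset_open_cover_unitInterval
    (c := fun i => γ ⁻¹' (O i)) (fun i => (hO i).preimage γ.continuous)
    (fun s _ => by simpa using hcov (γ s))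
  obtain ⟨i, h, hi⟩ := GL_aux H O δ compat trans base γ t ht0 htm htc n
  obtain ⟨j, h', hj⟩ := base
  have e1 := hn n le_rfl
  revert h
  rw [e1]
  intro h hi
  rw [γ.subpath_zero_one] at hi
  have gen : ∀ (z : X) (e : x0 = z) (hz : z ∈ O i) (z' : X) (e' : x0 = z') 
     (hh : (FundamentalGroup.fromPath <|
      ((Path.Homotopic.Quotient.mk (γ.cast e'.symm e.symm)).cast e' rfl).trans (δ i z hz).symm) ∈ H),
      (FundamentalGroup.fromPath <| Path.Homotopic.Quotient.mk γ) ∈ H := by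
    intro z e hz z' e' hh
    subst e
    subst e'
    have k1 := trans i j _ hz h'
    have k2 := H.mul_mem (H.mul_mem hj k1) hh
    convert k2 using 1
    simp only [FundamentalGroup.mul_def]
    show _ = Path.Homotopic.Quotient.trans (Path.Homotopic.Quotient.trans _ _) (Path.Homotopic.Quotient.trans (Path.Homotopic.Quotient.trans _ _) _)
    simp only [Path.cast_rfl_rfl, Path.Homotopic.Quotient.cast_rfl_rfl]
    let p' : FundamentalGroupoid.mk x0 ⟶ FundamentalGroupoid.mk x0 := Path.Homotopic.Quotient.mk γ
    let q' : FundamentalGroupoid.mk x0 ⟶ FundamentalGroupoid.mk x0 := δ i x0 hz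
    let e' : FundamentalGroupoid.mk x0 ⟶ FundamentalGroupoid.mk x0 := δ j x0 h'
    show p' = (p' ≫ CategoryTheory.Groupoid.inv q') ≫ ((q' ≫ CategoryTheory.Groupoid.inv e') ≫ e')
    simp
  exact gen _ γ.target.symm h _ γ.source.symm hi

theorem square {X : Type*} [TopologicalSpace X] (S : C(I × I, X)) {a b c d : X}
    (p : Path a b) (q : Path b c) (r : Path a d) (s : Path d c)
    (hp : ∀ t, p t = S (0, t)) (hq : ∀ t, q t = S (t, 1)) (hr : ∀ t, r t = S (t, 0))
    (hs : ∀ t, s t = S (1, t)) :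
    (Path.Homotopic.Quotient.mk p).trans (.mk q) = (Path.Homotopic.Quotient.mk r).trans (.mk s) := by
  have ha : a = S (0, 0) := by rw [← hp, p.source]
  have hb : b = S (0, 1) := by rw [← hp, p.target]
  have hc : c = S (1, 1) := by rw [← hq, q.target]
  have hd : d = S (1, 0) := by rw [← hr, r.target]
  subst ha hb hc hd
  let pr : ℝ → I := Set.projIcc 0 1 zero_le_one
  have hpr : Continuous pr := continuous_projIcc
  have pr0 : ∀ t : I, pr t = t := fun t => Set.projIcc_val _ t
  have pr1 : pr 1 = 1 := pr0 1
  have pr2 : pr 0 = 0 := pr0 0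
  let S' : C(ℝ × ℝ, X) := ⟨fun z => S (pr z.1, pr z.2), by fun_prop⟩
  let p0 : Path ((0:ℝ),(0:ℝ)) (0,1) := ⟨⟨fun t => (0,t), by fun_prop⟩, rfl, rfl⟩
  let q0 : Path ((0:ℝ),(1:ℝ)) (1,1) := ⟨⟨fun t => (t,1), by fun_prop⟩, rfl, rfl⟩
  let r0 : Path ((0:ℝ),(0:ℝ)) (1,0) := ⟨⟨fun t => (t,0), by fun_prop⟩, rfl, rfl⟩
  let s0 : Path ((1:ℝ),(0:ℝ)) (1,1) := ⟨⟨fun t => (1,t), by fun_prop⟩, rfl, rfl⟩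
  have E00 : S (0,0) = S' (0,0) := by simp [S', pr2]
  have E01 : S (0,1) = S' (0,1) := by simp [S', pr1, pr2]
  have E10 : S (1,0) = S' (1,0) := by simp [S', pr1, pr2]
  have E11 : S (1,1) = S' (1,1) := by simp [S', pr1]
  have hom : (p0.trans q0).Homotopic (r0.trans s0) := SimplyConnectedSpace.paths_homotopic _ _
  have hom' := hom.map S'
  simp only [Path.map_trans] at hom'
  have hom2 := hom'.pathCast E00 E11
  have t1 : p.trans q = ((p0.map S'.continuous).trans (q0.map S'.continuous)).cast E00 E11 := by
    have e1 : p = (p0.map S'.continuous).cast E00 E01 := by ext t; simp [S', p0, pr0, pr2, hp]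
    have e2 : q = (q0.map S'.continuous).cast E01 E11 := by ext t; simp [S', q0, pr0, pr1, hq]
    rw [e1, e2]; ext t; simp [Path.trans_apply]
  have t2 : r.trans s = ((r0.map S'.continuous).trans (s0.map S'.continuous)).cast E00 E11 := by
    have e1 : r = (r0.map S'.continuous).cast E00 E10 := by ext t; simp [S', r0, pr0, pr2, hr]
    have e2 : s = (s0.map S'.continuous).cast E10 E11 := by ext t; simp [S', s0, pr0, pr1, hs]
    rw [e1, e2]; ext t; simp [Path.trans_apply]
  rw [← Path.Homotopic.Quotient.mk_trans, ← Path.Homotopic.Quotient.mk_trans, t1, t2]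
  exact Path.Homotopic.Quotient.eq.2 hom2

open Complex
open unitInterval Topology Set

set_option linter.unusedVariables false
set_option linter.unusedSectionVars false
section cl
variable {E : Type*} [TopologicalSpace E] {Y : Set E}

def rst {a b : E} (γ : Path a b) (h : ∀ t, γ t ∈ Y) :
    Path (⟨a, by have := h 0; rwa [γ.source] at this⟩ : Y) ⟨b, by have := h 1; rwa [γ.target] at this⟩ where
  toFun t := ⟨γ t, h t⟩
  continuous_toFun := by fun_prop
  source' := by simp
  target' := by simp

def cl {a b : E} (γ : Path a b) (h : ∀ t, γ t ∈ Y) :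
    HQ (⟨a, by have := h 0; rwa [γ.source] at this⟩ : Y) ⟨b, by have := h 1; rwa [γ.target] at this⟩ :=
  .mk (rst γ h)

theorem mem_trans {a b c : E} {γ : Path a b} {γ' : Path b c} (h : ∀ t, γ t ∈ Y) (h' : ∀ t, γ' t ∈ Y) :
    ∀ t, (γ.trans γ') t ∈ Y := by
  intro t
  rw [Path.trans_apply]
  split_ifs
  · exact h _
  · exact h' _

theorem mem_symm {a b : E} {γ : Path a b} (h : ∀ t, γ t ∈ Y) : ∀ t, γ.symm t ∈ Y := fun t => h _

theorem cl_trans {a b c : E} (γ : Path a b) (γ' : Path b c) (h : ∀ t, γ t ∈ Y) (h' : ∀ t, γ' t ∈ Y) :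
    cl (γ.trans γ') (mem_trans h h') = (cl γ h).trans (cl γ' h') := by
  unfold cl
  rw [← Path.Homotopic.Quotient.mk_trans]
  congr 1
  ext t
  have e1 : ((rst (γ.trans γ') (mem_trans h h')) t : E) = (γ.trans γ') t := rfl
  refine e1.trans ?_
  rw [Path.trans_apply, Path.trans_apply]
  split_ifs <;> rfl

theorem cl_congr {a b : E} {γ γ' : Path a b} (h : ∀ t, γ t ∈ Y) (h' : ∀ t, γ' t ∈ Y)
    (e : ∀ t, γ t = γ' t) : cl γ h = cl γ' h' := by
  have : γ = γ' := by ext t; exact e t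
  subst this; rfl

theorem cl_symm {a b : E} (γ : Path a b) (h : ∀ t, γ t ∈ Y) :
    cl γ.symm (mem_symm h) = (cl γ h).symm := by
  unfold cl
  rw [← Path.Homotopic.Quotient.mk_symm]
  congr 1

theorem cl_htpy {a b : E} {γ γ' : Path a b} (h : ∀ t, γ t ∈ Y) (h' : ∀ t, γ' t ∈ Y)
    (F : I × I → E) (hF : Continuous F) (hY : ∀ z, F z ∈ Y) (h0 : ∀ t, F (0, t) = γ t)
    (h1 : ∀ t, F (1, t) = γ' t) (ha : ∀ s, F (s, 0) = a) (hb : ∀ s, F (s, 1) = b) :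
    cl γ h = cl γ' h' := by
  refine Path.Homotopic.Quotient.eq.2 ⟨⟨⟨⟨fun z => ⟨F z, hY z⟩, by fun_prop⟩, ?_, ?_⟩, ?_⟩⟩
  · intro t; exact Subtype.ext (h0 t)
  · intro t; exact Subtype.ext (h1 t)
  · intro s t ht
    rcases ht with rfl | rfl
    · refine Subtype.ext ?_
      show F (s, 0) = γ 0
      rw [ha, γ.source]
    · refine Subtype.ext ?_
      show F (s, 1) = γ 1
      rw [hb, γ.target]

theorem cl_square (S : I × I → E) (hS : Continuous S) (hY : ∀ z, S z ∈ Y) {a b c d : E}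
    (p : Path a b) (q : Path b c) (r : Path a d) (s : Path d c)
    (hp : ∀ t, p t = S (0, t)) (hq : ∀ t, q t = S (t, 1)) (hr : ∀ t, r t = S (t, 0))
    (hs : ∀ t, s t = S (1, t)) :
    (cl (Y := Y) p (fun t => hp t ▸ hY _)).trans (cl q (fun t => hq t ▸ hY _)) =
    (cl r (fun t => hr t ▸ hY _)).trans (cl s (fun t => hs t ▸ hY _)) := by
  refine square ⟨fun z => ⟨S z, hY z⟩, by fun_prop⟩ _ _ _ _ ?_ ?_ ?_ ?_
  · intro t; exact Subtype.ext (hp t)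
  · intro t; exact Subtype.ext (hq t)
  · intro t; exact Subtype.ext (hr t)
  · intro t; exact Subtype.ext (hs t)

def Mem {e : E} {he : e ∈ Y} (H : Subgroup (FundamentalGroup Y ⟨e, he⟩)) (γ : Path e e) : Prop :=
  ∃ h : ∀ t, γ t ∈ Y, FundamentalGroup.fromPath (cl γ h) ∈ H

theorem isOpen_all {X K : Type*} [TopologicalSpace X] [TopologicalSpace K] [CompactSpace K]
    {W : Set (X × K)} (hW : IsOpen W) : IsOpen {x | ∀ k, (x, k) ∈ W} := by
  have := isClosedMap_fst_of_compactSpace (X := X) (Y := K) _ hW.isClosed_compl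
  rw [← isOpen_compl_iff] at this
  convert this using 1
  ext x
  simp

end cl

section cl2
variable {E : Type*} [NormedAddCommGroup E] [NormedSpace ℂ E] {Y : Set E}

theorem cl_convex [NormedSpace ℝ E] {K : Set E} (hK : Convex ℝ K) (hKY : K ⊆ Y) {a b : E} {γ γ' : Path a b}
    (h : ∀ t, γ t ∈ K) (h' : ∀ t, γ' t ∈ K) :
    cl (Y := Y) γ (fun t => hKY (h t)) = cl γ' (fun t => hKY (h' t)) := by
  refine cl_htpy _ _ (fun z => (1 - (z.1 : ℝ)) • γ z.2 + (z.1 : ℝ) • γ' z.2) (by fun_prop) ?_ ?_ ?_ ?_ ?_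
  · intro z
    exact hKY (hK (h _) (h' _) (by linarith [z.1.2.2]) z.1.2.1 (by ring))
  · intro t; simp
  · intro t; simp
  · intro s; simp [← add_smul]
  · intro s; simp [← add_smul]

noncomputable def sm (κ : Path (0:ℂ) 0) (c : E) : Path (0:E) 0 where
  toFun t := κ t • c
  continuous_toFun := by fun_prop
  source' := by simp
  target' := by simp

noncomputable def sm1 (κ : Path (0:ℂ) 1) (c : E) : Path (0:E) c where
  toFun t := κ t • c
  continuous_toFun := by fun_prop
  source' := by simp
  target' := by simp

@[simp] theorem sm_apply (κ : Path (0:ℂ) 0) (c : E) (t : I) : sm κ c t = κ t • c := rfl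
@[simp] theorem sm1_apply (κ : Path (0:ℂ) 1) (c : E) (t : I) : sm1 κ c t = κ t • c := rfl

theorem cone (κ : Path (0:ℂ) 1) {q q' : E} (γ : Path q q') (h : ∀ s t, κ s • γ t ∈ Y)
    (h1 : ∀ s, sm1 κ q s ∈ Y) (h2 : ∀ t, γ t ∈ Y) (h3 : ∀ s, sm1 κ q' s ∈ Y) :
    (cl (sm1 κ q) h1).trans (cl γ h2) = cl (sm1 κ q') h3 := by
  have := cl_square (Y := Y) (fun z : I × I => κ z.1 • γ z.2) (by fun_prop) (fun z => h _ _)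
    (Path.refl 0) (sm1 κ q') (sm1 κ q) γ (by simp) (by simp) (by simp) (by simp)
  rw [← this]
  have e : cl (Path.refl (0:E)) (Y := Y) (by have := h1 0; simpa using this) = 
    Path.Homotopic.Quotient.refl _ := by
    rw [← Path.Homotopic.Quotient.mk_refl]; rfl
  rw [e, Path.Homotopic.Quotient.refl_trans]

theorem T1 (hYo : IsOpen Y) (h0 : (0:E) ∈ Y) (H : Subgroup (FundamentalGroup Y ⟨0, h0⟩))
    (hH : ∀ (c : E) (κ : Path (0:ℂ) 0), (∀ t, κ t • c ∈ Y) → Mem H (sm κ c))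
    (hstar : ∀ p ∈ Y, ∃ κ : Path (0:ℂ) 1, ∀ t, κ t • p ∈ Y) : H = ⊤ := by
  refine genLemma H (ι := Path (0:ℂ) 1) (fun κ => {p : Y | ∀ t, κ t • p.1 ∈ Y}) ?_ ?_
    (fun κ q hq => cl (sm1 κ q.1) hq) ?_ ?_ ?_
  · intro κ
    exact isOpen_all (K := I) (W := {z : Y × I | κ z.2 • z.1.1 ∈ Y}) (hYo.preimage (by fun_prop))
  · intro p; exact hstar p.1 p.2
  · intro κ q q' h h' γ hγ
    have := cone (Y := Y) κ (γ.map continuous_subtype_val) (fun s t => hγ t s) h (fun t => (γ t).2) h'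
    exact this
  · intro κ κ' q h h'
    have : ∀ t, (κ.trans κ'.symm) t • q.1 ∈ Y := by
      intro t
      have := mem_trans (Y := {z : ℂ | z • q.1 ∈ Y}) (γ := κ) (γ' := κ'.symm) h (fun t => h' _) t
      exact this
    obtain ⟨h2, h3⟩ := hH q.1 (κ.trans κ'.symm) this
    convert h3 using 1
    have e : sm (κ.trans κ'.symm) q.1 = (sm1 κ q.1).trans (sm1 κ' q.1).symm := by
      ext t
      simp only [sm_apply, Path.trans_apply]
      split_ifs <;> simp
    have := cl_trans (Y := Y) (sm1 κ q.1) (sm1 κ' q.1).symm h (mem_symm h')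
    rw [cl_symm (sm1 κ' q.1) h'] at this
    rw [FundamentalGroup.fromPath, FundamentalGroup.fromPath, FundamentalGroup.fromArrow, FundamentalGroup.fromArrow]
    rw [← this]
    exact cl_congr _ _ (fun t => by rw [e])
  · refine ⟨Path.segment 0 1, fun t => by simpa using h0, ?_⟩
    obtain ⟨h2, h3⟩ := hH 0 (Path.refl 0) (by simpa using h0)
    convert h3 using 1
    simp only [FundamentalGroup.fromPath, FundamentalGroup.fromArrow]
    exact cl_congr _ _ (by simp)

theorem Mem.congr {h0 : (0:E) ∈ Y} {H : Subgroup (FundamentalGroup Y ⟨0, h0⟩)} {γ γ' : Path (0:E) 0}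
    (hm : Mem H γ) (F : I × I → E) (hF : Continuous F) (hY : ∀ z, F z ∈ Y) (hh0 : ∀ t, F (0, t) = γ t)
    (hh1 : ∀ t, F (1, t) = γ' t) (ha : ∀ s, F (s, 0) = 0) (hb : ∀ s, F (s, 1) = 0) : Mem H γ' := by
  obtain ⟨h, h'⟩ := hm
  have h2 : ∀ t, γ' t ∈ Y := fun t => by rw [← hh1]; exact hY _
  refine ⟨h2, ?_⟩
  rw [← cl_htpy h h2 F hF hY hh0 hh1 ha hb]
  exact h'

/-- local constancy, used to restrict to generic `c`. -/
theorem T1' (hYo : IsOpen Y) (h0 : (0:E) ∈ Y) (H : Subgroup (FundamentalGroup Y ⟨0, h0⟩)) (D : Set E)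
    (hD : Dense D)
    (hH : ∀ c ∈ D, ∀ (κ : Path (0:ℂ) 0), (∀ t, κ t • c ∈ Y) → Mem H (sm κ c))
    (hstar : ∀ p ∈ Y, ∃ κ : Path (0:ℂ) 1, ∀ t, κ t • p ∈ Y) : H = ⊤ := by
  refine T1 hYo h0 H ?_ hstar
  intro c κ hc
  have ho : IsOpen {c' : E | ∀ z : I × I, κ z.2 • (((z.1:ℝ):ℂ) • c + (1 - ((z.1:ℝ):ℂ)) • c') ∈ Y} :=
    isOpen_all (K := I × I) (W := {w : E × (I × I) | κ w.2.2 • (((w.2.1:ℝ):ℂ) • c + (1 - ((w.2.1:ℝ):ℂ)) • w.1) ∈ Y})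
      (hYo.preimage (by fun_prop))
  obtain ⟨c', hc', hcD⟩ := hD.inter_open_nonempty _ ho ⟨c, fun z => by
    rw [← add_smul]; simpa using hc _⟩
  refine (hH c' hcD κ (fun t => by simpa using hc' (0, t))).congr
    (fun z : I × I => κ z.2 • (((z.1:ℝ):ℂ) • c + (1 - ((z.1:ℝ):ℂ)) • c')) (by fun_prop) hc' ?_ ?_ ?_ ?_
  all_goals intro t; simp

end cl2

set_option linter.unusedVariables false
open Complex
open unitInterval Topology Set

noncomputable def push (Z : Finset ℂ) (δ s : ℝ) (z : ℂ) : ℂ :=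
  z + (s:ℂ) * ∑ a ∈ Z, ((max 0 (δ / ‖z - a‖ - 1) : ℝ) : ℂ) * (z - a)

theorem push_far (Z : Finset ℂ) (δ s : ℝ) (z : ℂ) (hδ : 0 < δ) (h : ∀ a ∈ Z, δ ≤ ‖z - a‖) : push Z δ s z = z := by
  unfold push
  rw [Finset.sum_eq_zero, mul_zero, add_zero]
  intro a ha
  have h1 := h a ha
  have : δ / ‖z - a‖ - 1 ≤ 0 := by
    rw [sub_nonpos, div_le_one (by linarith)]; exact h1
  rw [max_eq_left this]; simp

theorem push_near (Z : Finset ℂ) (δ s : ℝ) (z : ℂ) (hδ : 0 < δ)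
    (sep : ∀ a ∈ Z, ∀ b ∈ Z, a ≠ b → 2 * δ ≤ ‖a - b‖) (hz : z ∉ Z) (hs : 0 ≤ s) (hs1 : s ≤ 1)
    (a : ℂ) (ha : a ∈ Z) (haz : ‖z - a‖ < δ) :
    ‖push Z δ s z - a‖ = ‖z - a‖ + s * (δ - ‖z - a‖) := by
  have hpos : 0 < ‖z - a‖ := by
    rw [norm_pos_iff, sub_ne_zero]; rintro rfl; exact hz ha
  have e : push Z δ s z - a = ((1 + s * (δ / ‖z - a‖ - 1) : ℝ) : ℂ) * (z - a) := by
    unfold push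
    rw [Finset.sum_eq_single a]
    · have : 0 ≤ δ / ‖z - a‖ - 1 := by
        rw [sub_nonneg, one_le_div hpos]; exact haz.le
      rw [max_eq_right this]; push_cast; ring
    · intro b hb hab
      have h1 := sep a ha b hb hab.symm
      have h2 : ‖a - b‖ ≤ ‖z - a‖ + ‖z - b‖ := by
        have := norm_sub_le (z - b) (z - a)
        have e : z - b - (z - a) = a - b := by ring
        rw [e] at this; linarith
      have : δ / ‖z - b‖ - 1 ≤ 0 := by
        rw [sub_nonpos, div_le_one (by linarith)]; linarith
      rw [max_eq_left this]; simp
    · intro h; exact absurd ha h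
  rw [e, norm_mul, Complex.norm_real, Real.norm_of_nonneg]
  · field_simp
  · have : 0 ≤ δ / ‖z - a‖ - 1 := by
        rw [sub_nonneg, one_le_div hpos]; exact haz.le
    positivity

theorem push_notMem (Z : Finset ℂ) (δ s : ℝ) (z : ℂ) (hδ : 0 < δ)
    (sep : ∀ a ∈ Z, ∀ b ∈ Z, a ≠ b → 2 * δ ≤ ‖a - b‖) (hz : z ∉ Z) (hs : 0 ≤ s) (hs1 : s ≤ 1) :
    push Z δ s z ∉ Z := by
  by_cases h : ∀ a ∈ Z, δ ≤ ‖z - a‖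
  · rwa [push_far Z δ s z hδ h]
  · push Not at h
    obtain ⟨a, ha, haz⟩ := h
    have h1 := push_near Z δ s z hδ sep hz hs hs1 a ha haz
    have hpos : 0 < ‖z - a‖ := by
      rw [norm_pos_iff, sub_ne_zero]; rintro rfl; exact hz ha
    intro hm
    by_cases hb : push Z δ s z = a
    · rw [hb] at h1
      simp at h1
      nlinarith
    · have := sep _ hm a ha hb
      nlinarith

theorem push_one (Z : Finset ℂ) (δ : ℝ) (z : ℂ) (hδ : 0 < δ)
    (sep : ∀ a ∈ Z, ∀ b ∈ Z, a ≠ b → 2 * δ ≤ ‖a - b‖) (hz : z ∉ Z) :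
    ∀ b ∈ Z, δ ≤ ‖push Z δ 1 z - b‖ := by
  by_cases h : ∀ a ∈ Z, δ ≤ ‖z - a‖
  · rwa [push_far Z δ 1 z hδ h]
  · push Not at h
    obtain ⟨a, ha, haz⟩ := h
    have h1 := push_near Z δ 1 z hδ sep hz zero_le_one le_rfl a ha haz
    intro b hb
    by_cases hab : a = b
    · subst hab; linarith
    · have h2 := sep _ ha b hb hab
      have h3 : ‖a - b‖ ≤ ‖push Z δ 1 z - a‖ + ‖push Z δ 1 z - b‖ := by
        have := norm_sub_le (push Z δ 1 z - b) (push Z δ 1 z - a)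
        have e : push Z δ 1 z - b - (push Z δ 1 z - a) = a - b := by ring
        rw [e] at this; linarith
      linarith

theorem push_cont (Z : Finset ℂ) (δ : ℝ) (κ : I → ℂ) (hκ : Continuous κ) (h : ∀ t, κ t ∉ Z) :
    Continuous (fun w : I × I => push Z δ w.1 (κ w.2)) := by
  unfold push
  refine Continuous.add (by fun_prop) (Continuous.mul (by fun_prop) ?_)
  refine continuous_finsetSum _ ?_
  intro a ha
  refine Continuous.mul ?_ (by fun_prop)
  refine Complex.continuous_ofReal.comp ?_
  refine continuous_const.max (Continuous.sub (Continuous.div (by fun_prop) (by fun_prop) ?_) (by fun_prop))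
  intro w hw
  rw [norm_eq_zero, sub_eq_zero] at hw
  exact h w.2 (hw ▸ ha)

/-- lower bound for a sextic in terms of distance to its roots. -/
theorem sextic_lower (A P b : ℂ) (hA : A ≠ 0) (δ : ℝ) (hδ : 0 < δ) (z : ℂ)
    (h : ∀ w, w ^ 6 * A + 6 * w ^ 2 * P = b → δ ≤ ‖z - w‖) :
    ‖A‖ * δ ^ 6 ≤ ‖z ^ 6 * A + 6 * z ^ 2 * P - b‖ := by
  let p : Polynomial ℂ := Polynomial.C A * Polynomial.X ^ 6 + Polynomial.C (6 * P) * Polynomial.X ^ 2 - Polynomial.C b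
  have hdeg : p.natDegree = 6 := by
    simp only [p]; compute_degree!
  have hl : p.leadingCoeff = A := by
    rw [Polynomial.leadingCoeff, hdeg]
    simp [p, -map_mul, Polynomial.coeff_C_mul, Polynomial.coeff_X_pow]
  have hp0 : p ≠ 0 := by rw [← Polynomial.leadingCoeff_ne_zero, hl]; exact hA
  have hev : ∀ w, p.eval w = w ^ 6 * A + 6 * w ^ 2 * P - b := by
    intro w; simp [p]; ring
  have hs := IsAlgClosed.splits p
  have hprod := hs.eq_prod_roots
  have hcard : p.roots.card = 6 := by rw [← hs.natDegree_eq_card_roots, hdeg]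
  rw [← hev z, hprod, hl]
  rw [Polynomial.eval_mul, Polynomial.eval_C, norm_mul]
  refine mul_le_mul_of_nonneg_left ?_ (norm_nonneg _)
  rw [Polynomial.eval_multiset_prod, Multiset.map_map]
  have hr : ∀ w ∈ p.roots, δ ≤ ‖z - w‖ := by
    intro w hw
    refine h w ?_
    have := (Polynomial.mem_roots hp0).1 hw
    rw [Polynomial.IsRoot, hev, sub_eq_zero] at this
    exact this
  rw [← hcard]
  clear_value p
  generalize p.roots = m at hr
  induction m using Multiset.induction with
  | empty => simp
  | cons a m ih =>
    simp only [Multiset.card_cons, Multiset.map_cons, Multiset.prod_cons, norm_mul, pow_succ]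
    rw [mul_comm]
    refine mul_le_mul ?_ (ih fun w hw => hr w (Multiset.mem_cons_of_mem hw)) (by positivity) (norm_nonneg _)
    simpa using hr a (Multiset.mem_cons_self _ _)

set_option linter.unusedVariables false
open Complex
open unitInterval Topology Set

def cA (p : ℂ × ℂ) : ℂ := p.1 ^ 6 + p.2 ^ 6
def cP (p : ℂ × ℂ) : ℂ := p.1 * p.2

theorem f_smul (l : ℂ) (p : ℂ × ℂ) : f (l • p) = l ^ 6 * cA p + 6 * l ^ 2 * cP p := by
  simp [f, cA, cP]; ring

theorem f_cont : Continuous f := by unfold f; fun_prop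

theorem f_zero : f 0 = 0 := by simp [f]

theorem sextic_finite (A P b : ℂ) (hA : A ≠ 0) : {w : ℂ | w ^ 6 * A + 6 * w ^ 2 * P = b}.Finite := by
  let p : Polynomial ℂ := Polynomial.C A * Polynomial.X ^ 6 + Polynomial.C (6 * P) * Polynomial.X ^ 2 - Polynomial.C b
  have hl : p.coeff 6 = A := by
    simp [p, -map_mul, Polynomial.coeff_C_mul, Polynomial.coeff_X_pow]
  have hp0 : p ≠ 0 := by rintro h; rw [h] at hl; simp at hl; exact hA hl.symm
  refine (Polynomial.finite_setOfPred_isRoot hp0).subset ?_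
  intro w hw
  have hw : w ^ 6 * A + 6 * w ^ 2 * P = b := hw
  show p.eval w = 0
  simp [p]; rw [← hw]; ring

theorem roots_bdd (B : Set ℂ) (hB : B.Finite) (c : ℝ → ℂ × ℂ) (hc : Continuous c)
    (hA : ∀ τ ∈ Icc (0:ℝ) 1, cA (c τ) ≠ 0) :
    ∃ a0 > 0, ∃ R : ℝ, ∀ τ ∈ Icc (0:ℝ) 1, a0 ≤ ‖cA (c τ)‖ ∧ ∀ l : ℂ, f (l • c τ) ∈ B → ‖l‖ ≤ R := by
  have hcA : Continuous (fun τ => cA (c τ)) := by unfold cA; fun_prop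
  have hcP : Continuous (fun τ => cP (c τ)) := by unfold cP; fun_prop
  obtain ⟨τ0, h0, hmin⟩ := isCompact_Icc.exists_isMinOn (s := Icc (0:ℝ) 1) ⟨0, by simp⟩ hcA.norm.continuousOn
  obtain ⟨τ1, h1, hmax⟩ := isCompact_Icc.exists_isMaxOn (s := Icc (0:ℝ) 1) ⟨0, by simp⟩ hcP.norm.continuousOn
  obtain ⟨M, hM⟩ := hB.isBounded.exists_norm_le
  set a0 := ‖cA (c τ0)‖ with ha0
  have ha0p : 0 < a0 := norm_pos_iff.2 (hA _ h0)
  set Pm := ‖cP (c τ1)‖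
  refine ⟨a0, ha0p, max 1 ((M + 6 * Pm) / a0), ?_⟩
  intro τ hτ
  have k1 : a0 ≤ ‖cA (c τ)‖ := hmin hτ
  have k2 : ‖cP (c τ)‖ ≤ Pm := hmax hτ
  refine ⟨k1, ?_⟩
  intro l hl
  by_cases hl1 : ‖l‖ ≤ 1
  · exact le_max_of_le_left hl1
  push Not at hl1
  refine le_max_of_le_right ?_
  rw [le_div_iff₀ ha0p]
  have h3 := hM _ hl
  rw [f_smul] at h3
  have h4 : ‖l‖ ^ 6 * ‖cA (c τ)‖ ≤ M + 6 * ‖l‖ ^ 2 * ‖cP (c τ)‖ := by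
    have e : l ^ 6 * cA (c τ) = (l ^ 6 * cA (c τ) + 6 * l ^ 2 * cP (c τ)) - 6 * l ^ 2 * cP (c τ) := by ring
    have := norm_sub_le (l ^ 6 * cA (c τ) + 6 * l ^ 2 * cP (c τ)) (6 * l ^ 2 * cP (c τ))
    rw [← e] at this
    simp only [norm_mul, norm_pow] at this h3
    norm_num at this
    linarith
  have hM0 : 0 ≤ M := (norm_nonneg _).trans h3
  have hl2 : 1 ≤ ‖l‖ ^ 2 := one_le_pow₀ hl1.le
  have h5 : ‖l‖ ^ 6 * a0 ≤ ‖l‖ ^ 2 * (M + 6 * Pm) := by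
    calc ‖l‖ ^ 6 * a0 ≤ ‖l‖ ^ 6 * ‖cA (c τ)‖ := by gcongr
      _ ≤ M + 6 * ‖l‖ ^ 2 * ‖cP (c τ)‖ := h4
      _ ≤ ‖l‖ ^ 2 * M + 6 * ‖l‖ ^ 2 * Pm := by gcongr; nlinarith
      _ = _ := by ring
  have h6 : ‖l‖ ^ 4 * a0 ≤ M + 6 * Pm := by
    have : ‖l‖ ^ 2 * (‖l‖ ^ 4 * a0) ≤ ‖l‖ ^ 2 * (M + 6 * Pm) := by
      calc _ = ‖l‖ ^ 6 * a0 := by ring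
        _ ≤ _ := h5
    exact le_of_mul_le_mul_left this (by positivity)
  refine le_trans ?_ h6
  gcongr
  calc ‖l‖ = ‖l‖ ^ 1 := by ring
    _ ≤ ‖l‖ ^ 4 := pow_le_pow_right₀ hl1.le (by norm_num)

theorem roots_sep (B : Set ℂ) (hB : B.Finite) (h0B : (0:ℂ) ∉ B) (c : ℝ → ℂ × ℂ) (hc : Continuous c)
    (R : ℝ) (hR : ∀ τ ∈ Icc (0:ℝ) 1, ∀ l : ℂ, f (l • c τ) ∈ B → ‖l‖ ≤ R)
    (hs : ∀ τ ∈ Icc (0:ℝ) 1, ∀ l : ℂ, f (l • c τ) ∈ B → 6 * l ^ 5 * cA (c τ) + 12 * l * cP (c τ) ≠ 0) :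
    ∃ δ > 0, ∀ τ ∈ Icc (0:ℝ) 1, ∀ l : ℂ, f (l • c τ) ∈ B →
      δ ≤ ‖l‖ ∧ ∀ m : ℂ, f (m • c τ) ∈ B → l ≠ m → 2 * δ ≤ ‖l - m‖ := by
  have hfc := f_cont
  have hcA : Continuous (fun τ => cA (c τ)) := by unfold cA; fun_prop
  have hcP : Continuous (fun τ => cP (c τ)) := by unfold cP; fun_prop
  let K1 : Set (ℝ × ℂ) := (Icc (0:ℝ) 1 ×ˢ Metric.closedBall 0 R) ∩ {z | f (z.2 • c z.1) ∈ B}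
  have hK1 : IsCompact K1 := by
    refine (isCompact_Icc.prod (isCompact_closedBall _ _)).inter_right ?_
    exact hB.isClosed.preimage (f := fun z : ℝ × ℂ => f (z.2 • c z.1)) (by fun_prop)
  let DD : ℝ × ℂ × ℂ → ℂ := fun z =>
    (z.2.1 ^ 5 + z.2.1 ^ 4 * z.2.2 + z.2.1 ^ 3 * z.2.2 ^ 2 + z.2.1 ^ 2 * z.2.2 ^ 3 + z.2.1 * z.2.2 ^ 4 + z.2.2 ^ 5)
      * cA (c z.1) + 6 * (z.2.1 + z.2.2) * cP (c z.1)
  have hDD : Continuous DD := by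
    have h1 : Continuous (fun z : ℝ × ℂ × ℂ => cA (c z.1)) := hcA.comp continuous_fst
    have h2 : Continuous (fun z : ℝ × ℂ × ℂ => cP (c z.1)) := hcP.comp continuous_fst
    simp only [DD]; fun_prop
  let K2 : Set (ℝ × ℂ × ℂ) := (Icc (0:ℝ) 1 ×ˢ (Metric.closedBall 0 R ×ˢ Metric.closedBall 0 R)) ∩
    ({z | (f (z.2.1 • c z.1), f (z.2.2 • c z.1)) ∈ (B ×ˢ B) ∩ {w | w.1 ≠ w.2}} ∪
      ({z | (f (z.2.1 • c z.1), f (z.2.2 • c z.1)) ∈ (B ×ˢ B)} ∩ {z | DD z = 0}))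
  have hK2 : IsCompact K2 := by
    refine (isCompact_Icc.prod ((isCompact_closedBall _ _).prod (isCompact_closedBall _ _))).inter_right ?_
    have hcc : Continuous (fun z : ℝ × ℂ × ℂ => (f (z.2.1 • c z.1), f (z.2.2 • c z.1))) := by fun_prop
    refine IsClosed.union ?_ (IsClosed.inter ?_ ?_)
    · exact ((hB.prod hB).inter_of_left _).isClosed.preimage hcc
    · exact (hB.prod hB).isClosed.preimage hcc
    · exact isClosed_eq hDD continuous_const
  have e1 : ∃ δ > 0, ∀ z ∈ K1, δ ≤ ‖z.2‖ := by
    refine hK1.exists_forall_le' (f := fun z : ℝ × ℂ => ‖z.2‖) (by fun_prop) (a := 0) ?_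
    intro z hz
    rw [norm_pos_iff]
    intro h
    have := hz.2
    simp [h, f_zero] at this
    exact h0B this
  have e2 : ∃ δ > 0, ∀ z ∈ K2, δ ≤ ‖z.2.1 - z.2.2‖ := by
    refine hK2.exists_forall_le' (f := fun z : ℝ × ℂ × ℂ => ‖z.2.1 - z.2.2‖) (by fun_prop) (a := 0) ?_
    intro z hz
    rw [norm_pos_iff, sub_ne_zero]
    intro h
    obtain ⟨hz1, hz2 | hz2⟩ := hz
    · simp [h] at hz2
    · refine hs z.1 hz1.1 z.2.1 hz2.1.1 ?_
      have := hz2.2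
      simp only [DD, mem_ofPred_eq, ← h] at this
      rw [← this]; ring
  obtain ⟨δ1, h1, h1'⟩ := e1
  obtain ⟨δ2, h2, h2'⟩ := e2
  refine ⟨min δ1 (δ2 / 2), by positivity, ?_⟩
  intro τ hτ l hl
  have hlR : l ∈ Metric.closedBall (0:ℂ) R := by simpa using hR τ hτ l hl
  refine ⟨(min_le_left _ _).trans (h1' (τ, l) ⟨⟨hτ, hlR⟩, hl⟩), ?_⟩
  intro m hm hlm
  have hmR : m ∈ Metric.closedBall (0:ℂ) R := by simpa using hR τ hτ m hm
  have h3 : δ2 ≤ ‖l - m‖ := by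
    refine h2' (τ, l, m) ⟨⟨hτ, hlR, hmR⟩, ?_⟩
    by_cases hb : f (l • c τ) = f (m • c τ)
    · right
      refine ⟨⟨hl, hm⟩, ?_⟩
      show DD (τ, l, m) = 0
      have : (l - m) * DD (τ, l, m) = 0 := by
        rw [f_smul, f_smul] at hb
        simp only [DD]
        linear_combination hb
      exact (mul_eq_zero.1 this).resolve_left (sub_ne_zero.2 hlm)
    · left
      exact ⟨⟨hl, hm⟩, hb⟩
  have := min_le_right δ1 (δ2/2)
  linarith

set_option linter.unusedVariables false
open Complex
open unitInterval Topology Set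

def Good {B : Set ℂ} {h0 : (0:ℂ × ℂ) ∈ U B} (H : Subgroup (FundamentalGroup (U B) ⟨0, h0⟩)) (c : ℂ × ℂ) : Prop :=
  ∀ κ : Path (0:ℂ) 0, (∀ t, κ t • c ∈ U B) → Mem H (sm κ c)

theorem T2 (B : Set ℂ) (hB : B.Finite) (h0B : (0:ℂ) ∉ B) (h0 : (0:ℂ × ℂ) ∈ U B)
    (H : Subgroup (FundamentalGroup (U B) ⟨0, h0⟩)) (c : ℝ → ℂ × ℂ) (hc : Continuous c)
    (hA : ∀ τ ∈ Icc (0:ℝ) 1, cA (c τ) ≠ 0)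
    (hs : ∀ τ ∈ Icc (0:ℝ) 1, ∀ l : ℂ, f (l • c τ) ∈ B → 6 * l ^ 5 * cA (c τ) + 12 * l * cP (c τ) ≠ 0)
    (hg : Good H (c 0)) : Good H (c 1) := by
  have hfc := f_cont
  obtain ⟨a0, ha0, R, haR⟩ := roots_bdd B hB c hc hA
  obtain ⟨δ, hδ, hsep⟩ := roots_sep B hB h0B c hc R (fun τ hτ => (haR τ hτ).2) hs
  have huc : UniformContinuousOn (fun z : ℝ × ℂ => f (z.2 • c z.1)) (Icc (0:ℝ) 1 ×ˢ Metric.closedBall 0 R) :=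
    (isCompact_Icc.prod (isCompact_closedBall _ _)).uniformContinuousOn_of_continuous (by fun_prop)
  rw [Metric.uniformContinuousOn_iff] at huc
  obtain ⟨ε, hε, huc⟩ := huc (a0 * δ ^ 6) (by positivity)
  -- away from the roots
  have far : ∀ τ ∈ Icc (0:ℝ) 1, ∀ τ' ∈ Icc (0:ℝ) 1, |τ - τ'| < ε → ∀ z : ℂ,
      (∀ w : ℂ, f (w • c τ) ∈ B → δ ≤ ‖z - w‖) → f (z • c τ') ∉ B := by
    intro τ hτ τ' hτ' hd z hz hb
    have hzR : z ∈ Metric.closedBall (0:ℂ) R := by simpa using (haR τ' hτ').2 z hb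
    have k1 := huc (τ, z) ⟨hτ, hzR⟩ (τ', z) ⟨hτ', hzR⟩ (by
      rw [Prod.dist_eq]; simpa [Real.dist_eq] using hd)
    have k2 := sextic_lower (cA (c τ)) (cP (c τ)) (f (z • c τ')) (hA τ hτ) δ hδ z (by
      intro w hw
      refine hz w ?_
      rw [f_smul, hw]; exact hb)
    rw [← f_smul, ← dist_eq_norm] at k2
    have k3 := (haR τ hτ).1
    have k4 : a0 * δ ^ 6 ≤ ‖cA (c τ)‖ * δ ^ 6 := by gcongr
    simp only at k1
    linarith
  have step : ∀ τ ∈ Icc (0:ℝ) 1, ∀ τ' ∈ Icc (0:ℝ) 1, |τ - τ'| < ε → Good H (c τ) → Good H (c τ') := by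
    intro τ hτ τ' hτ' hd hgood κ hκ
    have hfin : {w : ℂ | f (w • c τ') ∈ B}.Finite := by
      have : {w : ℂ | f (w • c τ') ∈ B} = ⋃ b ∈ B, {w : ℂ | w ^ 6 * cA (c τ') + 6 * w ^ 2 * cP (c τ') = b} := by
        ext w
        simp only [mem_ofPred_eq, mem_iUnion, f_smul]
        simp
      rw [this]
      exact hB.biUnion (fun b _ => sextic_finite _ _ b (hA _ hτ'))
    let Z := hfin.toFinset
    have hZ : ∀ w, w ∈ Z ↔ f (w • c τ') ∈ B := fun w => by simp [Z]
    have hsep' : ∀ a ∈ Z, ∀ b ∈ Z, a ≠ b → 2 * δ ≤ ‖a - b‖ := by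
      intro a ha b hb hab
      exact (hsep τ' hτ' a ((hZ a).1 ha)).2 b ((hZ b).1 hb) hab
    have hκZ : ∀ t, κ t ∉ Z := fun t h => hκ t ((hZ _).1 h)
    have hz0 : ∀ s, push Z δ s 0 = 0 := by
      intro s
      refine push_far Z δ s 0 hδ ?_
      intro a ha
      simpa using (hsep τ' hτ' a ((hZ a).1 ha)).1
    have hpc := push_cont Z δ κ κ.continuous hκZ
    let κ' : Path (0:ℂ) 0 := ⟨⟨fun t => push Z δ 1 (κ t), by
        have : Continuous (fun t : I => ((1:I), t)) := by fun_prop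
        exact hpc.comp this⟩, by simp [hz0], by simp [hz0]⟩
    have hκ' : ∀ t, κ' t = push Z δ 1 (κ t) := fun t => rfl
    have hfar : ∀ t, ∀ w : ℂ, f (w • c τ') ∈ B → δ ≤ ‖κ' t - w‖ := by
      intro t w hw
      exact push_one Z δ (κ t) hδ hsep' (hκZ t) w ((hZ w).2 hw)
    have m1 : Mem H (sm κ' (c τ)) := hgood κ' (fun t => far τ' hτ' τ hτ (by rwa [abs_sub_comm]) _ (hfar t))
    have m2 : Mem H (sm κ' (c τ')) := by
      refine m1.congr (fun z : I × I => κ' z.2 • c (τ + z.1 * (τ' - τ))) (by fun_prop) ?_ ?_ ?_ ?_ ?_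
      · intro z
        have hz1 := z.1.2.1
        have hz2 := z.1.2.2
        have hin : τ + z.1 * (τ' - τ) ∈ Icc (0:ℝ) 1 := by
          have := (convex_Icc (0:ℝ) 1) hτ hτ' (a := 1 - (z.1:ℝ)) (b := (z.1:ℝ)) (by linarith) hz1 (by ring)
          convert this using 1
          simp; ring
        refine far τ' hτ' _ hin ?_ _ (hfar z.2)
        have : τ' - (τ + z.1 * (τ' - τ)) = (1 - z.1) * (τ' - τ) := by ring
        rw [this, abs_mul, abs_sub_comm τ' τ, abs_of_nonneg (by linarith)]
        nlinarith [abs_nonneg (τ - τ')]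
      all_goals intro t; simp
    refine m2.congr (fun z : I × I => push Z δ (1 - (z.1:ℝ)) (κ z.2) • c τ') ?_ ?_ ?_ ?_ ?_ ?_
    · have : Continuous (fun z : I × I => (σ z.1, z.2)) := by fun_prop
      have := hpc.comp this
      have e : (fun z : I × I => push Z δ (1 - (z.1:ℝ)) (κ z.2)) = (fun w : I × I => push Z δ w.1 (κ w.2)) ∘ (fun z : I × I => (σ z.1, z.2)) := by
        ext z; simp
      rw [← e] at this
      fun_prop
    · intro z hz
      have hz1 := z.1.2.1
      have hz2 := z.1.2.2
      exact push_notMem Z δ (1 - z.1) (κ z.2) hδ hsep' (hκZ _) (by linarith) (by linarith) ((hZ _).2 hz)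
    · intro t; simp [hκ']
    · intro t; simp [push]
    · intro t; simp [hz0]
    · intro t; simp [hz0]
  have all : ∀ k : ℕ, Good H (c (min 1 (k * (ε / 2)))) := by
    intro k
    have hin : ∀ k : ℕ, min 1 (k * (ε / 2)) ∈ Icc (0:ℝ) 1 := fun k => ⟨by positivity, min_le_left _ _⟩
    induction k with
    | zero => simpa using hg
    | succ k ih =>
      refine step _ (hin k) _ (hin (k+1)) ?_ ih
      have := abs_min_sub_min_le_max (1:ℝ) (k * (ε/2)) 1 ((k+1 : ℕ) * (ε / 2))
      refine lt_of_le_of_lt this ?_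
      push_cast
      have e : k * (ε/2) - (k+1) * (ε/2) = -(ε/2) := by ring
      have e2 : |ε / 2| = ε / 2 := abs_of_pos (half_pos hε)
      rw [e, abs_neg, e2, sub_self, abs_zero]
      exact max_lt hε (by linarith)
  obtain ⟨k, hk⟩ := exists_nat_ge (1 / (ε / 2))
  have := all k
  rw [min_eq_left] at this
  · exact this
  · rwa [div_le_iff₀ (by positivity)] at hk

set_option linter.unusedVariables false
open Complex
open unitInterval Topology Set

theorem sextic_finite' (A P b : ℂ) (hb : b ≠ 0) : {w : ℂ | w ^ 6 * A + 6 * w ^ 2 * P = b}.Finite := by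
  let p : Polynomial ℂ := Polynomial.C A * Polynomial.X ^ 6 + Polynomial.C (6 * P) * Polynomial.X ^ 2 - Polynomial.C b
  have hl : p.eval 0 = -b := by simp [p]
  have hp0 : p ≠ 0 := by rintro h; rw [h] at hl; simp at hl; exact hb hl
  refine (Polynomial.finite_setOfPred_isRoot hp0).subset ?_
  intro w hw
  have hw : w ^ 6 * A + 6 * w ^ 2 * P = b := hw
  show p.eval w = 0
  simp [p]; rw [← hw]; ring

theorem U_star (B : Set ℂ) (hB : B.Finite) (h0B : (0:ℂ) ∉ B) (p : ℂ × ℂ) (hp : p ∈ U B) :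
    ∃ κ : Path (0:ℂ) 1, ∀ t, κ t • p ∈ U B := by
  have hfin : {w : ℂ | f (w • p) ∈ B}.Finite := by
    have : {w : ℂ | f (w • p) ∈ B} = ⋃ b ∈ B, {w : ℂ | w ^ 6 * cA p + 6 * w ^ 2 * cP p = b} := by
      ext w
      simp only [mem_ofPred_eq, mem_iUnion, f_smul]
      simp
    rw [this]
    exact hB.biUnion (fun b hb => sextic_finite' _ _ b (fun h => h0B (h ▸ hb)))
  have hpc := hfin.countable.isPathConnected_compl_of_one_lt_rank (E := ℂ) (by
    rw [rank_real_complex]; norm_num)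
  obtain ⟨κ, hκ⟩ := hpc.joinedIn 0 (by simpa [f_zero] using h0B) 1 (by simpa [U] using hp)
  exact ⟨κ, fun t => hκ t⟩

theorem U_zero {B : Set ℂ} (h0B : (0:ℂ) ∉ B) : (0 : ℂ × ℂ) ∈ U B := by
  show f 0 ∉ B
  rwa [f_zero]

theorem U_open {B : Set ℂ} (hB : B.Finite) : IsOpen (U B) :=
  hB.isClosed.isOpen_compl.preimage f_cont

theorem U_pc (B : Set ℂ) (hB : B.Finite) (h0B : (0:ℂ) ∉ B) : PathConnectedSpace (U B) := by
  rw [← isPathConnected_iff_pathConnectedSpace]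
  refine ⟨0, U_zero h0B, ?_⟩
  intro p hp
  obtain ⟨κ, hκ⟩ := U_star B hB h0B p hp
  exact ⟨sm1 κ p, hκ⟩

theorem dense_norm_ne : Dense {c : ℂ × ℂ | ‖c.1‖ ≠ ‖c.2‖} := by
  rw [Metric.dense_iff]
  intro c r hr
  by_cases h : ‖c.1‖ = ‖c.2‖
  · obtain ⟨u, hu, hcu⟩ : ∃ u : ℂ, ‖u‖ = 1 ∧ c.1 = ‖c.1‖ * u := by
      refine ⟨Complex.exp (Complex.arg c.1 * Complex.I), ?_, ?_⟩
      · exact Complex.norm_exp_ofReal_mul_I _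
      · exact (Complex.norm_mul_exp_arg_mul_I _).symm
    refine ⟨(c.1 + (r / 2 : ℝ) * u, c.2), ?_, ?_⟩
    · rw [Metric.mem_ball, Prod.dist_eq, dist_eq_norm]
      simp only [add_sub_cancel_left, dist_self, norm_mul, hu, Complex.norm_real]
      rw [Real.norm_of_nonneg (by positivity)]
      simp; linarith
    · show ‖c.1 + (r / 2 : ℝ) * u‖ ≠ ‖c.2‖
      rw [← h]
      have : c.1 + (r / 2 : ℝ) * u = ((‖c.1‖ + r / 2 : ℝ) : ℂ) * u := by
        conv_lhs => rw [hcu]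
        push_cast; ring
      rw [this, norm_mul, hu, Complex.norm_real, Real.norm_of_nonneg (by positivity)]
      intro h2; linarith
  · exact ⟨c, Metric.mem_ball_self hr, h⟩

theorem simple_root (x y b l : ℂ) (hxy : ‖x‖ ≠ ‖y‖) (hb : b ^ 4 = 256)
    (h : f (l • (x, y)) = b) : 6 * l ^ 5 * cA (x, y) + 12 * l * cP (x, y) ≠ 0 := by
  intro h2
  have hb0 : b ≠ 0 := by rintro rfl; norm_num at hb
  have hl : l ≠ 0 := by
    rintro rfl
    simp [f_zero] at h; exact hb0 h.symm
  rw [f_smul] at h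
  simp only [cA, cP] at h h2
  have e1 : l ^ 2 * (x * y) = b / 4 := by
    linear_combination (1/4) * h - (l / 24) * h2
  have e2 : l ^ 6 * (x ^ 6 + y ^ 6) = - b / 2 := by
    linear_combination h - 6 * e1
  have e3 : l ^ 6 * (x * y) ^ 3 = (b / 4) ^ 3 := by rw [← e1]; ring
  have e4 : (b ^ 2 - 16) * (b ^ 2 + 16) = 0 := by linear_combination hb
  have key : ∀ s : ℂ, s ^ 2 = 1 → l ^ 6 * (x ^ 3 + s * y ^ 3) ^ 2 = 0 → False := by
    intro s hs h3
    have h4 : (x ^ 3 + s * y ^ 3) = 0 := by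
      have := (mul_eq_zero.1 h3).resolve_left (pow_ne_zero _ hl)
      exact pow_eq_zero_iff (two_ne_zero) |>.1 this
    have hs1 : ‖s‖ = 1 := by
      have : ‖s‖ ^ 2 = 1 := by rw [← norm_pow, hs, norm_one]
      have h0 := norm_nonneg s
      nlinarith
    have h5 : ‖x‖ ^ 3 = ‖y‖ ^ 3 := by
      have : x ^ 3 = - (s * y ^ 3) := by linear_combination h4
      rw [← norm_pow, this, norm_neg, norm_mul, hs1, one_mul, norm_pow]
    exact hxy ((pow_left_inj₀ (norm_nonneg _) (norm_nonneg _) (by norm_num)).1 h5)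
  rcases mul_eq_zero.1 e4 with h3 | h3
  · refine key 1 (by norm_num) ?_
    linear_combination e2 + 2 * e3 + (b/32) * h3
  · refine key (-1) (by norm_num) ?_
    linear_combination e2 - 2 * e3 - (b/32) * h3

theorem good_scale {B : Set ℂ} {h0 : (0:ℂ × ℂ) ∈ U B} {H : Subgroup (FundamentalGroup (U B) ⟨0, h0⟩)}
    {c : ℂ × ℂ} (hg : Good H c) (x : ℂ) : Good H (x • c) := by
  intro κ hκ
  let κ' : Path (0:ℂ) 0 := ⟨⟨fun t => κ t * x, by fun_prop⟩, by simp, by simp⟩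
  have := hg κ' (fun t => by
    have := hκ t
    rw [smul_smul] at this
    exact this)
  have e : sm κ (x • c) = sm κ' c := by
    ext t <;> simp [κ', mul_assoc]
  rw [e]; exact this

theorem gen_of_axes {B : Set ℂ} (hB : B.Finite) (hB4 : ∀ b ∈ B, b ^ 4 = 256)
    {h0 : (0:ℂ × ℂ) ∈ U B} {H : Subgroup (FundamentalGroup (U B) ⟨0, h0⟩)}
    (h1 : Good H (1, 0)) (h2 : Good H (0, 1)) : H = ⊤ := by
  have h0B : (0:ℂ) ∉ B := by intro h; have := hB4 _ h; norm_num at this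
  refine T1' (U_open hB) h0 H _ dense_norm_ne ?_ (U_star B hB h0B)
  rintro ⟨x, y⟩ hxy
  have hxy : ‖x‖ ≠ ‖y‖ := hxy
  rcases lt_or_gt_of_ne hxy with h | h
  · have hn : ∀ τ ∈ Icc (0:ℝ) 1, ‖(τ:ℂ) * x‖ < ‖y‖ := by
      intro τ hτ
      rw [norm_mul, Complex.norm_real, Real.norm_of_nonneg hτ.1]
      nlinarith [norm_nonneg x, hτ.2]
    have := T2 B hB h0B h0 H (fun τ => ((τ:ℂ) * x, y)) (by fun_prop) ?_ ?_ ?_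
    · simpa [Good] using this
    · intro τ hτ h3
      have h4 := hn τ hτ
      simp only [cA] at h3
      have : ‖(τ:ℂ) * x‖ ^ 6 = ‖y‖ ^ 6 := by
        rw [← norm_pow, ← norm_pow, ← norm_neg]; congr 1; linear_combination -h3
      have h5 : ‖(τ:ℂ) * x‖ ^ 6 < ‖y‖ ^ 6 := by gcongr
      linarith
    · intro τ hτ l hl
      exact simple_root _ _ _ l (hn τ hτ).ne (hB4 _ hl) rfl
    · simpa using good_scale h2 y
  · have hn : ∀ τ ∈ Icc (0:ℝ) 1, ‖(τ:ℂ) * y‖ < ‖x‖ := by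
      intro τ hτ
      rw [norm_mul, Complex.norm_real, Real.norm_of_nonneg hτ.1]
      nlinarith [norm_nonneg y, hτ.2]
    have := T2 B hB h0B h0 H (fun τ => (x, (τ:ℂ) * y)) (by fun_prop) ?_ ?_ ?_
    · simpa [Good] using this
    · intro τ hτ h3
      have h4 := hn τ hτ
      simp only [cA] at h3
      have : ‖(τ:ℂ) * y‖ ^ 6 = ‖x‖ ^ 6 := by
        rw [← norm_pow, ← norm_pow, ← norm_neg]; congr 1; linear_combination -h3
      have h5 : ‖(τ:ℂ) * y‖ ^ 6 < ‖x‖ ^ 6 := by gcongr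
      linarith
    · intro τ hτ l hl
      exact simple_root _ _ _ l (hn τ hτ).ne' (hB4 _ hl) rfl
    · simpa using good_scale h1 x

set_option linter.unusedVariables false
open Complex
open unitInterval Topology Set

noncomputable def wL (ε : ℝ) : ℂ := ⟨1 + ε, ε / 2⟩
noncomputable def wR (ε : ℝ) : ℂ := ⟨1 + ε, -(ε / 2)⟩

noncomputable def tri (ε : ℝ) : Path (0:ℂ) 0 :=
  (Path.segment 0 (wR ε)).trans ((Path.segment (wR ε) (wL ε)).trans (Path.segment (wL ε) 0))

theorem seg_mem {K : Set ℂ} (hK : Convex ℝ K) {a b : ℂ} (ha : a ∈ K) (hb : b ∈ K) (t : I) :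
    Path.segment a b t ∈ K := by
  have : Path.segment a b t ∈ Set.range (Path.segment a b) := ⟨t, rfl⟩
  rw [Path.range_segment] at this
  exact hK.segment_subset ha hb this

theorem sm1_seg (q : ℂ) : sm1 (Path.segment 0 1) q = Path.segment 0 q := by
  ext t
  simp [AffineMap.lineMap_apply]

theorem seg_mul (a b z : ℂ) (t : I) : Path.segment a b t * z = Path.segment (a * z) (b * z) t := by
  simp [AffineMap.lineMap_apply]; ring

theorem convex_div {K : Set ℂ} (hK : Convex ℝ K) (z : ℂ) : Convex ℝ {q : ℂ | q / z ∈ K} := by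
  intro x hx y hy a b ha hb hab
  have := hK hx hy ha hb hab
  show (a • x + b • y) / z ∈ K
  convert this using 1
  simp only [Complex.real_smul]; ring

theorem convex_cone (α β : ℝ) : Convex ℝ {u : ℂ | α * u.re ≤ u.im ∧ u.im ≤ β * u.re} := by
  rintro x ⟨hx1, hx2⟩ y ⟨hy1, hy2⟩ a b ha hb hab
  constructor
  · simp; nlinarith
  · simp; nlinarith

theorem convex_N (ε : ℝ) : Convex ℝ {u : ℂ | 1 < u.re ∧ |u.im| < ε * u.re} := by
  have : {u : ℂ | 1 < u.re ∧ |u.im| < ε * u.re} = 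
    {u : ℂ | 1 < u.re} ∩ ({u : ℂ | 0 < ε * u.re - u.im } ∩ {u : ℂ | 0 < ε * u.re + u.im}) := by
    ext u
    simp only [mem_ofPred_eq, mem_inter_iff, abs_lt]
    constructor
    · rintro ⟨h1, h2, h3⟩; exact ⟨h1, by linarith, by linarith⟩
    · rintro ⟨h1, h2, h3⟩; exact ⟨h1, by linarith, by linarith⟩
  rw [this]
  refine Convex.inter ?_ (Convex.inter ?_ ?_)
  · exact convex_halfSpace_gt ⟨by simp, by simp⟩ 1
  · exact convex_halfSpace_gt (f := fun u : ℂ => ε * u.re - u.im) ⟨by intros; simp; ring, by intros; simp; ring⟩ 0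
  · exact convex_halfSpace_gt (f := fun u : ℂ => ε * u.re + u.im) ⟨by intros; simp; ring, by intros; simp; ring⟩ 0

structure TriCond (Z : Set ℂ) (ε : ℝ) : Prop where
  pos : 0 < ε
  cond : ∀ z ∈ Z, ∀ z' ∈ Z, z' ≠ z → 0 < (z' / z).re → ε * (z' / z).re < |(z' / z).im|

theorem triCond_ev (Z : Set ℂ) (hZ : Z.Finite) (hr : ∀ z ∈ Z, ∀ z' ∈ Z, z' ≠ z → 0 < (z' / z).re → (z' / z).im ≠ 0) :
    ∀ᶠ ε in 𝓝[>] (0:ℝ), TriCond Z ε := by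
  have h1 : ∀ᶠ ε in 𝓝[>] (0:ℝ), ∀ z ∈ Z, ∀ z' ∈ Z, z' ≠ z → 0 < (z' / z).re → ε * (z' / z).re < |(z' / z).im| := by
    rw [Filter.eventually_all_finite hZ]
    intro z hz
    rw [Filter.eventually_all_finite hZ]
    intro z' hz'
    by_cases h : z' ≠ z ∧ 0 < (z' / z).re
    · have h2 := abs_pos.2 (hr z hz z' hz' h.1 h.2)
      have : Filter.Tendsto (fun ε : ℝ => ε * (z' / z).re) (𝓝[>] 0) (𝓝 0) := by
        have : Filter.Tendsto (fun ε : ℝ => ε * (z' / z).re) (𝓝 0) (𝓝 (0 * (z' / z).re)) := by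
          apply Continuous.tendsto; fun_prop
        rw [zero_mul] at this
        exact this.mono_left nhdsWithin_le_nhds
      filter_upwards [this.eventually_lt_const h2] with ε hε _ _
      exact hε
    · exact Filter.Eventually.of_forall (fun ε a b => absurd ⟨a, b⟩ h)
  filter_upwards [h1, self_mem_nhdsWithin] with ε hε h0
  exact ⟨h0, hε⟩

section T3
variable {Z : Set ℂ} {ε : ℝ}

theorem TriCond.N_sub (hε : TriCond Z ε) (h0 : (0:ℂ) ∉ Z) {z : ℂ} (hz : z ∈ Z) :
    {q : ℂ | q / z ∈ {u : ℂ | 1 < u.re ∧ |u.im| < ε * u.re}} ⊆ {q | q ∉ Z} := by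
  rintro q ⟨h1, h2⟩ hq
  have hz0 : z ≠ 0 := fun h => h0 (h ▸ hz)
  by_cases h : q = z
  · rw [h, div_self hz0] at h1; simp at h1
  · have := hε.cond z hz q hq h (by linarith)
    linarith

theorem TriCond.cone_sub (hε : TriCond Z ε) (h0 : (0:ℂ) ∉ Z) {z : ℂ} (hz : z ∈ Z) {α β : ℝ}
    (hαβ : α < β) (hα : -ε ≤ α) (hβ : β ≤ ε) (hne : 0 < α ∨ β < 0) :
    {q : ℂ | q / z ∈ {u : ℂ | α * u.re ≤ u.im ∧ u.im ≤ β * u.re}} ⊆ {q | q ∉ Z} := by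
  rintro q ⟨h1, h2⟩ hq
  have hz0 : z ≠ 0 := fun h => h0 (h ▸ hz)
  have hre : 0 ≤ (q / z).re := by
    by_contra h; push Not at h; nlinarith
  by_cases h : q = z
  · rw [h, div_self hz0] at h1 h2; simp at h1 h2
    rcases hne with h | h <;> linarith
  · rcases hre.lt_or_eq with h3 | h3
    · have := hε.cond z hz q hq h h3
      rw [lt_abs] at this
      rcases this with h4 | h4 <;> nlinarith
    · have : q / z = 0 := by
        apply Complex.ext
        · simp [← h3]
        · rw [← h3] at h1 h2; simp at h1 h2; simp; linarith
      rw [div_eq_zero_iff] at this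
      rcases this with h | h
      · exact h0 (h ▸ hq)
      · exact hz0 h

end T3

set_option linter.unusedVariables false
open Complex
open unitInterval Topology Set

theorem grp_upper {X : Type*} [TopologicalSpace X] {o l q : X} (L : HQ o l) (M : HQ l q) (Q : HQ o q)
    (h : L.trans M = Q) : (L.trans M).trans Q.symm = Path.Homotopic.Quotient.refl o := by
  rw [h, Path.Homotopic.Quotient.trans_symm]

open CategoryTheory in
theorem grp_lower {X : Type*} [TopologicalSpace X] {o l q r : X} (L : HQ o l) (M : HQ l q) (Q : HQ o q)
    (R : HQ o r) (S : HQ r l) (S' : HQ r q) (h : S.trans M = S') (h' : R.trans S' = Q) :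
    (L.trans M).trans Q.symm = (R.trans (S.trans L.symm)).symm := by
  subst h; subst h'
  let L' : FundamentalGroupoid.mk o ⟶ FundamentalGroupoid.mk l := L
  let M' : FundamentalGroupoid.mk l ⟶ FundamentalGroupoid.mk q := M
  let R' : FundamentalGroupoid.mk o ⟶ FundamentalGroupoid.mk r := R
  let S' : FundamentalGroupoid.mk r ⟶ FundamentalGroupoid.mk l := S
  show (L' ≫ M') ≫ (CategoryTheory.Groupoid.inv (R' ≫ S' ≫ M')) = CategoryTheory.Groupoid.inv (R' ≫ S' ≫ CategoryTheory.Groupoid.inv L')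
  simp

open CategoryTheory in
theorem grp_three {X : Type*} [TopologicalSpace X] {o q : X} (L Q M : HQ o q) :
    (L.trans M.symm) = (L.trans Q.symm).trans (Q.trans M.symm) := by
  let L' : FundamentalGroupoid.mk o ⟶ FundamentalGroupoid.mk q := L
  let M' : FundamentalGroupoid.mk o ⟶ FundamentalGroupoid.mk q := M
  let Q' : FundamentalGroupoid.mk o ⟶ FundamentalGroupoid.mk q := Q
  show (L' ≫ CategoryTheory.Groupoid.inv M') = (L' ≫ CategoryTheory.Groupoid.inv Q') ≫ (Q' ≫ CategoryTheory.Groupoid.inv M')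
  simp

open CategoryTheory in
theorem grp_symm {X : Type*} [TopologicalSpace X] {o q : X} (L M : HQ o q) :
    (L.trans M.symm) = (M.trans L.symm).symm := by
  let L' : FundamentalGroupoid.mk o ⟶ FundamentalGroupoid.mk q := L
  let M' : FundamentalGroupoid.mk o ⟶ FundamentalGroupoid.mk q := M
  show (L' ≫ CategoryTheory.Groupoid.inv M') = CategoryTheory.Groupoid.inv (M' ≫ CategoryTheory.Groupoid.inv L') 
  simp

theorem tri_convex {Y K : Set ℂ} (hK : Convex ℝ K) (hKY : K ⊆ Y) {a b c : ℂ} (ha : a ∈ K) (hb : b ∈ K) (hc : c ∈ K)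
    (h1 : ∀ t, Path.segment a b t ∈ Y) (h2 : ∀ t, Path.segment b c t ∈ Y) (h3 : ∀ t, Path.segment a c t ∈ Y) :
    (cl (Path.segment a b) h1).trans (cl (Path.segment b c) h2) = cl (Path.segment a c) h3 := by
  rw [← cl_trans]
  exact cl_convex (Y := Y) hK hKY (mem_trans (fun t => seg_mem hK ha hb t) (fun t => seg_mem hK hb hc t))
    (fun t => seg_mem hK ha hc t)

section T3
variable {Z : Set ℂ} {ε : ℝ}

abbrev NN (z : ℂ) (ε : ℝ) : Set ℂ := {q : ℂ | q / z ∈ {u : ℂ | 1 < u.re ∧ |u.im| < ε * u.re}}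

theorem wL_N {z : ℂ} (hz : z ≠ 0) (hε : 0 < ε) : wL ε * z ∈ NN z ε := by
  simp only [NN, mem_ofPred_eq, mul_div_cancel_right₀ _ hz, wL]
  rw [abs_of_pos (by linarith)]
  constructor <;> nlinarith
theorem wR_N {z : ℂ} (hz : z ≠ 0) (hε : 0 < ε) : wR ε * z ∈ NN z ε := by
  simp only [NN, mem_ofPred_eq, mul_div_cancel_right₀ _ hz, wR]
  rw [abs_neg, abs_of_pos (by linarith)]
  constructor <;> nlinarith

theorem segL (hε : TriCond Z ε) (h0 : (0:ℂ) ∉ Z) {z : ℂ} (hz : z ∈ Z) (t : I) : Path.segment 0 (wL ε * z) t ∈ {q | q ∉ Z} := by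
  have hz0 : z ≠ 0 := fun h => h0 (h ▸ hz)
  have e := hε.pos
  have p : 0 < (ε/2) / (1+ε) := by positivity
  have l : (ε/2) / (1+ε) < ε := by rw [div_lt_iff₀ (by positivity)]; nlinarith
  refine hε.cone_sub h0 hz l (by linarith) le_rfl (Or.inl p) (seg_mem (convex_div (convex_cone _ _) z) ?_ ?_ t)
  · simp
  · simp only [mem_ofPred_eq, mul_div_cancel_right₀ _ hz0, wL]
    constructor
    · rw [div_mul_cancel₀ _ (by positivity)]
    · nlinarith

theorem segR (hε : TriCond Z ε) (h0 : (0:ℂ) ∉ Z) {z : ℂ} (hz : z ∈ Z) (t : I) : Path.segment 0 (wR ε * z) t ∈ {q | q ∉ Z} := by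
  have hz0 : z ≠ 0 := fun h => h0 (h ▸ hz)
  have e := hε.pos
  have p : 0 < (ε/2) / (1+ε) := by positivity
  have l : (ε/2) / (1+ε) < ε := by rw [div_lt_iff₀ (by positivity)]; nlinarith
  refine hε.cone_sub h0 hz (neg_lt_neg l) (by linarith) (by linarith) (Or.inr (by linarith)) (seg_mem (convex_div (convex_cone _ _) z) ?_ ?_ t)
  · simp
  · simp only [mem_ofPred_eq, mul_div_cancel_right₀ _ hz0, wR]
    constructor
    · nlinarith
    · rw [neg_mul, div_mul_cancel₀ _ (by positivity)]

theorem segN (hε : TriCond Z ε) (h0 : (0:ℂ) ∉ Z) {z : ℂ} (hz : z ∈ Z) {a b : ℂ} (ha : a ∈ NN z ε) (hb : b ∈ NN z ε) 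
    (t : I) : Path.segment a b t ∈ {q | q ∉ Z} :=
  hε.N_sub h0 hz (seg_mem (convex_div (convex_N ε) z) ha hb t)

theorem sm_tri (ε : ℝ) (z : ℂ) (t : I) : sm (tri ε) z t = ((Path.segment 0 (wR ε * z)).trans 
    ((Path.segment (wR ε * z) (wL ε * z)).trans (Path.segment 0 (wL ε * z)).symm)) t := by
  rw [Path.segment_symm]
  simp only [sm_apply, tri, Path.trans_apply, smul_eq_mul]
  split_ifs <;> rw [seg_mul] <;> simp

theorem T3key (hε : TriCond Z ε) (h0 : (0:ℂ) ∈ {q | q ∉ Z}) 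
    (H : Subgroup (FundamentalGroup {q : ℂ | q ∉ Z} ⟨0, h0⟩)) {z : ℂ} (hz : z ∈ Z)
    (hH : Mem H (sm (tri ε) z)) {q : ℂ} (hq : q ∈ NN z ε) (hA : ∀ t, Path.segment 0 q t ∈ {q | q ∉ Z}) :
    (FundamentalGroup.fromPath <| ((cl (Path.segment 0 (wL ε * z)) (segL hε h0 hz)).trans 
      (cl (Path.segment (wL ε * z) q) (segN hε h0 hz (wL_N (fun h => h0 (h ▸ hz)) hε.pos) hq))).trans 
      (cl (Path.segment 0 q) hA).symm) ∈ H := by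
  have hz0 : z ≠ 0 := fun h => h0 (h ▸ hz)
  have e := hε.pos
  have p : 0 < (ε/2) / (1+ε) := by positivity
  have l : (ε/2) / (1+ε) < ε := by rw [div_lt_iff₀ (by positivity)]; nlinarith
  have hw : (q / z).im ≠ 0 := by
    intro him
    have hre : 1 < (q / z).re := hq.1
    have e1 : q / z = ((q/z).re : ℂ) := Complex.ext (by simp) (by simp [him])
    have e2 : q = ((q/z).re : ℂ) * z := by rw [← e1]; field_simp
    have := hA ⟨(q/z).re⁻¹, by positivity, inv_le_one_of_one_le₀ hre.le⟩
    apply this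
    have : Path.segment 0 q ⟨(q/z).re⁻¹, by positivity, inv_le_one_of_one_le₀ hre.le⟩ = z := by
      simp only [Path.segment_apply, AffineMap.lineMap_apply]
      simp only [vsub_eq_sub, sub_zero, vadd_eq_add, add_zero, Complex.real_smul]
      have h3 : ((q/z).re : ℂ) ≠ 0 := by norm_cast; positivity
      nth_rewrite 2 [e2]
      push_cast
      field_simp
    rw [this]; exact hz
  obtain ⟨hq1, hq2⟩ := hq
  rw [abs_lt] at hq2
  have hqp : 0 < (q/z).re := by linarith
  rcases lt_or_gt_of_ne hw with h | h
  · rw [grp_lower (R := cl (Path.segment 0 (wR ε * z)) (segR hε h0 hz)) 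
      (S := cl (Path.segment (wR ε * z) (wL ε * z)) (segN hε h0 hz (wR_N hz0 e) (wL_N hz0 e)))
      (S' := cl (Path.segment (wR ε * z) q) (segN hε h0 hz (wR_N hz0 e) ⟨hq1, abs_lt.2 hq2⟩))]
    · obtain ⟨hh, hm⟩ := hH
      have h2 := H.inv_mem hm
      rw [FundamentalGroup.inv_def] at h2
      convert h2 using 1
      simp only [FundamentalGroup.fromPath, FundamentalGroup.fromArrow]
      congr 1
      rw [← cl_symm, ← cl_trans, ← cl_trans]
      exact cl_congr _ _ (fun t => (sm_tri ε z t).symm)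
    · exact tri_convex (convex_div (convex_N ε) z) (hε.N_sub h0 hz) (wR_N hz0 e) (wL_N hz0 e) ⟨hq1, abs_lt.2 hq2⟩ _ _ _
    · have m1 : min ((ε/2)/(1+ε)) (-(q/z).im / (q/z).re) < ε := lt_of_le_of_lt (min_le_left _ _) l
      have m2 : 0 < min ((ε/2)/(1+ε)) (-(q/z).im / (q/z).re) := lt_min p (by apply div_pos <;> linarith)
      refine tri_convex (convex_div (convex_cone (-ε) (-min ((ε/2)/(1+ε)) (-(q/z).im / (q/z).re))) z) 
        (hε.cone_sub h0 hz (neg_lt_neg m1) le_rfl (by linarith) (Or.inr (by linarith)))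
        ?_ ?_ ?_ _ _ _
      · simp
      · simp only [mem_ofPred_eq, mul_div_cancel_right₀ _ hz0, wR]
        constructor
        · nlinarith
        · have := min_le_left ((ε/2)/(1+ε)) (-(q/z).im / (q/z).re)
          rw [le_div_iff₀ (by positivity)] at this
          linarith
      · simp only [mem_ofPred_eq]
        constructor
        · linarith
        · have := min_le_right ((ε/2)/(1+ε)) (-(q/z).im / (q/z).re)
          rw [le_div_iff₀ hqp] at this
          linarith
  · rw [grp_upper]
    · exact H.one_mem
    · have m1 : min ((ε/2)/(1+ε)) ((q/z).im / (q/z).re) < ε := lt_of_le_of_lt (min_le_left _ _) l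
      have m2 : 0 < min ((ε/2)/(1+ε)) ((q/z).im / (q/z).re) := lt_min p (by apply div_pos <;> linarith)
      refine tri_convex (convex_div (convex_cone (min ((ε/2)/(1+ε)) ((q/z).im / (q/z).re)) ε) z) 
        (hε.cone_sub h0 hz m1 (by linarith) le_rfl (Or.inl (by linarith)))
        ?_ ?_ ?_ _ _ _
      · simp
      · simp only [mem_ofPred_eq, mul_div_cancel_right₀ _ hz0, wL]
        constructor
        · have := min_le_left ((ε/2)/(1+ε)) ((q/z).im / (q/z).re)
          rw [le_div_iff₀ (by positivity)] at this
          linarith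
        · nlinarith
      · simp only [mem_ofPred_eq]
        constructor
        · have := min_le_right ((ε/2)/(1+ε)) ((q/z).im / (q/z).re)
          rw [le_div_iff₀ hqp] at this
          linarith
        · linarith

theorem T3 (hZ : Z.Finite) (hε : TriCond Z ε) (h0 : (0:ℂ) ∈ {q | q ∉ Z}) 
    (H : Subgroup (FundamentalGroup {q : ℂ | q ∉ Z} ⟨0, h0⟩)) 
    (hH : ∀ z ∈ Z, Mem H (sm (tri ε) z)) : H = ⊤ := by
  have hYo : IsOpen {q : ℂ | q ∉ Z} := hZ.isClosed.isOpen_compl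
  have hNo : ∀ z : ℂ, IsOpen (NN z ε) := by
    intro z
    have c1 : Continuous fun q : ℂ => (q / z).re := by fun_prop
    have c2 : Continuous fun q : ℂ => (q / z).im := by fun_prop
    exact (isOpen_lt continuous_const c1).inter (isOpen_lt c2.abs (continuous_const.mul c1))
  have hz0 : ∀ z ∈ Z, z ≠ 0 := fun z hz h => h0 (h ▸ hz)
  refine genLemma H (ι := Option Z) (fun i => match i with 
    | none => {p | ∀ t, Path.segment 0 p.1 t ∈ {q : ℂ | q ∉ Z}}
    | some z => {p | p.1 ∈ NN z.1 ε}) ?_ ?_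
    (fun i p => match i with
      | none => fun h => cl (Path.segment 0 p.1) h
      | some z => fun h => (cl (Path.segment 0 (wL ε * z)) (segL hε h0 z.2)).trans 
          (cl (Path.segment (wL ε * z) p.1) (segN hε h0 z.2 (wL_N (hz0 z.1 z.2) hε.pos) h))) ?_ ?_ ?_
  · rintro (_ | z)
    · exact isOpen_all (K := I) (W := {z : {q : ℂ | q ∉ Z} × I | Path.segment 0 z.1.1 z.2 ∈ {q : ℂ | q ∉ Z}}) 
        (hYo.preimage (by simp only [Path.segment_apply, AffineMap.lineMap_apply]; simp only [vsub_eq_sub, sub_zero, vadd_eq_add, add_zero]; fun_prop))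
    · exact (hNo z.1).preimage continuous_subtype_val
  · intro p
    by_cases h : ∀ t, Path.segment 0 p.1 t ∈ {q : ℂ | q ∉ Z}
    · exact ⟨none, h⟩
    · push Not at h
      obtain ⟨t, ht⟩ := h
      simp only [mem_ofPred_eq, not_not] at ht
      refine ⟨some ⟨_, ht⟩, ?_⟩
      have e : Path.segment 0 p.1 t = ((t:ℝ):ℂ) * p.1 := by
        simp [AffineMap.lineMap_apply]
      have ht0 : (t:ℝ) ≠ 0 := by
        intro h
        apply hz0 _ ht
        rw [e, h]; simp
      have hp0 : p.1 ≠ 0 := by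
        intro h
        apply hz0 _ ht
        rw [e, h]; simp
      have ht1 : (t:ℝ) ≠ 1 := by
        intro h
        apply p.2
        rw [e, h] at ht; simpa using ht
      have ht2 : (t:ℝ) < 1 := lt_of_le_of_ne t.2.2 ht1
      have ht3 : 0 < (t:ℝ) := lt_of_le_of_ne t.2.1 ht0.symm
      show p.1 / (Path.segment 0 p.1 t) ∈ {u : ℂ | 1 < u.re ∧ |u.im| < ε * u.re}
      have e2 : p.1 / (Path.segment 0 p.1 t) = (((t:ℝ)⁻¹ : ℝ) : ℂ) := by
        rw [e]; push_cast
        have : ((t:ℝ):ℂ) ≠ 0 := by exact_mod_cast ht0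
        field_simp
      rw [e2]
      constructor
      · rw [Complex.ofReal_re]; exact (one_lt_inv₀ ht3).2 ht2
      · rw [Complex.ofReal_re, Complex.ofReal_im, abs_zero]; exact mul_pos hε.pos (inv_pos.2 ht3)
  · rintro (_ | z) q q' h h' γ hγ
    · have := cone (Y := {q : ℂ | q ∉ Z}) (Path.segment 0 1) (γ.map continuous_subtype_val) (fun s t => by
        have := hγ t s
        rwa [← sm1_seg] at this) (by rw [sm1_seg]; exact h) (fun t => (γ t).2) (by rw [sm1_seg]; exact h')
      have e1 : ∀ (r : {q : ℂ | q ∉ Z}) h h', cl (Y := {q : ℂ | q ∉ Z}) (sm1 (Path.segment 0 1) r.1) h = cl (Path.segment 0 r.1) h' := fun r h h' => cl_congr _ _ (fun t => by rw [sm1_seg])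
      rw [e1 q _ h, e1 q' _ h'] at this
      exact this
    · show Path.Homotopic.Quotient.trans (Path.Homotopic.Quotient.trans _ _) _ = _
      rw [Path.Homotopic.Quotient.trans_assoc]
      congr 1
      have e : (Path.Homotopic.Quotient.mk γ : HQ q q') = cl (γ.map continuous_subtype_val) (fun t => (γ t).2) := rfl
      rw [e]
      have := cl_trans (Y := {q : ℂ | q ∉ Z}) (Path.segment (wL ε * z) q.1) (γ.map continuous_subtype_val) 
        (segN hε h0 z.2 (wL_N (hz0 z.1 z.2) hε.pos) h) (fun t => (γ t).2)
      refine this.symm.trans ?_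
      exact cl_convex (Y := {q : ℂ | q ∉ Z}) (convex_div (convex_N ε) z) (hε.N_sub h0 z.2)
        (mem_trans (fun t => seg_mem (convex_div (convex_N ε) z) (wL_N (hz0 z.1 z.2) hε.pos) h t) (fun t => hγ t))
        (fun t => seg_mem (convex_div (convex_N ε) z) (wL_N (hz0 z.1 z.2) hε.pos) h' t)
  · have k1 : ∀ (z : Z) (q : {q : ℂ | q ∉ Z}) (h : q.1 ∈ NN z.1 ε) (h' : ∀ t, Path.segment 0 q.1 t ∈ {q : ℂ | q ∉ Z}), _ :=
      fun z q h h' => T3key hε h0 H z.2 (hH z.1 z.2) h h'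
    rintro (_ | z) (_ | z') q h h'
    · rw [Path.Homotopic.Quotient.trans_symm]
      exact H.one_mem
    · have := H.inv_mem (k1 z' q h' h)
      rw [FundamentalGroup.inv_def] at this
      rw [grp_symm]; exact this
    · exact k1 z q h h'
    · by_cases hA : ∀ t, Path.segment 0 q.1 t ∈ {q : ℂ | q ∉ Z}
      · have a1 := k1 z q h hA
        have a2 := H.inv_mem (k1 z' q h' hA)
        have := H.mul_mem a2 a1
        rw [FundamentalGroup.inv_def, FundamentalGroup.mul_def] at this
        rw [grp_three (Q := cl (Path.segment 0 q.1) hA)]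
        rw [grp_symm (cl (Path.segment 0 q.1) hA)]
        exact this
      · have : z = z' := by
          push Not at hA
          obtain ⟨t, ht⟩ := hA
          simp only [mem_ofPred_eq, not_not] at ht
          have e : Path.segment 0 q.1 t = ((t:ℝ):ℂ) * q.1 := by
            simp [AffineMap.lineMap_apply]
          have gen : ∀ z : Z, q.1 ∈ NN z.1 ε → Path.segment 0 q.1 t = z.1 := by
            intro z h
            by_contra hne
            have e2 : Path.segment 0 q.1 t / z.1 = ((t:ℝ):ℂ) * (q.1/z.1) := by rw [e]; ring
            have ht3 : 0 < (t:ℝ) := lt_of_le_of_ne t.2.1 (fun h => hz0 _ ht (by rw [e, ← h]; simp))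
            have h1 : 1 < (q.1/z.1).re := h.1
            have h2 : |(q.1/z.1).im| < ε * (q.1/z.1).re := h.2
            have := hε.cond z.1 z.2 _ ht hne (by rw [e2, Complex.re_ofReal_mul]; apply mul_pos ht3; linarith)
            rw [e2, Complex.re_ofReal_mul, Complex.im_ofReal_mul, abs_mul, abs_of_pos ht3] at this
            nlinarith
          exact Subtype.ext ((gen z h).symm.trans (gen z' h'))
        subst this
        rw [Path.Homotopic.Quotient.trans_symm]
        exact H.one_mem
  · refine ⟨none, fun t => by simpa using h0, ?_⟩
    have : cl (Y := {q : ℂ | q ∉ Z}) (Path.segment 0 0) (fun t => by simpa using h0) = Path.Homotopic.Quotient.refl _ := by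
      rw [← Path.Homotopic.Quotient.mk_refl]
      have := cl_congr (Y := {q : ℂ | q ∉ Z}) (γ := Path.segment 0 0) (γ' := Path.refl 0) (fun t => by simpa using h0) (fun t => by simpa using h0) (by simp)
      rw [this]; rfl
    show FundamentalGroup.fromPath (cl _ _) ∈ H
    rw [this]
    exact H.one_mem

end T3

set_option linter.unusedVariables false
open Complex
open unitInterval Topology Set

theorem good_of_tri {B : Set ℂ} (hB : B.Finite) {h0 : (0:ℂ × ℂ) ∈ U B} {H : Subgroup (FundamentalGroup (U B) ⟨0, h0⟩)}
    (c : ℂ × ℂ) (hc : ∀ q : ℂ, f (q • c) = q ^ 6) (ε : ℝ) (hε : TriCond {q : ℂ | q ^ 6 ∈ B} ε)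
    (hH : ∀ z : ℂ, z ^ 6 ∈ B → Mem H (sm (tri ε) (z • c))) : Good H c := by
  have h0B : (0:ℂ) ∉ B := by
    have : f 0 ∉ B := h0
    rwa [f_zero] at this
  have h0' : (0:ℂ) ∈ {q : ℂ | q ∉ {q : ℂ | q ^ 6 ∈ B}} := by simpa using h0B
  have hZ : {q : ℂ | q ^ 6 ∈ B}.Finite := by
    have : {q : ℂ | q ^ 6 ∈ B} = ⋃ b ∈ B, {w : ℂ | w ^ 6 * 1 + 6 * w ^ 2 * 0 = b} := by
      ext w; simp
    rw [this]
    exact hB.biUnion (fun b hb => sextic_finite' _ _ _ (fun h => h0B (h ▸ hb)))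
  let φ : C({q : ℂ | q ∉ {q : ℂ | q ^ 6 ∈ B}}, U B) := ⟨fun q => ⟨q.1 • c, by
    show f (q.1 • c) ∉ B
    rw [hc]; exact q.2⟩, by fun_prop⟩
  have hφ : φ ⟨0, h0'⟩ = ⟨0, h0⟩ := Subtype.ext (zero_smul ℂ c)
  have key : ∀ κ : Path (0:ℂ) 0, Mem (H.comap (FundamentalGroup.mapOfEq φ hφ)) κ ↔ Mem H (sm κ c) := by
    intro κ
    have hh : (∀ t, κ t ∈ {q : ℂ | q ∉ {q : ℂ | q ^ 6 ∈ B}}) ↔ (∀ t, sm κ c t ∈ U B) := by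
      apply forall_congr'
      intro t
      show _ ↔ f (κ t • c) ∉ B
      rw [hc]; rfl
    have e : ∀ h h', FundamentalGroup.mapOfEq φ hφ (FundamentalGroup.fromPath (cl κ h)) =
        FundamentalGroup.fromPath (cl (sm κ c) h') := by
      intro h h'
      rw [FundamentalGroup.mapOfEq_apply]
      show ((Path.Homotopic.Quotient.mk _).map φ).cast _ _ = Path.Homotopic.Quotient.mk _
      rw [← Path.Homotopic.Quotient.mk_map, ← Path.Homotopic.Quotient.mk_cast]
      rfl
    constructor
    · rintro ⟨h, h'⟩
      refine ⟨hh.1 h, ?_⟩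
      rw [Subgroup.mem_comap, e h (hh.1 h)] at h'
      exact h'
    · rintro ⟨h, h'⟩
      refine ⟨hh.2 h, ?_⟩
      rw [Subgroup.mem_comap, e (hh.2 h) h]
      exact h'
  have top := T3 hZ hε h0' (H.comap (FundamentalGroup.mapOfEq φ hφ)) (by
    intro z hz
    have h1 := (key (sm (tri ε) z)).2 (by
      obtain ⟨h, h'⟩ := hH z hz
      have e : sm (tri ε) (z • c) = sm (sm (tri ε) z) c := by
        ext t <;> simp [mul_assoc]
      rw [← e]
      exact ⟨h, h'⟩)
    exact h1)
  intro κ hκ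
  rw [← key]
  refine ⟨fun t => ?_, ?_⟩
  · have := hκ t
    change f _ ∉ B at this
    rw [hc] at this
    exact this
  · rw [top]; trivial

set_option linter.unusedVariables false
open Complex
open unitInterval Topology Set

theorem seg_re (a b : ℂ) (t : I) : (Path.segment a b t).re = a.re + (t:ℝ) * (b.re - a.re) := by
  simp [AffineMap.lineMap_apply]; ring
theorem seg_im (a b : ℂ) (t : I) : (Path.segment a b t).im = a.im + (t:ℝ) * (b.im - a.im) := by
  simp [AffineMap.lineMap_apply]; ring

theorem tri_near {ε : ℝ} (hε : 0 < ε) (t : I) : (∃ s : I, dist (tri ε t) ((s:ℝ):ℂ) ≤ 2 * ε) ∧ tri ε t ≠ 1 ∧ tri ε t ≠ -1 := by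
  have cvx : Convex ℝ {w : ℂ | ∃ s : I, dist w ((s:ℝ):ℂ) ≤ 2 * ε} := by
    rintro x ⟨s, hs⟩ y ⟨s', hs'⟩ a b ha hb hab
    refine ⟨⟨a * s + b * s', ?_, ?_⟩, ?_⟩
    · have := s.2.1; have := s'.2.1; positivity
    · have := s.2.2; have := s'.2.2; nlinarith
    · rw [dist_eq_norm] at *
      have : a • x + b • y - ((a * (s:ℝ) + b * (s':ℝ) : ℝ) : ℂ) = a • (x - ((s:ℝ):ℂ)) + b • (y - ((s':ℝ):ℂ)) := by
        simp only [Complex.real_smul]; push_cast; ring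
      show ‖a • x + b • y - ((a * (s:ℝ) + b * (s':ℝ) : ℝ) : ℂ)‖ ≤ _
      rw [this]
      refine (norm_add_le _ _).trans ?_
      rw [norm_smul, norm_smul, Real.norm_of_nonneg ha, Real.norm_of_nonneg hb]
      nlinarith
  have w1 : wL ε ∈ {w : ℂ | ∃ s : I, dist w ((s:ℝ):ℂ) ≤ 2 * ε} := by
    refine ⟨1, ?_⟩
    rw [dist_eq_norm]
    refine (Complex.norm_le_abs_re_add_abs_im _).trans ?_
    simp [wL, abs_of_pos hε, abs_of_pos (half_pos hε)]; linarith
  have w2 : wR ε ∈ {w : ℂ | ∃ s : I, dist w ((s:ℝ):ℂ) ≤ 2 * ε} := by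
    refine ⟨1, ?_⟩
    rw [dist_eq_norm]
    refine (Complex.norm_le_abs_re_add_abs_im _).trans ?_
    simp [wR, abs_of_pos hε, abs_of_pos (half_pos hε)]; linarith
  have w0 : (0:ℂ) ∈ {w : ℂ | ∃ s : I, dist w ((s:ℝ):ℂ) ≤ 2 * ε} := ⟨0, by simp; linarith⟩
  refine ⟨mem_trans (fun t => seg_mem cvx w0 w2 t) (mem_trans (fun t => seg_mem cvx w2 w1 t) (fun t => seg_mem cvx w1 w0 t)) t, ?_⟩
  have k : ∀ t, tri ε t ∈ {w : ℂ | w ≠ 1 ∧ w ≠ -1} := by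
    refine mem_trans ?_ (mem_trans ?_ ?_)
    · intro t
      have ht := t.2.1
      have ht1 := t.2.2
      constructor
      · intro h
        have h1 := congrArg Complex.re h
        have h2 := congrArg Complex.im h
        rw [seg_re] at h1
        rw [seg_im] at h2
        simp [wR] at h1 h2
        rcases h2 with h2 | h2
        · rw [h2] at h1; simp at h1
        · linarith
      · intro h
        have h1 := congrArg Complex.re h
        rw [seg_re] at h1
        simp [wR] at h1
        nlinarith
    · intro t
      constructor
      · intro h
        have h1 := congrArg Complex.re h
        rw [seg_re] at h1
        simp [wR, wL] at h1
        linarith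
      · intro h
        have h1 := congrArg Complex.re h
        rw [seg_re] at h1
        simp [wR, wL] at h1
        linarith
    · intro t
      have ht := t.2.1
      have ht1 := t.2.2
      constructor
      · intro h
        have h1 := congrArg Complex.re h
        have h2 := congrArg Complex.im h
        rw [seg_re] at h1
        rw [seg_im] at h2
        simp [wL] at h1 h2
        have : (t:ℝ) = 1 := by
          have : ε / 2 * (1 - (t:ℝ)) = 0 := by linarith
          rcases mul_eq_zero.1 this with h | h <;> linarith
        rw [this] at h1; simp at h1
      · intro h
        have h1 := congrArg Complex.re h
        rw [seg_re] at h1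
        simp [wL] at h1
        nlinarith
  exact k t

def Eqv (B : Set ℂ) (p q : ℂ × ℂ) : Prop := ∀ᶠ ε in 𝓝[>] (0:ℝ), (∀ t, sm (tri ε) p t ∈ U B) ∧
  ∀ (h0 : (0:ℂ × ℂ) ∈ U B) (H : Subgroup (FundamentalGroup (U B) ⟨0, h0⟩)), Mem H (sm (tri ε) p) → Mem H (sm (tri ε) q)

theorem cA_cont : Continuous cA := by unfold cA; fun_prop
theorem cP_cont : Continuous cP := by unfold cP; fun_prop

theorem core (b b' : ℂ) (c : I → ℂ × ℂ) (hc : Continuous c) (hb : ∀ τ, cA (c τ) + 6 * cP (c τ) = b)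
    (h1 : ∀ τ, ∀ l : I, cA (c τ) * (((l:ℝ):ℂ)^4 + ((l:ℝ):ℂ)^2 + 1) + 6 * cP (c τ) ≠ 0)
    (h2 : ∀ τ, ∀ l : I, f (((l:ℝ):ℂ) • c τ) ≠ b') : Eqv {b, b'} (c 0) (c 1) := by
  have hAc : Continuous fun τ => cA (c τ) := cA_cont.comp hc
  have hPc : Continuous fun τ => cP (c τ) := cP_cont.comp hc
  let W : Set ℂ := {w | ∀ τ : I, (w, τ) ∈ {z : ℂ × I | cA (c z.2) * (z.1^4 + z.1^2 + 1) + 6 * cP (c z.2) ≠ 0 ∧ f (z.1 • c z.2) ≠ b'}}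
  have hW : IsOpen W := by
    apply isOpen_all
    apply IsOpen.inter
    · have : Continuous fun z : ℂ × I => cA (c z.2) * (z.1^4 + z.1^2 + 1) + 6 * cP (c z.2) := by
        have := hAc.comp (continuous_snd (X := ℂ) (Y := I))
        have := hPc.comp (continuous_snd (X := ℂ) (Y := I))
        simp only [Function.comp_def] at *
        fun_prop
      exact isOpen_ne_fun this continuous_const
    · have : Continuous fun z : ℂ × I => f (z.1 • c z.2) := f_cont.comp (by fun_prop)
      exact isOpen_ne_fun this continuous_const
  have hK : IsCompact (Set.range fun s : I => ((s:ℝ):ℂ)) := isCompact_range (by fun_prop)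
  have hKW : (Set.range fun s : I => ((s:ℝ):ℂ)) ⊆ W := by
    rintro _ ⟨s, rfl⟩ τ
    exact ⟨h1 τ s, h2 τ s⟩
  obtain ⟨δ, hδ, hδW⟩ := hK.exists_thickening_subset_open hW hKW
  have hev : ∀ᶠ ε in 𝓝[>] (0:ℝ), ε < δ / 2 := 
    nhdsWithin_le_nhds (Iio_mem_nhds (by positivity))
  have main : ∀ᶠ ε in 𝓝[>] (0:ℝ), ∀ t τ, tri ε t • c τ ∈ U {b, b'} := by
    filter_upwards [hev, self_mem_nhdsWithin] with ε hε hpos t τ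
    obtain ⟨⟨s, hs⟩, n1, n2⟩ := tri_near hpos t
    have hw : tri ε t ∈ W := hδW (Metric.mem_thickening_iff.2 ⟨_, ⟨s, rfl⟩, by linarith⟩)
    obtain ⟨a1, a2⟩ := hw τ
    show f _ ∉ _
    simp only [mem_insert_iff, mem_singleton_iff, not_or]
    refine ⟨?_, a2⟩
    intro h
    rw [f_smul, ← hb τ] at h
    have : (tri ε t - 1) * ((tri ε t + 1) * (cA (c τ) * (tri ε t^4 + tri ε t^2 + 1) + 6 * cP (c τ))) = 0 := by
      linear_combination h
    rcases mul_eq_zero.1 this with h | h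
    · exact n1 (sub_eq_zero.1 h)
    · rcases mul_eq_zero.1 h with h | h
      · exact n2 (eq_neg_of_add_eq_zero_left h)
      · exact a1 h
  filter_upwards [main] with ε hm
  refine ⟨fun t => hm t 0, fun h0 H hM => ?_⟩
  refine hM.congr (fun z : I × I => tri ε z.2 • c z.1) (by fun_prop) (fun z => hm _ _) ?_ ?_ ?_ ?_
  all_goals intro t; simp

def SS : Set (ℂ × ℂ) := {p | f p = 4 ∧ (cP p).im ≤ 0 ∧ ((cP p).im < 0 ∨ (cP p).re < 1)}

theorem SS_core {p : ℂ × ℂ} (hp : p ∈ SS) : cA p + 6 * cP p = 4 ∧ 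
    (∀ l : I, cA p * (((l:ℝ):ℂ)^4 + ((l:ℝ):ℂ)^2 + 1) + 6 * cP p ≠ 0) ∧
    (∀ l : I, f (((l:ℝ):ℂ) • p) ≠ 4 * Complex.I) := by
  obtain ⟨h1, h2, h3⟩ := hp
  have e : cA p + 6 * cP p = 4 := by
    have := f_smul 1 p
    rw [one_smul, h1] at this
    rw [this]; ring
  have eA : cA p = 4 - 6 * cP p := by linear_combination e
  refine ⟨e, fun l h => ?_, fun l h => ?_⟩
  · obtain ⟨l, hl0, hl1⟩ := l
    simp only at h
    rw [eA] at h
    have h' : (((4 * (l^4+l^2+1) : ℝ)):ℂ) - (((6 * (l^4 + l^2)) : ℝ) : ℂ) * cP p = 0 := by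
      push_cast; linear_combination h
    have r := congrArg Complex.re h'
    have i := congrArg Complex.im h'
    simp only [Complex.sub_re, Complex.sub_im, Complex.re_ofReal_mul, Complex.im_ofReal_mul, Complex.ofReal_re, Complex.ofReal_im, Complex.zero_re, Complex.zero_im] at r i
    have u0 : 0 ≤ l^4 + l^2 := by positivity
    have u1 : l^4 + l^2 ≤ 2 := by
      have := pow_le_one₀ (n := 4) hl0 hl1
      have := pow_le_one₀ (n := 2) hl0 hl1
      linarith
    generalize l^4 + l^2 = u at *
    rcases h3 with h3 | h3
    · have : u = 0 := by
        by_contra hu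
        have : 0 < u := lt_of_le_of_ne u0 (Ne.symm hu)
        nlinarith
      rw [this] at r; norm_num at r
    · rcases u0.eq_or_lt with hu | hu
      · rw [← hu] at r; norm_num at r
      · have := mul_pos hu (sub_pos.2 h3)
        nlinarith
  · obtain ⟨l, hl0, hl1⟩ := l
    rw [f_smul, eA] at h
    simp only at h
    have h' : (((4 * l^6 : ℝ)):ℂ) + (((6 * l^2 * (1 - l^4)) : ℝ) : ℂ) * cP p = 4 * Complex.I := by
      push_cast; linear_combination h
    have i := congrArg Complex.im h'
    simp only [Complex.add_re, Complex.add_im, Complex.re_ofReal_mul, Complex.im_ofReal_mul, Complex.ofReal_re, Complex.ofReal_im] at i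
    simp at i
    have u1 : 0 ≤ 1 - l^4 := by
      have := pow_le_one₀ (n := 4) hl0 hl1
      linarith
    have : 0 ≤ 6 * l^2 * (1 - l^4) := by positivity
    nlinarith

noncomputable def om : ℂ := Complex.exp (2 * Real.pi * Complex.I / 24)
theorem om6 : om ^ 6 = Complex.I := by
  unfold om
  rw [← Complex.exp_nat_mul]
  refine Eq.trans ?_ Complex.exp_pi_div_two_mul_I
  congr 1
  push_cast; ring_nf

noncomputable def sg (p : ℂ × ℂ) : ℂ × ℂ := (om * (starRingEnd ℂ) p.1, om ^ 5 * (starRingEnd ℂ) p.2)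

theorem sg_cont : Continuous sg := by
  unfold sg
  have := Complex.continuous_conj
  fun_prop
theorem sg_A (p : ℂ × ℂ) : cA (sg p) = Complex.I * (starRingEnd ℂ) (cA p) := by
  have : om ^ 30 = Complex.I := by 
    have : om ^ 30 = (om ^ 6)^5 := by ring
    rw [this, om6]
    have : Complex.I ^ 5 = (Complex.I ^ 2)^2 * Complex.I := by ring
    rw [this]; simp
  simp only [cA, sg, map_add, map_pow, mul_pow, om6, ← pow_mul]
  norm_num [this]; ring
theorem sg_P (p : ℂ × ℂ) : cP (sg p) = Complex.I * (starRingEnd ℂ) (cP p) := by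
  simp only [cP, sg, map_mul]
  linear_combination (starRingEnd ℂ) p.1 * (starRingEnd ℂ) p.2 * om6

def Eq2 (p q : ℂ × ℂ) : Prop := Eqv {4, 4 * Complex.I} p q ∧ Eqv {4, 4 * Complex.I} (sg p) (sg q)

theorem Eq2_of {p q : ℂ × ℂ} (h : JoinedIn SS p q) : Eq2 p q := by
  obtain ⟨γ, hγ⟩ := h
  constructor
  · have := core 4 (4 * Complex.I) γ γ.continuous (fun τ => (SS_core (hγ τ)).1)
      (fun τ => (SS_core (hγ τ)).2.1) (fun τ => (SS_core (hγ τ)).2.2)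
    rwa [γ.source, γ.target] at this
  · have := core (4 * Complex.I) 4 (fun τ => sg (γ τ)) (sg_cont.comp γ.continuous) (fun τ => by
        rw [sg_A, sg_P]
        have := congrArg (starRingEnd ℂ) (SS_core (hγ τ)).1
        simp only [map_add, map_mul, map_ofNat] at this
        linear_combination Complex.I * this)
      (fun τ l h => by
        rw [sg_A, sg_P] at h
        have k := (SS_core (hγ τ)).2.1 l
        apply k
        have h2 : Complex.I * (starRingEnd ℂ) (cA (γ τ) * (((l:ℝ):ℂ)^4 + ((l:ℝ):ℂ)^2 + 1) + 6 * cP (γ τ)) = 0 := by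
          rw [← h]
          simp only [map_add, map_mul, map_ofNat, map_pow, Complex.conj_ofReal, map_one]
          ring
        rcases mul_eq_zero.1 h2 with h2 | h2
        · exact absurd h2 Complex.I_ne_zero
        · exact (map_eq_zero _).1 h2) 
      (fun τ l h => by
        have k := (SS_core (hγ τ)).2.2 l
        apply k
        have h2 := congrArg (starRingEnd ℂ) h
        rw [f_smul, sg_A, sg_P] at h2
        simp only [map_add, map_mul, map_ofNat, map_pow, Complex.conj_ofReal, map_one, Complex.conj_conj, Complex.conj_I] at h2
        rw [f_smul]
        linear_combination Complex.I * h2 + (((l:ℝ):ℂ)^6 * cA (γ τ) + 6 * ((l:ℝ):ℂ)^2 * cP (γ τ)) * Complex.I_sq)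
    rw [γ.source, γ.target] at this
    rwa [Set.pair_comm] at this

set_option linter.unusedVariables false
open Complex
open unitInterval Topology Set

theorem f_eq (p : ℂ × ℂ) : f p = cA p + 6 * cP p := by
  unfold f cA cP; ring

theorem joined_map {φ : ℂ × ℂ → ℂ × ℂ} (hφ : Continuous φ) (hm : ∀ p ∈ SS, φ p ∈ SS) {p q : ℂ × ℂ}
    (h : JoinedIn SS p q) : JoinedIn SS (φ p) (φ q) := by
  obtain ⟨γ, hγ⟩ := h
  exact ⟨γ.map hφ, fun t => hm _ (hγ t)⟩

theorem joined_rot {z w : ℂ} (hz : z ^ 6 = 1) (hzw : z * w = 1) {p q : ℂ × ℂ} (h : JoinedIn SS p q) :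
    JoinedIn SS (z * p.1, w * p.2) (z * q.1, w * q.2) := by
  refine joined_map (φ := fun p => (z * p.1, w * p.2)) (by fun_prop) ?_ h
  intro p hp
  have hw : w ^ 6 = 1 := by
    have : (z * w) ^ 6 = z ^ 6 * w ^ 6 := by ring
    rw [hzw, hz] at this; simpa using this.symm
  have e1 : cA (z * p.1, w * p.2) = cA p := by simp only [cA]; rw [mul_pow, mul_pow, hz, hw]; ring
  have e2 : cP (z * p.1, w * p.2) = cP p := by simp only [cP]; linear_combination p.1 * p.2 * hzw
  simpa only [SS, mem_ofPred_eq, f_eq, e1, e2] using hp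

theorem joined_swp {z w : ℂ} (hz : z ^ 6 = 1) (hzw : z * w = 1) {p q : ℂ × ℂ} (h : JoinedIn SS p q) :
    JoinedIn SS (w * p.2, z * p.1) (w * q.2, z * q.1) := by
  refine joined_map (φ := fun p => (w * p.2, z * p.1)) (by fun_prop) ?_ h
  intro p hp
  have hw : w ^ 6 = 1 := by
    have : (z * w) ^ 6 = z ^ 6 * w ^ 6 := by ring
    rw [hzw, hz] at this; simpa using this.symm
  have e1 : cA (w * p.2, z * p.1) = cA p := by simp only [cA]; rw [mul_pow, mul_pow, hz, hw]; ring
  have e2 : cP (w * p.2, z * p.1) = cP p := by simp only [cP]; linear_combination p.1 * p.2 * hzw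
  simpa only [SS, mem_ofPred_eq, f_eq, e1, e2] using hp

noncomputable def XX (a : ℝ) : ℝ := ((4 - 6 * a) + √((4 - 6 * a)^2 - 4 * a ^ 6)) / 2
noncomputable def xx (a : ℝ) : ℝ := XX a ^ (((6:ℕ):ℝ)⁻¹)

theorem XX_pos {a : ℝ} (ha : a < 2/3) : 0 < XX a := by
  unfold XX
  have := Real.sqrt_nonneg ((4 - 6 * a)^2 - 4 * a ^ 6)
  linarith
theorem xx_pos {a : ℝ} (ha : a < 2/3) : 0 < xx a := Real.rpow_pos_of_pos (XX_pos ha) _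
theorem xx6 {a : ℝ} (ha : a < 2/3) : xx a ^ 6 = XX a := Real.rpow_inv_natCast_pow (XX_pos ha).le (by norm_num)

theorem xx_A {a : ℝ} (ha : a < 2/3) (hD : 0 ≤ (4 - 6 * a)^2 - 4 * a ^ 6) : xx a ^ 6 + (a / xx a)^6 = 4 - 6 * a := by
  rw [div_pow, xx6 ha]
  have h := (XX_pos ha).ne'
  have h2 := Real.sq_sqrt hD
  have : XX a ^ 2 - (4 - 6 * a) * XX a + a ^ 6 = 0 := by
    unfold XX
    linear_combination h2 / 4
  field_simp
  linarith

theorem xx_cont : Continuous xx := by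
  unfold xx XX
  apply Continuous.rpow_const (by fun_prop)
  intro a; right; positivity

noncomputable def rr : ℝ := (4:ℝ) ^ (((6:ℕ):ℝ)⁻¹)
theorem rr6 : rr ^ 6 = 4 := Real.rpow_inv_natCast_pow (by norm_num) (by norm_num)
theorem xx_zero : xx 0 = rr := by
  unfold xx XX rr
  congr 1
  rw [show ((4:ℝ) - 6 * 0)^2 - 4 * 0 ^ 6 = 4^2 by norm_num, Real.sqrt_sq (by norm_num)]
  norm_num

theorem joined_Icc {a b : ℝ} (hab : a ≤ b) (c : ℝ → ℂ × ℂ) (hc : ContinuousOn c (Icc a b)) (hS : ∀ t ∈ Icc a b, c t ∈ SS)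
    {s t : ℝ} (hs : s ∈ Icc a b) (ht : t ∈ Icc a b) : JoinedIn SS (c s) (c t) := by
  have h1 : IsPathConnected (Icc a b) := (convex_Icc a b).isPathConnected ⟨a, le_rfl, hab⟩
  have h2 := h1.image' hc
  exact (h2.joinedIn _ ⟨s, hs, rfl⟩ _ ⟨t, ht, rfl⟩).mono (by rintro _ ⟨u, hu, rfl⟩; exact hS u hu)

theorem exists_a1 : ∃ a : ℝ, 0 < a ∧ a < 2/3 ∧ 2 * a ^ 3 + 6 * a = 4 := by
  have h := intermediate_value_Icc (show (0:ℝ) ≤ 2/3 by norm_num) (f := fun a : ℝ => 2 * a ^ 3 + 6 * a) (by fun_prop)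
  obtain ⟨a, ⟨h1, h2⟩, h3⟩ := h (show (4:ℝ) ∈ _ by norm_num)
  simp only at h3
  refine ⟨a, lt_of_le_of_ne h1 ?_, lt_of_le_of_ne h2 ?_, h3⟩
  · rintro rfl; norm_num at h3
  · rintro rfl; norm_num at h3

theorem D_pos1 {a1 a : ℝ} (h : 2 * a1 ^ 3 + 6 * a1 = 4) (ha : 0 ≤ a) (ha1 : a ≤ a1) : 0 ≤ (4 - 6 * a)^2 - 4 * a ^ 6 := by
  have h3 : a ^ 3 ≤ a1 ^ 3 := by gcongr
  have h4 : 0 ≤ a ^ 3 := by positivity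
  have : (4 - 6 * a)^2 - 4 * a ^ 6 = (4 - 6 * a - 2 * a ^ 3) * (4 - 6 * a + 2 * a^3) := by ring
  rw [this]
  apply mul_nonneg <;> linarith

theorem D_pos2 {a : ℝ} (ha : -2 ≤ a) (ha1 : a ≤ 0) : 0 ≤ (4 - 6 * a)^2 - 4 * a ^ 6 := by
  have h4 : a ^ 3 ≤ 0 := Odd.pow_nonpos (by decide) ha1
  have : (4 - 6 * a)^2 - 4 * a ^ 6 = (4 - 6 * a - 2 * a ^ 3) * (2 * (a-1)^2 * (a+2)) := by ring
  rw [this]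
  apply mul_nonneg
  · linarith
  · have : 0 ≤ a + 2 := by linarith
    positivity

theorem real_SS {a : ℝ} (ha : a < 2/3) (hD : 0 ≤ (4 - 6 * a)^2 - 4 * a ^ 6) : ((xx a : ℂ), ((a / xx a : ℝ) : ℂ)) ∈ SS := by
  have h := xx_A ha hD
  have h0 := (xx_pos ha).ne'
  have e1 : cA ((xx a : ℂ), ((a / xx a : ℝ) : ℂ)) = ((4 - 6 * a : ℝ) : ℂ) := by
    simp only [cA]; rw [← h]; push_cast; ring
  have e2 : cP ((xx a : ℂ), ((a / xx a : ℝ) : ℂ)) = (a : ℂ) := by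
    simp only [cP]; rw [← Complex.ofReal_mul]; congr 1; field_simp
  simp only [SS, mem_ofPred_eq, f_eq, e1, e2]
  refine ⟨by push_cast; ring, by simp, Or.inr (by simp; linarith)⟩

theorem real_cont {s : Set ℝ} (hs : ∀ a ∈ s, a < 2/3) : ContinuousOn (fun a : ℝ => ((xx a : ℂ), ((a / xx a : ℝ) : ℂ))) s := by
  refine ContinuousOn.prodMk ?_ ?_
  · exact (Complex.continuous_ofReal.comp xx_cont).continuousOn
  · refine Complex.continuous_ofReal.comp_continuousOn (continuousOn_id.div xx_cont.continuousOn ?_)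
    intro a ha; exact (xx_pos (hs a ha)).ne'

theorem xx_D0 {a : ℝ} (ha : a < 2/3) (hD : (4 - 6 * a)^2 - 4 * a ^ 6 = 0) : xx a ^ 2 = |a| := by
  have h := xx6 ha
  have h1 : xx a ^ 6 = (4 - 6 * a) / 2 := by rw [h]; unfold XX; rw [hD]; simp
  have : (xx a ^ 2) ^ 6 = |a| ^ 6 := by
    rw [Even.pow_abs (by decide)]
    have : (xx a ^ 2) ^ 6 = (xx a ^ 6)^2 := by ring
    rw [this, h1]; linear_combination hD / 4
  exact (pow_left_inj₀ (by positivity) (by positivity) (by norm_num)).1 this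

theorem path1 : JoinedIn SS ((rr : ℂ), 0) (0, (rr:ℂ)) := by
  obtain ⟨a1, p, l, h⟩ := exists_a1
  have := joined_Icc p.le _ (real_cont (s := Icc 0 a1) (fun a ha => by linarith [ha.2])) 
    (fun a ha => real_SS (by linarith [ha.2]) (D_pos1 h ha.1 ha.2)) (s := 0) (t := a1) ⟨le_rfl, p.le⟩ ⟨p.le, le_rfl⟩
  simp only [xx_zero] at this
  have e := xx_D0 l (by rw [show 4 - 6 * a1 = 2 * a1^3 by linarith]; ring)
  rw [abs_of_pos p] at e
  have e2 : a1 / xx a1 = xx a1 := by rw [div_eq_iff (xx_pos l).ne']; linear_combination -e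
  rw [e2] at this
  have k := joined_swp (z := 1) (w := 1) (by norm_num) (by norm_num) this
  simp at k this
  exact this.trans k.symm

theorem path2 : JoinedIn SS ((rr : ℂ), 0) (0, -(rr:ℂ)) := by
  have := joined_Icc (show (-2:ℝ) ≤ 0 by norm_num) _ (real_cont (s := Icc (-2) 0) (fun a ha => by linarith [ha.2])) 
    (fun a ha => real_SS (by linarith [ha.2]) (D_pos2 ha.1 ha.2)) (s := 0) (t := -2) (by norm_num) (by norm_num)
  simp only [xx_zero] at this
  have e := xx_D0 (a := -2) (by norm_num) (by norm_num)
  rw [abs_of_neg (by norm_num)] at e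
  have e2 : -2 / xx (-2) = - xx (-2) := by rw [div_eq_iff (xx_pos (by norm_num)).ne']; linear_combination e
  rw [e2] at this
  have k := joined_swp (z := -1) (w := -1) (by norm_num) (by norm_num) this
  simp at k this
  exact this.trans k.symm

noncomputable def z3 : ℂ := ⟨-(1/2), √3/2⟩
noncomputable def z3' : ℂ := ⟨-(1/2), -(√3/2)⟩
theorem z3_mul : z3 * z3' = 1 := by
  have := Real.sq_sqrt (show (0:ℝ) ≤ 3 by norm_num)
  apply Complex.ext
  · simp [z3, z3']; linear_combination this / 4
  · simp [z3, z3']; ring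
theorem z3_sq : z3 ^ 2 = z3' := by
  have := Real.sq_sqrt (show (0:ℝ) ≤ 3 by norm_num)
  rw [sq]
  apply Complex.ext
  · simp [z3, z3']; linear_combination -this / 4
  · simp [z3, z3']; ring
theorem z3_cube : z3 ^ 3 = 1 := by rw [pow_succ, z3_sq, mul_comm]; exact z3_mul
theorem z3'_six : z3' ^ 6 = 1 := by
  rw [← z3_sq]; have : (z3 ^ 2)^6 = (z3^3)^4 := by ring
  rw [this, z3_cube, one_pow]

noncomputable def kk (a : ℝ) : ℝ := √(4 / (4 - 6 * a) - 1/4)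
noncomputable def nu (a : ℝ) : ℂ := ⟨-(1/2), -(kk a)⟩
noncomputable def mu (a : ℝ) : ℂ := (z3 * nu a) ^ (((2:ℕ):ℂ)⁻¹)

theorem mu_sq (a : ℝ) : mu a ^ 2 = z3 * nu a := Complex.cpow_nat_inv_pow _ (by norm_num)

theorem kk_sq {a : ℝ} (ha0 : 0 ≤ a) (ha : a < 2/3) : kk a ^ 2 = 4 / (4 - 6 * a) - 1/4 := by
  unfold kk
  rw [Real.sq_sqrt]
  have : 1 ≤ 4 / (4 - 6 * a) := by rw [le_div_iff₀ (by linarith)]; linarith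
  linarith

theorem nu_id {a : ℝ} (ha0 : 0 ≤ a) (ha : a < 2/3) : nu a ^ 3 * ((4 - 6 * a : ℝ):ℂ) + 6 * ((a : ℂ) * nu a) = 4 := by
  have h := kk_sq ha0 ha
  have hq : (4 - 6 * a) ≠ 0 := by linarith
  have h1 : (nu a ^ 2 + nu a) * ((4 - 6 * a : ℝ):ℂ) = -4 := by
    have : nu a ^ 2 + nu a = ((-(1/4) - kk a ^ 2 : ℝ) : ℂ) := by
      rw [sq]
      apply Complex.ext
      · rw [Complex.ofReal_re]; simp [nu]; ring
      · rw [Complex.ofReal_im]; simp [nu]; ring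
    rw [this, h, ← Complex.ofReal_mul]
    have : (-(1/4) - (4 / (4 - 6 * a) - 1/4)) * (4 - 6 * a) = -4 := by field_simp; ring
    rw [this]; norm_num
  push_cast at *
  linear_combination (nu a - 1) * h1

theorem mu_cont {s : Set ℝ} (hs : ∀ a ∈ s, a < 2/3) : ContinuousOn mu s := by
  have hk : ContinuousOn kk s := by
    unfold kk
    apply ContinuousOn.sqrt
    apply ContinuousOn.sub _ continuousOn_const
    apply ContinuousOn.div continuousOn_const (by fun_prop)
    intro a ha; have := hs a ha; linarith
  have hn : ContinuousOn nu s := by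
    have e : nu = fun a => ((-(1/2) : ℝ) : ℂ) + ((-(kk a) : ℝ) : ℂ) * Complex.I := by
      ext a
      exact (Complex.mk_eq_add_mul_I _ _)
    rw [e]
    exact continuousOn_const.add ((Complex.continuous_ofReal.comp_continuousOn hk.neg).mul continuousOn_const)
  unfold mu
  intro a ha
  refine ContinuousWithinAt.cpow ((continuousOn_const.mul hn) a ha) continuousWithinAt_const ?_
  left
  simp [z3, nu]
  have : 0 ≤ kk a := Real.sqrt_nonneg _
  have : 0 ≤ √3 / 2 * kk a := by positivity
  linarith

theorem mu_zero : mu 0 = 1 := by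
  unfold mu
  have : nu 0 = z3' := by
    unfold nu z3' kk
    congr 2
    rw [show (4:ℝ) / (4 - 6 * 0) - 1/4 = 3 / 2^2 by norm_num, Real.sqrt_div (by norm_num), Real.sqrt_sq (by norm_num)]
  rw [this, z3_mul, Complex.one_cpow]

theorem path3 : JoinedIn SS ((rr : ℂ), 0) (0, z3' * (rr:ℂ)) := by
  obtain ⟨a1, p, l, h⟩ := exists_a1
  have := joined_Icc p.le (fun a => (mu a * (xx a : ℂ), mu a * (z3' * ((a / xx a : ℝ) : ℂ)))) (by
      have c1 := real_cont (s := Icc 0 a1) (fun a ha => by linarith [ha.2])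
      have c2 := mu_cont (s := Icc 0 a1) (fun a ha => by linarith [ha.2])
      exact (c2.mul (continuous_fst.comp_continuousOn c1)).prodMk (c2.mul (continuousOn_const.mul (continuous_snd.comp_continuousOn c1))))
    (fun a ha => by
      have ha' : a < 2/3 := by linarith [ha.2]
      have h := xx_A ha' (D_pos1 h ha.1 ha.2)
      have h0 := (xx_pos ha').ne'
      have m6 : mu a ^ 6 = nu a ^ 3 := by
        have : mu a ^ 6 = (mu a ^ 2)^3 := by ring
        rw [this, mu_sq, mul_pow, z3_cube, one_mul]
      have e1 : cA (mu a * (xx a : ℂ), mu a * (z3' * ((a / xx a : ℝ) : ℂ))) = nu a ^ 3 * ((4 - 6 * a : ℝ) : ℂ) := by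
        simp only [cA]; rw [← h, mul_pow, mul_pow, mul_pow, z3'_six, m6]; push_cast; ring
      have e2 : cP (mu a * (xx a : ℂ), mu a * (z3' * ((a / xx a : ℝ) : ℂ))) = (a : ℂ) * nu a := by
        simp only [cP]
        have e3 : ((xx a : ℝ) : ℂ) * ((a / xx a : ℝ) : ℂ) = (a : ℂ) := by
          rw [← Complex.ofReal_mul]; congr 1; field_simp
        linear_combination (mu a ^ 2 * z3') * e3 + a * z3' * mu_sq a + a * nu a * z3_mul
      simp only [SS, mem_ofPred_eq, f_eq, e1, e2]
      refine ⟨nu_id ha.1 ha', ?_, Or.inr ?_⟩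
      · simp [nu]
        exact mul_nonneg ha.1 (Real.sqrt_nonneg _)
      · simp [nu]; linarith [ha.1])
      (s := 0) (t := a1) ⟨le_rfl, p.le⟩ ⟨p.le, le_rfl⟩
  simp only [xx_zero, mu_zero] at this
  have e := xx_D0 l (by rw [show 4 - 6 * a1 = 2 * a1^3 by linarith]; ring)
  rw [abs_of_pos p] at e
  have e2 : a1 / xx a1 = xx a1 := by rw [div_eq_iff (xx_pos l).ne']; linear_combination -e
  rw [e2] at this
  have k := joined_swp (z := z3') (w := z3) z3'_six (by rw [mul_comm]; exact z3_mul) this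
  simp at k this
  have e4 : (z3 * (mu a1 * (z3' * (xx a1 : ℂ)))) = mu a1 * (xx a1 : ℂ) := by
    linear_combination mu a1 * xx a1 * z3_mul
  have e5 : z3' * (mu a1 * (xx a1 : ℂ)) = mu a1 * (z3' * (xx a1 : ℂ)) := by ring
  rw [e4, e5] at k
  exact this.trans k.symm

theorem all_joined {z : ℂ} (hz : z ^ 6 = 1) : JoinedIn SS ((rr:ℂ), 0) (z * rr, 0) ∧ JoinedIn SS ((rr:ℂ), 0) (0, z * rr) := by
  have st1 : ∀ z w : ℂ, z ^ 6 = 1 → z * w = 1 → JoinedIn SS (z * rr, 0) (0, w * rr) := by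
    intro z w h h'
    have := joined_rot h h' path1
    simpa using this
  have st2 : ∀ z w : ℂ, z ^ 6 = 1 → z * w = 1 → JoinedIn SS (z * rr, 0) (0, -w * rr) := by
    intro z w h h'
    have := joined_rot h h' path2
    simpa using this
  have st3 : ∀ z w : ℂ, z ^ 6 = 1 → z * w = 1 → JoinedIn SS (z * rr, 0) (0, w * z3' * rr) := by
    intro z w h h'
    have := joined_rot h h' path3
    simpa [mul_assoc] using this
  let P : ℂ → Prop := fun w => JoinedIn SS ((rr:ℂ), 0) (0, w * rr)
  have p1 : P 1 := by have := st1 1 1 (by norm_num) (by norm_num); simpa [P] using this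
  have neg : ∀ w : ℂ, w ^ 6 = 1 → P w → P (-w) := by
    intro w hw h
    have h5 : (w ^ 5)^6 = 1 := by rw [← pow_mul, mul_comm, pow_mul, hw, one_pow]
    have h6 : w ^ 5 * w = 1 := by rw [← hw]; ring
    exact (h.trans (st1 _ _ h5 h6).symm).trans (st2 _ _ h5 h6)
  have mz : ∀ w : ℂ, w ^ 6 = 1 → P w → P (w * z3') := by
    intro w hw h
    have h5 : (w ^ 5)^6 = 1 := by rw [← pow_mul, mul_comm, pow_mul, hw, one_pow]
    have h6 : w ^ 5 * w = 1 := by rw [← hw]; ring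
    exact (h.trans (st1 _ _ h5 h6).symm).trans (st3 _ _ h5 h6)
  have p2 : P z3' := by have := mz 1 (by norm_num) p1; simpa using this
  have p3 : P z3 := by 
    have := mz z3' z3'_six p2
    have e : z3' * z3' = z3 := by
      rw [← z3_sq]
      linear_combination z3 * z3_cube
    rwa [e] at this
  have z36 : z3 ^ 6 = 1 := by have : z3 ^ 6 = (z3 ^ 3)^2 := by ring
                              rw [this, z3_cube, one_pow]
  have hall : ∀ w : ℂ, w ^ 6 = 1 → P w := by
    intro w hw
    have hsum : z3 + z3' = -1 := by apply Complex.ext <;> simp [z3, z3'] ; norm_num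
    have fac : (w - 1) * ((w - z3) * ((w - z3') * ((w + 1) * ((w + z3) * (w + z3'))))) = 0 := by
      have e1 : (w - z3) * (w - z3') = w^2 + w + 1 := by linear_combination -w * hsum + z3_mul
      have e2 : (w + z3) * (w + z3') = w^2 - w + 1 := by linear_combination w * hsum + z3_mul
      calc _ = (w - 1) * (((w - z3) * (w - z3')) * ((w + 1) * ((w + z3) * (w + z3')))) := by ring
        _ = w ^ 6 - 1 := by rw [e1, e2]; ring
        _ = 0 := by rw [hw]; ring
    rcases mul_eq_zero.1 fac with h | h
    · rw [sub_eq_zero.1 h]; exact p1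
    rcases mul_eq_zero.1 h with h | h
    · rw [sub_eq_zero.1 h]; exact p3
    rcases mul_eq_zero.1 h with h | h
    · rw [sub_eq_zero.1 h]; exact p2
    rcases mul_eq_zero.1 h with h | h
    · rw [eq_neg_of_add_eq_zero_left h]; exact neg _ (by norm_num) p1
    rcases mul_eq_zero.1 h with h | h
    · rw [eq_neg_of_add_eq_zero_left h]; exact neg _ z36 p3
    · rw [eq_neg_of_add_eq_zero_left h]; exact neg _ z3'_six p2
  refine ⟨?_, hall z hz⟩
  have h5 : (z ^ 5)^6 = 1 := by rw [← pow_mul, mul_comm, pow_mul, hz, one_pow]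
  exact (hall _ h5).trans (st1 z (z^5) hz (by rw [← hz]; ring)).symm

set_option linter.unusedVariables false
open Complex
open unitInterval Topology Set

theorem rr_ne : (rr:ℂ) ≠ 0 := by
  intro h
  have := rr6
  rw [Complex.ofReal_eq_zero.1 h] at this
  norm_num at this
theorem rr6c : (rr:ℂ)^6 = 4 := by exact_mod_cast rr6
theorem om_ne : om ≠ 0 := by unfold om; exact Complex.exp_ne_zero _

theorem B2_tri : ∀ᶠ ε in 𝓝[>] (0:ℝ), TriCond {q : ℂ | q ^ 6 ∈ ({4, 4 * Complex.I} : Set ℂ)} ε := by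
  apply triCond_ev
  · have : {q : ℂ | q ^ 6 ∈ ({4, 4 * Complex.I} : Set ℂ)} = {w : ℂ | w ^ 6 * 1 + 6 * w ^ 2 * 0 = 4} ∪ {w : ℂ | w ^ 6 * 1 + 6 * w ^ 2 * 0 = 4 * Complex.I} := by
      ext w; simp
    rw [this]
    exact (sextic_finite' _ _ _ (by norm_num)).union (sextic_finite' _ _ _ (by simp))
  · intro z hz z' hz' hne hre him
    have hz0 : z ≠ 0 := by rintro rfl; simp at hz
    have e : z' / z = (((z'/z).re : ℝ) : ℂ) := Complex.ext (by simp) (by simp [him])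
    set x := (z'/z).re with hx
    have e2 : z' ^ 6 = ((x ^ 6 : ℝ) : ℂ) * z ^ 6 := by
      push_cast; rw [← e]; field_simp
    have hx6 : 0 < x ^ 6 := by positivity
    have : x ^ 6 = 1 := by
      simp only [mem_ofPred_eq, mem_insert_iff, mem_singleton_iff] at hz hz'
      generalize x ^ 6 = y at *
      rcases hz with h | h <;> rcases hz' with h' | h' <;> rw [h, h'] at e2
      · have := congrArg Complex.re e2; simp at this; linarith
      · have := congrArg Complex.re e2; simp at this; linarith
      · have := congrArg Complex.re e2; simp at this
      · have := congrArg Complex.im e2; simp at this; linarith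
    have x1 : x = 1 := by
      have := (pow_left_inj₀ hre.le zero_le_one (show 6 ≠ 0 by norm_num)).1 (by rw [this, one_pow])
      exact this
    rw [x1] at e
    apply hne
    rw [div_eq_iff hz0] at e
    simpa using e

theorem G2_gen (h0 : (0:ℂ × ℂ) ∈ U {4, 4 * Complex.I}) : 
    ∃ g1 g2 : FundamentalGroup (U {4, 4 * Complex.I}) ⟨0, h0⟩, Subgroup.closure {g1, g2} = ⊤ := by
  have hfin : {z : ℂ | z ^ 6 = 1}.Finite := by
    have : {q : ℂ | q ^ 6 = 1} = {w : ℂ | w ^ 6 * 1 + 6 * w ^ 2 * 0 = 1} := by ext w; simp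
    rw [this]
    exact sextic_finite' _ _ _ (by norm_num)
  have ev : ∀ᶠ ε in 𝓝[>] (0:ℝ), ∀ z ∈ {z : ℂ | z ^ 6 = 1}, 
      (∀ t, sm (tri ε) ((rr:ℂ), (0:ℂ)) t ∈ U {4, 4 * Complex.I}) ∧ (∀ t, sm (tri ε) (sg ((rr:ℂ), (0:ℂ))) t ∈ U {4, 4 * Complex.I}) ∧
      ∀ (h0 : (0:ℂ × ℂ) ∈ U {4, 4 * Complex.I}) (H : Subgroup (FundamentalGroup (U {4, 4 * Complex.I}) ⟨0, h0⟩)),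
      Mem H (sm (tri ε) ((rr:ℂ), (0:ℂ))) → Mem H (sm (tri ε) (sg ((rr:ℂ), (0:ℂ)))) → 
      Mem H (sm (tri ε) (z * rr, (0:ℂ))) ∧ Mem H (sm (tri ε) ((0:ℂ), z * rr)) ∧
      Mem H (sm (tri ε) (sg (z * rr, (0:ℂ)))) ∧ Mem H (sm (tri ε) (sg ((0:ℂ), z * rr))) := by
    rw [Filter.eventually_all_finite hfin]
    intro z hz
    obtain ⟨a, b⟩ := all_joined hz
    filter_upwards [(Eq2_of a).1, (Eq2_of a).2, (Eq2_of b).1, (Eq2_of b).2] with ε e1 e2 e3 e4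
    exact ⟨e1.1, e2.1, fun h0 H m1 m2 => ⟨e1.2 h0 H m1, e3.2 h0 H m1, e2.2 h0 H m2, e4.2 h0 H m2⟩⟩
  obtain ⟨ε, hε, htri⟩ := (ev.and B2_tri).exists
  obtain ⟨m1, m2, -⟩ := hε 1 (by simp)
  refine ⟨FundamentalGroup.fromPath (cl _ m1), FundamentalGroup.fromPath (cl _ m2), ?_⟩
  set H := Subgroup.closure {FundamentalGroup.fromPath (cl _ m1), FundamentalGroup.fromPath (cl _ m2)} with hH
  have k1 : Mem H (sm (tri ε) ((rr:ℂ), (0:ℂ))) := ⟨m1, Subgroup.subset_closure (by simp)⟩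
  have k2 : Mem H (sm (tri ε) (sg ((rr:ℂ), (0:ℂ)))) := ⟨m2, Subgroup.subset_closure (by simp)⟩
  have all := fun z hz => (hε z hz).2.2 h0 H k1 k2
  have om30 : om ^ 30 = Complex.I := by 
    have : om ^ 30 = (om ^ 6)^5 := by ring
    rw [this, om6]
    have : Complex.I ^ 5 = (Complex.I ^ 2)^2 * Complex.I := by ring
    rw [this]; simp
  refine gen_of_axes (by simp) ?_ (good_of_tri (by simp) _ ?_ ε htri ?_) (good_of_tri (by simp) _ ?_ ε htri ?_)
  · rintro b (rfl | rfl)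
    · norm_num
    · rw [mul_pow, show Complex.I ^ 4 = (Complex.I ^ 2)^2 by ring, Complex.I_sq]; norm_num
  · intro q; simp [f]
  · rintro z (h | h)
    · have := (all (z / rr) (by simp only [mem_ofPred_eq]; rw [div_pow, h, rr6c]; norm_num)).1
      rw [div_mul_cancel₀ _ rr_ne] at this
      simpa using this
    · have := (all ((starRingEnd ℂ) (z / (om * rr))) (by 
        simp only [mem_ofPred_eq]
        rw [← map_pow, div_pow, mul_pow, h, rr6c, om6, mul_comm, div_self (by simp)]; simp)).2.2.1
      have e : sg ((starRingEnd ℂ) (z / (om * rr)) * rr, 0) = z • (1, 0) := by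
        have := om_ne
        have := rr_ne
        simp only [sg, map_mul, Complex.conj_conj, Complex.conj_ofReal]
        ext
        · simp; field_simp
        · simp
      rwa [e] at this
  · intro q; simp [f]
  · rintro z (h | h)
    · have := (all (z / rr) (by simp only [mem_ofPred_eq]; rw [div_pow, h, rr6c]; norm_num)).2.1
      rw [div_mul_cancel₀ _ rr_ne] at this
      simpa using this
    · have := (all ((starRingEnd ℂ) (z / (om ^ 5 * rr))) (by 
        simp only [mem_ofPred_eq]
        rw [← map_pow, div_pow, mul_pow, h, rr6c, ← pow_mul, om30, mul_comm, div_self (by simp)]; simp)).2.2.2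
      have e : sg (0, (starRingEnd ℂ) (z / (om ^ 5 * rr)) * rr) = z • (0, 1) := by
        have := om_ne
        have := rr_ne
        simp only [sg, map_mul, Complex.conj_conj, Complex.conj_ofReal]
        ext
        · simp
        · simp; field_simp
      rwa [e] at this

set_option linter.unusedVariables false
open Complex
open unitInterval Topology Set

noncomputable def ZC {X ι T : Type*} [TopologicalSpace X] [TopologicalSpace T] [DiscreteTopology T]
    (V : ι → Set X) (hV : ∀ i, IsOpen (V i)) (ix : X → ι) (hix : ∀ x, x ∈ V (ix x))
    (h : ι → X → Equiv.Perm T)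
    (hc : ∀ i j x, x ∈ V i → x ∈ V j → ∀ᶠ y in 𝓝 x, h j y * (h i y)⁻¹ = h j x * (h i x)⁻¹) :
    FiberBundleCore ι X T where
  baseSet := V
  isOpen_baseSet := hV
  indexAt := ix
  mem_baseSet_at := hix
  coordChange i j x t := (h j x * (h i x)⁻¹) t
  coordChange_self i x hx v := by simp
  continuousOn_coordChange i j := by
    rintro ⟨x, t⟩ ⟨⟨hi, hj⟩, -⟩
    apply ContinuousAt.continuousWithinAt
    have h1 : ContinuousAt (fun p : X × T => (h j x * (h i x)⁻¹) p.2) (x, t) :=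
      (continuous_of_discreteTopology (f := fun t : T => (h j x * (h i x)⁻¹) t)).continuousAt.comp
        continuousAt_snd
    refine h1.congr ?_
    have := (continuousAt_fst (p := (x, t))).eventually (hc i j x hi hj)
    filter_upwards [this] with p hp
    rw [hp]
  coordChange_comp i j k x hx v := by simp

theorem ZC_hom {X ι T : Type*} [TopologicalSpace X] 
    (V : ι → Set X) (hV : ∀ i, IsOpen (V i)) (ix : X → ι) (hix : ∀ x, x ∈ V (ix x))
    (h : ι → X → Equiv.Perm T)
    (hc : ∀ i j x, x ∈ V i → x ∈ V j → ∀ᶠ y in 𝓝 x, h j y * (h i y)⁻¹ = h j x * (h i x)⁻¹)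
    (x0 : X) : ∃ φ : FundamentalGroup X x0 →* Equiv.Perm T,
    ∀ (γ : Path x0 x0) (c : I) (s : Equiv.Perm T), 0 < c →
      (∀ t, t ≠ c → ix (γ t) = ix x0 ∧ h (ix x0) (γ t) = 1) →
      (∀ t, t < c → γ t ∈ V (ix (γ c)) → h (ix (γ c)) (γ t) = s) →
      (∀ t, c < t → γ t ∈ V (ix (γ c)) → h (ix (γ c)) (γ t) = 1) → h (ix (γ c)) (γ c) = 1 →
      φ (FundamentalGroup.fromPath (.mk γ)) = s := by
  letI : TopologicalSpace T := ⊥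
  haveI : DiscreteTopology T := ⟨rfl⟩
  let Z := ZC V hV ix hix h hc
  have cov : IsCoveringMap (Bundle.TotalSpace.proj : Z.TotalSpace → X) :=
    FiberBundle.isCoveringMap (F := T) (E := Z.Fiber)
  let e : (Bundle.TotalSpace.proj : Z.TotalSpace → X) ⁻¹' {x0} ≃ T :=
    { toFun := fun z => z.1.2
      invFun := fun t => ⟨⟨x0, t⟩, rfl⟩
      left_inv := by rintro ⟨⟨b, t⟩, hb⟩; obtain rfl : b = x0 := hb; rfl
      right_inv := fun t => rfl }
  refine ⟨(e.permCongrHom.toMonoidHom).comp (cov.monodromyPerm x0), ?_⟩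
  intro γ c s hc0 hne hlt hgt hcc
  ext k
  classical
  let Γ : I → Z.TotalSpace := fun t => ⟨γ t, if t < c then k else s k⟩
  have Γc : Continuous Γ := by
    rw [continuous_iff_continuousAt]
    intro t0
    rw [FiberBundle.continuousAt_totalSpace]
    refine ⟨γ.continuous.continuousAt, ?_⟩
    have e1 : ∀ t, ((trivializationAt T Z.Fiber (Γ t0).proj) (Γ t)).2 =
        (h (ix (γ t0)) (γ t) * (h (ix (γ t)) (γ t))⁻¹) (if t < c then k else s k) := fun t => rfl
    simp only [e1]
    rcases lt_trichotomy t0 c with hl | rfl | hg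
    · refine (continuousAt_const (y := k)).congr ?_
      filter_upwards [isOpen_Iio.mem_nhds hl] with t ht
      have ht' : t < c := ht
      rw [(hne t0 hl.ne).1, (hne t ht'.ne).1, (hne t ht'.ne).2]
      simp [ht']
    · refine (continuousAt_const (y := s k)).congr ?_
      filter_upwards [γ.continuous.continuousAt ((hV _).mem_nhds (hix (γ t0)))] with t ht
      rcases lt_trichotomy t t0 with h1 | rfl | h1
      · rw [(hne t h1.ne).1, (hne t h1.ne).2, hlt t h1 ht]
        simp [h1]
      · simp
      · rw [(hne t h1.ne').1, (hne t h1.ne').2, hgt t h1 ht]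
        simp [h1.not_gt]
    · refine (continuousAt_const (y := s k)).congr ?_
      filter_upwards [isOpen_Ioi.mem_nhds hg] with t ht
      have ht' : c < t := ht
      rw [(hne t0 hg.ne').1, (hne t ht'.ne').1, (hne t ht'.ne').2]
      simp [ht'.not_gt]
  have h0 : γ.toContinuousMap 0 = (⟨x0, k⟩ : Z.TotalSpace).proj := γ.source
  have key : Γ = cov.liftPath γ.toContinuousMap ⟨x0, k⟩ h0 := by
    rw [cov.eq_liftPath_iff]
    refine ⟨Γc, rfl, ?_⟩
    have hs : ∀ (b : X) (t : T), b = x0 → t = k → (⟨b, t⟩ : Z.TotalSpace) = ⟨x0, k⟩ := by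
      rintro _ _ rfl rfl; rfl
    exact hs _ _ γ.source (if_pos hc0)
  change (cov.liftPath γ.toContinuousMap ⟨x0, k⟩ h0 1).2 = s k
  have k1 : Γ 1 = cov.liftPath γ.toContinuousMap ⟨x0, k⟩ h0 1 := congrFun key 1
  rw [← k1]
  exact if_neg (not_lt.2 c.2.2)

set_option linter.unusedVariables false
open Complex
open unitInterval Topology Set

def VV {X : Type*} (w : X → ℂ) : Fin 3 → Set X
  | 0 => {x | (w x).im ≠ 0 ∨ |(w x).re| < 4}
  | 1 => {x | 4 < (w x).re}
  | 2 => {x | (w x).re < -4}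

open Classical in
noncomputable def hh {X T : Type*} (w : X → ℂ) (ς τ : Equiv.Perm T) : Fin 3 → X → Equiv.Perm T
  | 0 => fun _ => 1
  | 1 => fun x => if (w x).im < 0 then ς else 1
  | 2 => fun x => if 0 < (w x).im then τ else 1

open Classical in
noncomputable def ii {X : Type*} (w : X → ℂ) : X → Fin 3 := fun x =>
  if (w x).im ≠ 0 ∨ |(w x).re| < 4 then 0 else if 4 < (w x).re then 1 else 2

theorem hh_loc {X T : Type*} [TopologicalSpace X] (w : X → ℂ) (hw : Continuous w) (ς τ : Equiv.Perm T)
    (i : Fin 3) (x : X) (hx : (w x).im ≠ 0) : ∀ᶠ y in 𝓝 x, hh w ς τ i y = hh w ς τ i x := by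
  have hc : Continuous fun y => (w y).im := Complex.continuous_im.comp hw
  rcases lt_or_gt_of_ne hx with h | h
  · filter_upwards [(isOpen_lt hc continuous_const).mem_nhds h] with y hy
    have hy' : (w y).im < 0 := hy
    fin_cases i <;> simp [hh, h, hy', h.not_gt, hy'.not_gt]
  · filter_upwards [(isOpen_lt continuous_const hc).mem_nhds h] with y hy
    have hy' : 0 < (w y).im := hy
    fin_cases i <;> simp [hh, h, hy', h.not_gt, hy'.not_gt]

theorem psi_ex {X T : Type*} [TopologicalSpace X] (w : X → ℂ) (hw : Continuous w)
    (h4 : ∀ x, w x ≠ 4) (h4' : ∀ x, w x ≠ -4) (x0 : X) (h0 : w x0 = 0) (ς τ : Equiv.Perm T) :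
    ∃ φ : FundamentalGroup X x0 →* Equiv.Perm T,
    (∀ (γ : Path x0 x0) (c : I), 0 < c → 4 < (w (γ c)).re → (w (γ c)).im = 0 →
      (∀ t < c, (w (γ t)).im < 0 ∨ w (γ t) = 0) → (∀ t > c, 0 < (w (γ t)).im ∨ w (γ t) = 0) →
      φ (FundamentalGroup.fromPath (.mk γ)) = ς) ∧
    (∀ (γ : Path x0 x0) (c : I), 0 < c → (w (γ c)).re < -4 → (w (γ c)).im = 0 →
      (∀ t < c, 0 < (w (γ t)).im ∨ w (γ t) = 0) → (∀ t > c, (w (γ t)).im < 0 ∨ w (γ t) = 0) →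
      φ (FundamentalGroup.fromPath (.mk γ)) = τ) := by
  have hci : Continuous fun y => (w y).im := Complex.continuous_im.comp hw
  have hcr : Continuous fun y => (w y).re := Complex.continuous_re.comp hw
  obtain ⟨φ, hφ⟩ := ZC_hom (VV w) (by
      intro i
      fin_cases i
      · exact (isOpen_ne_fun hci continuous_const).union (isOpen_lt hcr.abs continuous_const)
      · exact isOpen_lt continuous_const hcr
      · exact isOpen_lt hcr continuous_const) (ii w) (by
      intro x
      by_cases c1 : (w x).im ≠ 0 ∨ |(w x).re| < 4
      · simp only [ii, if_pos c1]; exact c1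
      by_cases c2 : 4 < (w x).re
      · simp only [ii, if_neg c1, if_pos c2]; exact c2
      · simp only [ii, if_neg c1, if_neg c2]
        push Not at c1 c2
        change (w x).re < -4
        rcases le_abs.1 c1.2 with h | h
        · exact absurd (Complex.ext (by simp; linarith) (by simp [c1.1])) (h4 x)
        · refine lt_of_le_of_ne (by linarith) fun h' => h4' x (Complex.ext (by simp [h']) (by simp [c1.1]))) 
    (hh w ς τ) (by
      intro i j x hi hj
      by_cases hij : i = j
      · subst hij; simp
      have him : (w x).im ≠ 0 := by
        intro h
        have h0' : ∀ x, x ∈ VV w 0 ↔ ((w x).im ≠ 0 ∨ |(w x).re| < 4) := fun _ => Iff.rfl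
        have h1' : ∀ x, x ∈ VV w 1 ↔ (4 < (w x).re) := fun _ => Iff.rfl
        have h2' : ∀ x, x ∈ VV w 2 ↔ ((w x).re < -4) := fun _ => Iff.rfl
        fin_cases i <;> fin_cases j <;> 
          simp only [h0', h1', h2', h, Fin.mk_one, Fin.zero_eta, Fin.reduceFinMk, abs_lt, ne_eq, not_true, false_or] at hi hj hij <;> 
          first | exact hij rfl | linarith [hi.1, hi.2] | linarith [hj.1, hj.2] | linarith
      filter_upwards [hh_loc w hw ς τ i x him, hh_loc w hw ς τ j x him] with y h1 h2
      rw [h1, h2]) x0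
  have hi0 : ii w x0 = 0 := by simp [ii, h0]
  have hz : ∀ x, ((w x).im ≠ 0 ∨ w x = 0) → ii w x = 0 := by
    rintro x (h | h) <;> simp [ii, h]
  refine ⟨φ, ?_, ?_⟩
  · intro γ c hc hre him hlt hgt
    have hic : ii w (γ c) = 1 := by
      have : ¬ |(w (γ c)).re| < 4 := by rw [abs_lt]; intro h; linarith [h.2]
      simp [ii, him, this, hre]
    refine hφ γ c ς hc ?_ ?_ ?_ ?_
    · intro t ht
      rw [hi0]
      refine ⟨hz _ ?_, rfl⟩
      rcases lt_or_gt_of_ne ht with h | h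
      · exact (hlt t h).imp_left (·.ne)
      · exact (hgt t h).imp_left (·.ne')
    · intro t ht
      rw [hic]
      intro hv
      have hv' : 4 < (w (γ t)).re := hv
      rcases hlt t ht with h | h
      · simp [hh, h]
      · rw [h] at hv'; simp at hv'; linarith
    · intro t ht
      rw [hic]
      intro hv
      have hv' : 4 < (w (γ t)).re := hv
      rcases hgt t ht with h | h
      · simp [hh, h.not_gt]
      · rw [h] at hv'; simp at hv'; linarith
    · rw [hic]; simp [hh, him]
  · intro γ c hc hre him hlt hgt
    have hic : ii w (γ c) = 2 := by
      have : ¬ |(w (γ c)).re| < 4 := by rw [abs_lt]; intro h; linarith [h.1]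
      have h2 : ¬ 4 < (w (γ c)).re := by linarith
      simp [ii, him, this, h2]
    refine hφ γ c τ hc ?_ ?_ ?_ ?_
    · intro t ht
      rw [hi0]
      refine ⟨hz _ ?_, rfl⟩
      rcases lt_or_gt_of_ne ht with h | h
      · exact (hlt t h).imp_left (·.ne')
      · exact (hgt t h).imp_left (·.ne)
    · intro t ht
      rw [hic]
      intro hv
      have hv' : (w (γ t)).re < -4 := hv
      rcases hlt t ht with h | h
      · simp [hh, h]
      · rw [h] at hv'; simp at hv'; linarith
    · intro t ht
      rw [hic]
      intro hv
      have hv' : (w (γ t)).re < -4 := hv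
      rcases hgt t ht with h | h
      · simp [hh, h.not_gt]
      · rw [h] at hv'; simp at hv'; linarith
    · rw [hic]; simp [hh, him]

set_option linter.unusedVariables false
open Complex
open unitInterval Topology Set

noncomputable def rq : ℝ := Real.sqrt (Real.sqrt 12)
theorem rq_pos : 0 < rq := by unfold rq; positivity
theorem rq4 : rq ^ 4 = 12 := by
  unfold rq
  have : ∀ x : ℝ, x ^ 4 = (x ^ 2) ^ 2 := fun x => by ring
  rw [this, Real.sq_sqrt (by positivity), Real.sq_sqrt (by positivity)]
noncomputable def s2 : ℝ := Real.sqrt 2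
theorem s2_pos : 0 < s2 := by unfold s2; positivity
theorem s2sq : s2 ^ 2 = 2 := Real.sq_sqrt (by positivity)
noncomputable def CC : ℝ := rq ^ 3 / (2 * s2)
theorem CC_pos : 0 < CC := by have := rq_pos; have := s2_pos; unfold CC; positivity
theorem CCsq : 4 < CC ^ 2 := by
  have h1 : CC ^ 2 = 12 * rq ^ 2 / 8 := by
    unfold CC
    rw [div_pow, mul_pow, s2sq, ← rq4]; ring
  have h2 : (8 / 3) < rq ^ 2 := by
    by_contra h
    have h := not_lt.1 h
    have := rq4
    nlinarith [sq_nonneg rq]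
  rw [h1]; linarith

noncomputable def gx (θ : ℝ) : ℂ := (((CC * Real.cos (2 * θ)) ^ (1 / 3 : ℝ) : ℝ) : ℂ) * Complex.exp (Complex.I * (θ / 3))

theorem gx_cont : Continuous gx := by
  unfold gx
  refine (Complex.continuous_ofReal.comp (Continuous.rpow_const (by fun_prop) ?_)).mul (by fun_prop)
  intro x; right; norm_num

noncomputable def dd (θ : ℝ) : ℝ := CC * Real.cos (2 * θ)

theorem gx_cube (θ : ℝ) (h : |θ| ≤ Real.pi / 4) : gx θ ^ 3 = (dd θ : ℂ) * Complex.exp (Complex.I * θ) := by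
  obtain ⟨h1, h2⟩ := abs_le.1 h
  have hc : 0 ≤ Real.cos (2 * θ) := Real.cos_nonneg_of_neg_pi_div_two_le_of_le (by linarith) (by linarith)
  have hd : 0 ≤ CC * Real.cos (2 * θ) := mul_nonneg CC_pos.le hc
  unfold gx dd
  rw [mul_pow, ← Complex.ofReal_pow, ← Real.rpow_natCast, ← Real.rpow_mul hd, ← Complex.exp_nat_mul]
  congr 2
  · norm_num
  · push_cast; ring

theorem gx_six (θ : ℝ) (h : |θ| ≤ Real.pi / 4) :
    (gx θ ^ 6).re = dd θ ^ 2 * Real.cos (2 * θ) ∧ (gx θ ^ 6).im = dd θ ^ 2 * Real.sin (2 * θ) := by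
  have e : gx θ ^ 6 = ((dd θ ^ 2 : ℝ) : ℂ) * Complex.exp (((2 * θ : ℝ) : ℂ) * Complex.I) := by
    have : gx θ ^ 6 = (gx θ ^ 3) ^ 2 := by ring
    rw [this, gx_cube θ h, mul_pow, ← Complex.exp_nat_mul]
    push_cast
    congr 2
    ring
  rw [e]
  constructor
  · rw [Complex.re_ofReal_mul, Complex.exp_ofReal_mul_I_re]
  · rw [Complex.im_ofReal_mul, Complex.exp_ofReal_mul_I_im]

noncomputable def th (t : ℝ) : ℝ := Real.pi / 2 * (t - 1 / 2)

theorem th_abs (t : I) : |th t| ≤ Real.pi / 4 := by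
  have := Real.pi_pos
  have h1 := t.2.1
  have h2 := t.2.2
  unfold th
  rw [abs_le]; constructor <;> nlinarith

theorem th_cont : Continuous th := by unfold th; fun_prop

theorem gx_facts (t : I) : 
    ((t:ℝ) < 1/2 → (gx (th t) ^ 6).im < 0 ∨ gx (th t) ^ 6 = 0) ∧
    (1/2 < (t:ℝ) → 0 < (gx (th t) ^ 6).im ∨ gx (th t) ^ 6 = 0) ∧
    ((t:ℝ) = 1/2 → 4 < (gx (th t) ^ 6).re ∧ (gx (th t) ^ 6).im = 0) := by
  obtain ⟨hr, hi⟩ := gx_six (th t) (th_abs t)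
  obtain ⟨a1, a2⟩ := abs_le.1 (th_abs t)
  have hp := Real.pi_pos
  have hz : dd (th t) = 0 → gx (th t) ^ 6 = 0 := by
    intro h; apply Complex.ext
    · rw [hr, h]; simp
    · rw [hi, h]; simp
  rw [hi, hr]
  refine ⟨?_, ?_, ?_⟩
  · intro h
    by_cases hd : dd (th t) = 0
    · right; exact hz hd
    · left
      have : th t < 0 := by unfold th; nlinarith
      exact mul_neg_of_pos_of_neg (by positivity) (Real.sin_neg_of_neg_of_neg_pi_lt (by linarith) (by linarith))
  · intro h
    by_cases hd : dd (th t) = 0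
    · right; exact hz hd
    · left
      have : 0 < th t := by unfold th; nlinarith
      exact mul_pos (by positivity) (Real.sin_pos_of_pos_of_lt_pi (by linarith) (by linarith))
  · intro h
    have : th t = 0 := by unfold th; rw [h]; ring
    rw [this]
    simp [dd]
    exact CCsq

theorem gx_U (t : I) : gx (th t) ^ 6 ≠ 4 ∧ gx (th t) ^ 6 ≠ -4 := by
  obtain ⟨h1, h2, h3⟩ := gx_facts t
  have key : (gx (th t) ^ 6).im = 0 → 4 < (gx (th t) ^ 6).re ∨ gx (th t) ^ 6 = 0 := by
    intro h
    rcases lt_trichotomy (t:ℝ) (1/2) with c | c | c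
    · right; exact (h1 c).resolve_left (by rw [h]; simp)
    · left; exact (h3 c).1
    · right; exact (h2 c).resolve_left (by rw [h]; simp)
  constructor
  · intro h
    rcases key (by rw [h]; simp) with c | c
    · rw [h] at c; norm_num at c
    · rw [h] at c; norm_num at c
  · intro h
    rcases key (by rw [h]; simp) with c | c
    · rw [h] at c; norm_num at c
    · rw [h] at c; norm_num at c

theorem gx_end : gx (th 0) = 0 ∧ gx (th 1) = 0 := by
  have e1 : 2 * th 0 = - (Real.pi / 2) := by unfold th; ring
  have e2 : 2 * th 1 = Real.pi / 2 := by unfold th; ring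
  constructor
  · unfold gx; rw [e1, Real.cos_neg, Real.cos_pi_div_two]; simp
  · unfold gx; rw [e2, Real.cos_pi_div_two]; simp

theorem f_x0 (x : ℂ) : f (x, 0) = x ^ 6 := by simp [f]

theorem gp_mem (a : ℂ) (ha : a ^ 6 = 1 ∨ a ^ 6 = -1) (t : I) : (a * gx (th t), (0:ℂ)) ∈ U {4, -4} := by
  have := gx_U t
  simp only [U, mem_ofPred_eq, f_x0, mul_pow, mem_insert_iff, mem_singleton_iff, not_or]
  rcases ha with h | h <;> rw [h]
  · simpa using this
  · constructor
    · intro h; apply this.2; linear_combination -h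
    · intro h; apply this.1; linear_combination -h

noncomputable def gp (h0 : (0:ℂ × ℂ) ∈ U {4, -4}) (a : ℂ) (ha : a ^ 6 = 1 ∨ a ^ 6 = -1) :
    Path (⟨0, h0⟩ : U {4, -4}) ⟨0, h0⟩ where
  toFun t := ⟨(a * gx (th t), 0), gp_mem a ha t⟩
  continuous_toFun := by
    have : Continuous fun t : I => gx (th t) := gx_cont.comp (th_cont.comp continuous_subtype_val)
    exact Continuous.subtype_mk (Continuous.prodMk (continuous_const.mul this) continuous_const) _
  source' := by
    apply Subtype.ext
    simp [gx_end.1]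
  target' := by
    apply Subtype.ext
    simp [gx_end.2]

theorem psi_gp (h0 : (0:ℂ × ℂ) ∈ U {4, -4}) {T : Type*} (ς τ : Equiv.Perm T) :
    ∃ φ : FundamentalGroup (U {4, -4}) ⟨0, h0⟩ →* Equiv.Perm T,
      φ (FundamentalGroup.fromPath (.mk (gp h0 1 (by simp)))) = ς ∧
      φ (FundamentalGroup.fromPath (.mk (gp h0 (-1) (by norm_num)))) = ς ∧
      φ (FundamentalGroup.fromPath (.mk (gp h0 Complex.I (by right; rw [show (6:ℕ) = 2 * 3 by rfl, pow_mul, Complex.I_sq]; norm_num)))) = τ := by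
  obtain ⟨φ, h1, h2⟩ := psi_ex (fun x : U {4, -4} => f x.1) (f_cont.comp continuous_subtype_val)
    (fun x h => x.2 (by simp [h])) (fun x h => x.2 (by simp [h])) ⟨0, h0⟩ f_zero ς τ
  let c : I := ⟨1/2, by norm_num, by norm_num⟩
  have hc : (0:I) < c := by rw [← Subtype.coe_lt_coe]; norm_num [c]
  have I6 : Complex.I ^ 6 = -1 := by rw [show (6:ℕ) = 2 * 3 by rfl, pow_mul, Complex.I_sq]; norm_num
  have ef : ∀ a ha t, f (gp h0 a ha t).1 = a ^ 6 * gx (th t) ^ 6 := by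
    intro a ha t
    change f (a * gx (th t), 0) = _
    rw [f_x0, mul_pow]
  have lt1 : ∀ t : I, t < c → (t:ℝ) < 1/2 := fun t ht => ht
  have lt2 : ∀ t : I, c < t → 1/2 < (t:ℝ) := fun t ht => ht
  have hm : (-1:ℂ) ^ 6 = 1 := by norm_num
  have gc := (gx_facts c).2.2 rfl
  refine ⟨φ, h1 _ c hc ?_ ?_ ?_ ?_, h1 _ c hc ?_ ?_ ?_ ?_, h2 _ c hc ?_ ?_ ?_ ?_⟩ <;> 
    simp only [ef, one_pow, hm, one_mul, I6, neg_one_mul, Complex.neg_re, Complex.neg_im, neg_eq_zero, neg_lt_zero, neg_pos, neg_lt_neg_iff] 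
  · exact gc.1
  · exact gc.2
  · exact fun t ht => (gx_facts t).1 (lt1 t ht)
  · exact fun t ht => (gx_facts t).2.1 (lt2 t ht)
  · exact gc.1
  · exact gc.2
  · exact fun t ht => (gx_facts t).1 (lt1 t ht)
  · exact fun t ht => (gx_facts t).2.1 (lt2 t ht)
  · exact gc.1
  · exact gc.2
  · exact fun t ht => (gx_facts t).1 (lt1 t ht)
  · exact fun t ht => (gx_facts t).2.1 (lt2 t ht)

set_option linter.unusedVariables false
open Complex
open unitInterval Topology Set

noncomputable def RR (q : (ℂ × ℂ) × ℂ) : ℂ :=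
  q.2 ^ 4 - 6 * (q.1.1 * q.1.2) * q.2 ^ 2 - 4 * (s2 : ℂ) * (q.1.1 ^ 3 + q.1.2 ^ 3) * q.2 + 12 - 3 * (q.1.1 * q.1.2) ^ 2

noncomputable def TH (q : (ℂ × ℂ) × ℂ) : (ℂ × ℂ) × ℂ := (q.1, RR q)

def SSq : Set ((ℂ × ℂ) × ℂ) := {q | q.1 ∈ U {4, -4} ∧ q.2 = 0}

theorem RR_contDiff : ContDiff ℂ 1 RR := by unfold RR; fun_prop

theorem TH_cont : Continuous TH := continuous_fst.prodMk RR_contDiff.continuous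

theorem s2c : (s2 : ℂ) ^ 2 = 2 := by rw [← Complex.ofReal_pow, s2sq]; norm_num

theorem TH_proper : IsProperMap TH := by
  rw [isProperMap_iff_isCompact_preimage]
  refine ⟨TH_cont, fun K hK => ?_⟩
  let m : (ℂ × ℂ) × ℂ → ℝ := fun q => 1 + ‖6 * (q.1.1 * q.1.2)‖ + ‖4 * (s2 : ℂ) * (q.1.1 ^ 3 + q.1.2 ^ 3)‖
    + ‖12 - 3 * (q.1.1 * q.1.2) ^ 2 - q.2‖
  have hm : Continuous m := by unfold m; fun_prop
  obtain ⟨M, hM⟩ := hK.bddAbove_image hm.continuousOn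
  refine IsCompact.of_isClosed_subset ((hK.image continuous_fst).prod (isCompact_closedBall (0:ℂ) M))
    (hK.isClosed.preimage TH_cont) ?_
  rintro ⟨p, z⟩ hq
  have hq' : (p, RR (p, z)) ∈ K := hq
  refine ⟨⟨_, hq', rfl⟩, ?_⟩
  rw [mem_closedBall_zero_iff]
  refine le_trans ?_ (hM ⟨_, hq', rfl⟩)
  simp only [m]
  set a := 6 * (p.1 * p.2)
  set b := 4 * (s2 : ℂ) * (p.1 ^ 3 + p.2 ^ 3)
  set d := 12 - 3 * (p.1 * p.2) ^ 2 - RR (p, z) with hd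
  have e : z ^ 4 = a * z ^ 2 + b * z - d := by
    rw [hd]; simp only [RR, a, b]; ring
  have h1 : ‖z‖ ^ 4 ≤ ‖a‖ * ‖z‖ ^ 2 + ‖b‖ * ‖z‖ + ‖d‖ := by
    calc ‖z‖ ^ 4 = ‖z ^ 4‖ := (norm_pow _ _).symm
      _ = ‖a * z ^ 2 + b * z - d‖ := by rw [e]
      _ ≤ ‖a * z ^ 2 + b * z‖ + ‖d‖ := norm_sub_le _ _
      _ ≤ ‖a * z ^ 2‖ + ‖b * z‖ + ‖d‖ := by gcongr; exact norm_add_le _ _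
      _ = _ := by rw [norm_mul a, norm_mul b, norm_pow]
  by_contra hc
  have hc := not_le.1 hc
  have ha := norm_nonneg a
  have hb := norm_nonneg b
  have hdn := norm_nonneg d
  have hz : 1 < ‖z‖ := by linarith
  have hz2 : ‖z‖ ≤ ‖z‖ ^ 2 := by nlinarith
  have h2 : ‖z‖ ^ 4 ≤ (‖a‖ + ‖b‖ + ‖d‖) * ‖z‖ ^ 2 := by nlinarith
  have h3 : (‖a‖ + ‖b‖ + ‖d‖) * ‖z‖ ^ 2 < ‖z‖ * ‖z‖ ^ 2 := by
    apply mul_lt_mul_of_pos_right (by linarith) (by positivity)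
  have h4 : ‖z‖ * ‖z‖ ^ 2 ≤ ‖z‖ ^ 4 := by
    have : ‖z‖ ^ 4 = ‖z‖ * (‖z‖ * ‖z‖ ^ 2) := by ring
    rw [this]
    have : 0 ≤ ‖z‖ * ‖z‖ ^ 2 := by positivity
    nlinarith
  linarith

theorem TH_fin (q : (ℂ × ℂ) × ℂ) : (TH ⁻¹' {q}).Finite := by
  open Polynomial in
  let P : ℂ[X] := X ^ 4 - C (6 * (q.1.1 * q.1.2)) * X ^ 2 - C (4 * (s2 : ℂ) * (q.1.1 ^ 3 + q.1.2 ^ 3)) * X + C (12 - 3 * (q.1.1 * q.1.2) ^ 2 - q.2)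
  have hP0 : ∀ a b c : ℂ, (Polynomial.X ^ 4 - Polynomial.C a * Polynomial.X ^ 2 - Polynomial.C b * Polynomial.X + Polynomial.C c) ≠ 0 := by
    intro a b c h
    have := congrArg (fun p => Polynomial.coeff p 4) h
    simp [Polynomial.coeff_X, Polynomial.coeff_C, Polynomial.coeff_X_pow] at this
  have hP : P ≠ 0 := hP0 _ _ _
  have := Polynomial.finite_setOfPred_isRoot hP
  refine (this.image (fun z => (q.1, z))).subset ?_
  rintro ⟨p, z⟩ h
  have h' : (p, RR (p, z)) = q := h
  subst h'
  refine ⟨z, ?_, rfl⟩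
  simp only [mem_ofPred_eq, Polynomial.IsRoot.def, P]
  simp [RR]

theorem RR_simple (q : (ℂ × ℂ) × ℂ) (hU : q.1 ∈ U {4, -4}) (h : RR q = 0) :
    4 * q.2 ^ 3 - 12 * (q.1.1 * q.1.2) * q.2 - 4 * (s2 : ℂ) * (q.1.1 ^ 3 + q.1.2 ^ 3) ≠ 0 := by
  intro h'
  obtain ⟨⟨x, y⟩, z⟩ := q
  simp only [RR] at h h' hU
  have hs : (s2 : ℂ) * (x ^ 3 + y ^ 3) = z ^ 3 - 3 * (x * y) * z := by linear_combination -(1/4) * h'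
  have hs2 : 2 * (x ^ 3 + y ^ 3) ^ 2 = (z ^ 3 - 3 * (x * y) * z) ^ 2 := by
    rw [← hs, mul_pow, s2c]
  have h3 : (z ^ 2 - x * y - 2) * (z ^ 2 - x * y + 2) = 0 := by
    linear_combination (-1/3) * h - (4/3) * z * hs
  have hf : f (x, y) = (x ^ 3 + y ^ 3) ^ 2 - 2 * (x * y) ^ 3 + 6 * (x * y) := by simp [f]; ring
  simp only [U, mem_ofPred_eq, mem_insert_iff, mem_singleton_iff, not_or] at hU
  rcases mul_eq_zero.1 h3 with h4 | h4
  · have hv : x * y = z ^ 2 - 2 := by linear_combination -h4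
    rw [hv] at hs2 hf
    exact hU.1 (by rw [hf]; linear_combination (1/2) * hs2)
  · have hv : x * y = z ^ 2 + 2 := by linear_combination -h4
    rw [hv] at hs2 hf
    exact hU.2 (by rw [hf]; linear_combination (1/2) * hs2)

theorem TH_loc : IsLocalHomeomorphOn TH (TH ⁻¹' SSq) := by
  intro q hq
  have hU : q.1 ∈ U {4, -4} := hq.1
  have h0 : RR q = 0 := hq.2
  have hs := RR_simple q hU h0
  have hR : HasStrictFDerivAt RR (fderiv ℂ RR q) q := RR_contDiff.contDiffAt.hasStrictFDerivAt (by simp)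
  set L := (ContinuousLinearMap.fst ℂ (ℂ × ℂ) ℂ).prod (fderiv ℂ RR q) with hL
  have hT : HasStrictFDerivAt TH L q := hasStrictFDerivAt_fst.prodMk hR
  have hz : fderiv ℂ RR q (0, 1) = 4 * q.2 ^ 3 - 12 * (q.1.1 * q.1.2) * q.2 - 4 * (s2 : ℂ) * (q.1.1 ^ 3 + q.1.2 ^ 3) := by
    have d1 : HasDerivAt (fun z : ℂ => (q.1, z)) (0, 1) q.2 := (hasDerivAt_const _ _).prodMk (hasDerivAt_id _)
    have d2 : HasDerivAt (fun z : ℂ => RR (q.1, z)) (fderiv ℂ RR q (0, 1)) q.2 := HasFDerivAt.comp_hasDerivAt (l := RR) q.2 hR.hasFDerivAt d1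
    have d3 : HasDerivAt (fun z : ℂ => RR (q.1, z)) (4 * q.2 ^ 3 - 12 * (q.1.1 * q.1.2) * q.2 - 4 * (s2 : ℂ) * (q.1.1 ^ 3 + q.1.2 ^ 3)) q.2 := by
      have := (((((hasDerivAt_pow 4 q.2).sub ((hasDerivAt_pow 2 q.2).const_mul (6 * (q.1.1 * q.1.2)))).sub
        ((hasDerivAt_id q.2).const_mul (4 * (s2 : ℂ) * (q.1.1 ^ 3 + q.1.2 ^ 3)))).add_const 12).sub_const (3 * (q.1.1 * q.1.2) ^ 2))
      refine this.congr_deriv ?_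
      norm_num
      ring
    exact d2.unique d3
  have inj : Function.Injective (L : (ℂ × ℂ) × ℂ →ₗ[ℂ] (ℂ × ℂ) × ℂ) := by
    rw [injective_iff_map_eq_zero]
    rintro ⟨dp, dz⟩ h
    have h1 : dp = 0 := congrArg Prod.fst h
    have h2 : fderiv ℂ RR q (dp, dz) = 0 := congrArg Prod.snd h
    subst h1
    have h3 : ((0, dz) : (ℂ × ℂ) × ℂ) = dz • (0, 1) := by simp
    rw [h3, map_smul, hz, smul_eq_mul] at h2
    rw [(mul_eq_zero.1 h2).resolve_right hs]; rfl
  let e := (LinearEquiv.ofInjectiveEndo _ inj).toContinuousLinearEquiv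
  have he : (e : (ℂ × ℂ) × ℂ →L[ℂ] (ℂ × ℂ) × ℂ) = L := by
    refine ContinuousLinearMap.ext fun v => rfl
  rw [← he] at hT
  exact ⟨hT.toOpenPartialHomeomorph TH, hT.mem_toOpenPartialHomeomorph_source, (hT.toOpenPartialHomeomorph_coe).symm⟩

theorem TH_cov : IsCoveringMap (SSq.restrictPreimage TH) :=
  (TH_proper.isClosedMap.isCoveringMapOn_of_isLocalHomeomorphOn (fun x _ => TH_fin x) TH_loc).isCoveringMap_restrictPreimage

set_option linter.unusedVariables false
open Complex
open unitInterval Topology Set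

def toS : C(U {4, -4}, SSq) :=
  ⟨fun u => ⟨(u.1, 0), u.2, rfl⟩, Continuous.subtype_mk (continuous_subtype_val.prodMk continuous_const) _⟩

theorem RR_x0 (x z : ℂ) : RR ((x, 0), z) = z ^ 4 - 4 * (s2:ℂ) * x ^ 3 * z + 12 := by simp [RR]

theorem RR_lift (t : I) : RR ((1 * gx (th t), 0), (rq : ℂ) * Complex.exp (Complex.I * th t)) = 0 := by
  rw [RR_x0, one_mul, gx_cube _ (th_abs t)]
  have h4 : (rq : ℂ) ^ 4 = 12 := by rw [← Complex.ofReal_pow, rq4]; norm_num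
  have hC : 4 * (s2 : ℂ) * CC * rq = 24 := by
    have : 4 * s2 * CC * rq = 24 := by
      unfold CC
      have := s2_pos.ne'
      field_simp
      rw [rq4]; norm_num
    rw [← Complex.ofReal_ofNat, ← Complex.ofReal_mul, ← Complex.ofReal_mul, ← Complex.ofReal_mul, this]; norm_num
  unfold dd
  push_cast
  set E := Complex.exp (Complex.I * th t) with hE
  have hEn : E ≠ 0 := Complex.exp_ne_zero _
  have hc : 2 * Complex.cos (2 * th t) = E ^ 2 + E⁻¹ ^ 2 := by
    rw [Complex.cos, hE, ← Complex.exp_neg, ← Complex.exp_nat_mul, ← Complex.exp_nat_mul]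
    push_cast
    rw [mul_div_cancel₀ _ (by norm_num)]
    congr 2 <;> ring
  have hE1 : E * E⁻¹ = 1 := mul_inv_cancel₀ hEn
  have : (rq * E) ^ 4 - 4 * (s2:ℂ) * (CC * Complex.cos (2 * th t) * E) * (rq * E) + 12 = 
     rq ^ 4 * E ^ 4 - (4 * (s2 : ℂ) * CC * rq) * E ^ 2 * Complex.cos (2 * th t) + 12 := by ring
  rw [this, h4, hC]
  have : (24 : ℂ) * E ^ 2 * Complex.cos (2 * th t) = 12 * E ^ 2 * (2 * Complex.cos (2 * th t)) := by ring
  rw [this, hc]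
  linear_combination -12 * (E * E⁻¹ + 1) * hE1

theorem q1_unique (z w : ℂ) (hz : z ^ 4 = -12) (hw : w ^ 4 = -12) (h1 : 0 < z.re) (h2 : 0 < z.im)
    (h3 : 0 < w.re) (h4 : 0 < w.im) : z = w := by
  have key : ∀ z : ℂ, z ^ 4 = -12 → 0 < z.re → 0 < z.im → z.im = z.re ∧ z.re ^ 4 = 3 := by
    intro z hz h1 h2
    have e : z ^ 4 = z * z * (z * z) := by ring
    rw [e] at hz
    have hi := congrArg Complex.im hz
    have hr := congrArg Complex.re hz
    simp at hi hr
    have h5 : z.re * z.im * (z.re - z.im) * (z.re + z.im) = 0 := by linear_combination (1/4) * hi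
    have h6 : z.im = z.re := by
      rcases mul_eq_zero.1 h5 with h | h
      · rcases mul_eq_zero.1 h with h | h
        · exact absurd h (by positivity)
        · linarith
      · linarith
    refine ⟨h6, ?_⟩
    rw [h6] at hr
    linear_combination (-1/4) * hr
  obtain ⟨a1, a2⟩ := key z hz h1 h2
  obtain ⟨b1, b2⟩ := key w hw h3 h4
  have : z.re = w.re := (pow_left_inj₀ h1.le h3.le (n := 4) (by norm_num)).1 (by rw [a2, b2])
  exact Complex.ext this (by rw [a1, b1, this])

theorem no_cross (x z : ℂ) (hx : 0 < (x ^ 3).re ∨ x = 0) (h : RR ((-1 * x, 0), z) = 0) :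
    z.re ≠ 0 ∧ (0 < z.re → z.im ≠ 0) := by
  rw [RR_x0] at h
  have h' : z * z * (z * z) + 4 * (s2 : ℂ) * (x ^ 3) * z + 12 = 0 := by linear_combination h
  have hp := s2_pos
  set y := x ^ 3 with hy
  have hr := congrArg Complex.re h'
  have hi := congrArg Complex.im h'
  simp at hr hi
  have hy0 : 0 < y.re ∨ y = 0 := hx.imp_right (fun h => by rw [hy, h]; simp)
  constructor
  · intro h0
    rw [h0] at hr hi
    simp at hr hi
    rcases hy0 with c | c
    · have : z.im = 0 := by
        rcases hi with h | h
        · rcases h with h | h <;> linarith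
        · exact h
      rw [this] at hr; norm_num at hr
    · rw [c] at hr; simp at hr
      nlinarith [sq_nonneg (z.im * z.im)]
  · intro hpos h0
    rw [h0] at hr
    simp at hr
    have hyr : 0 ≤ y.re := by rcases hy0 with c | c; exact c.le; rw [c]; simp
    have : 0 ≤ 4 * s2 * y.re * z.re := by positivity
    nlinarith [sq_nonneg (z.re * z.re)]

theorem gx_re (t : I) : 0 < (gx (th t) ^ 3).re ∨ gx (th t) = 0 := by
  obtain ⟨a1, a2⟩ := abs_le.1 (th_abs t)
  have hp := Real.pi_pos
  have e := gx_cube _ (th_abs t)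
  by_cases hd : dd (th t) = 0
  · right
    rw [hd] at e
    simpa using e
  · left
    have hc : 0 ≤ Real.cos (2 * th t) := Real.cos_nonneg_of_neg_pi_div_two_le_of_le (by linarith) (by linarith)
    have h2 : 0 ≤ dd (th t) := mul_nonneg CC_pos.le hc
    rw [e, Complex.re_ofReal_mul, mul_comm Complex.I, Complex.exp_ofReal_mul_I_re]
    exact mul_pos (lt_of_le_of_ne h2 (Ne.symm hd)) (Real.cos_pos_of_mem_Ioo ⟨by linarith, by linarith⟩)

set_option linter.unusedVariables false
open Complex
open unitInterval Topology Set

theorem re_pos_path (u : I → ℝ) (hu : Continuous u) (hne : ∀ t, u t ≠ 0) (h0 : 0 < u 0) (t : I) : 0 < u t := by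
  by_contra h
  have h := not_lt.1 h
  obtain ⟨s, hs⟩ := mem_range_of_exists_le_of_exists_ge hu ⟨t, h⟩ ⟨0, h0.le⟩
  exact hne s hs

theorem rho_ex (h0 : (0:ℂ × ℂ) ∈ U {4, -4}) :
    ∃ (T : Type) (_ : Finite T) (φ : FundamentalGroup (U {4, -4}) ⟨0, h0⟩ →* Equiv.Perm T),
      φ (FundamentalGroup.fromPath (.mk (gp h0 1 (by simp)))) ≠ 
      φ (FundamentalGroup.fromPath (.mk (gp h0 (-1) (by norm_num)))) := by
  let p := SSq.restrictPreimage TH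
  have cov : IsCoveringMap p := TH_cov
  let x0 : U {4, -4} := ⟨0, h0⟩
  let b0 : SSq := toS x0
  let T := p ⁻¹' {b0}
  have hT : Finite T := by
    have := (TH_fin b0.1).to_subtype
    refine Finite.of_injective (β := TH ⁻¹' {b0.1}) (fun z => ⟨z.1.1, congrArg Subtype.val z.2⟩) ?_
    intro a b hab
    have := congrArg Subtype.val hab
    exact Subtype.ext (Subtype.ext this)
  refine ⟨T, hT, (cov.monodromyPerm b0).comp (FundamentalGroup.map toS x0), ?_⟩
  intro heq
  have hz : ∀ z : ℂ, z ^ 4 = -12 → TH ((0, z) : (ℂ × ℂ) × ℂ) = ((0, 0) : (ℂ × ℂ) × ℂ) := by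
    intro z h
    simp [TH, RR, h]
  let pt : ∀ z : ℂ, z ^ 4 = -12 → T := fun z h => ⟨⟨(0, z), by
    change TH (0, z) ∈ SSq
    rw [hz z h]; exact ⟨h0, rfl⟩⟩, by
    change p _ = b0
    exact Subtype.ext (hz z h)⟩
  have hrq : (rq : ℂ) ^ 4 = 12 := by rw [← Complex.ofReal_pow, rq4]; norm_num
  let ez : ℝ → ℂ := fun t => (rq : ℂ) * Complex.exp (Complex.I * th t)
  have eRR : ∀ t : I, RR ((1 * gx (th t), 0), ez t) = 0 := RR_lift
  have ez0 : ez 0 ^ 4 = -12 := by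
    have := eRR 0
    rw [RR_x0] at this
    simp [gx_end.1] at this
    linear_combination this
  have ez1 : ez 1 ^ 4 = -12 := by
    have := eRR 1
    rw [RR_x0] at this
    simp [gx_end.2] at this
    linear_combination this
  have ere : ∀ t, (ez t).re = rq * Real.cos (th t) ∧ (ez t).im = rq * Real.sin (th t) := by
    intro t
    simp only [ez]
    rw [mul_comm Complex.I, Complex.re_ofReal_mul, Complex.im_ofReal_mul, Complex.exp_ofReal_mul_I_re, Complex.exp_ofReal_mul_I_im]
    exact ⟨rfl, rfl⟩
  have hpi := Real.pi_pos
  have t1 : th 1 = Real.pi / 4 := by unfold th; ring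
  have t0 : th 0 = - (Real.pi / 4) := by unfold th; ring
  have p1 : 0 < (ez 1).re := by
    rw [(ere 1).1, t1]; exact mul_pos rq_pos (Real.cos_pos_of_mem_Ioo ⟨by linarith, by linarith⟩)
  have p2 : 0 < (ez 1).im := by
    rw [(ere 1).2, t1]; exact mul_pos rq_pos (Real.sin_pos_of_pos_of_lt_pi (by linarith) (by linarith))
  have p3 : (ez 0).im < 0 := by
    rw [(ere 0).2, t0]; exact mul_neg_of_pos_of_neg rq_pos (Real.sin_neg_of_neg_of_neg_pi_lt (by linarith) (by linarith))
  -- first lift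
  have l1 : (cov.monodromyPerm b0) (FundamentalGroup.map toS x0 (FundamentalGroup.fromPath (.mk (gp h0 1 (by simp))))) (pt _ ez0) = pt _ ez1 := by
    let γ := (gp h0 1 (by simp)).map toS.continuous
    have hm : ∀ t : I, TH (((1 * gx (th t), 0), ez t) : (ℂ × ℂ) × ℂ) = ((1 * gx (th t), 0), 0) := by
      intro t; simp only [TH, eRR]
    let Γ : I → TH ⁻¹' SSq := fun t => ⟨((1 * gx (th t), 0), ez t), by
      change TH _ ∈ SSq
      rw [hm]; exact ⟨gp_mem 1 (by simp) t, rfl⟩⟩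
    have hΓ : Continuous Γ := by
      have h1 : Continuous fun t : I => gx (th t) := gx_cont.comp (th_cont.comp continuous_subtype_val)
      have h2 : Continuous fun t : I => ez t := by
        have : Continuous ez := by have := th_cont; fun_prop
        exact this.comp continuous_subtype_val
      exact Continuous.subtype_mk (((continuous_const.mul h1).prodMk continuous_const).prodMk h2) _
    have hs : γ.toContinuousMap 0 = p (pt _ ez0).1 := γ.source.trans (pt _ ez0).2.symm
    have key : Γ = cov.liftPath γ.toContinuousMap (pt _ ez0).1 hs := by
      rw [cov.eq_liftPath_iff]
      refine ⟨hΓ, ?_, ?_⟩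
      · funext t
        exact Subtype.ext (hm t)
      · apply Subtype.ext
        change (((1 * gx (th 0), 0), ez 0) : (ℂ × ℂ) × ℂ) = ((0,0), ez 0)
        rw [gx_end.1, mul_zero]
    apply Subtype.ext
    change cov.liftPath γ.toContinuousMap (pt _ ez0).1 hs 1 = (pt _ ez1).1
    have k1 : Γ 1 = cov.liftPath γ.toContinuousMap (pt _ ez0).1 hs 1 := congrFun key 1
    rw [← k1]
    apply Subtype.ext
    change (((1 * gx (th 1), 0), ez 1) : (ℂ × ℂ) × ℂ) = ((0,0), ez 1)
    rw [gx_end.2, mul_zero]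
  have l2 : (cov.monodromyPerm b0) (FundamentalGroup.map toS x0 (FundamentalGroup.fromPath (.mk (gp h0 (-1) (by norm_num))))) (pt _ ez1) = pt _ ez1 := by
    let γ := (gp h0 (-1) (by norm_num)).map toS.continuous
    have hs : γ.toContinuousMap 0 = p (pt _ ez1).1 := γ.source.trans (pt _ ez1).2.symm
    set Γ := cov.liftPath γ.toContinuousMap (pt _ ez1).1 hs with hΓ
    have hl : ∀ t, p (Γ t) = γ t := fun t => congrFun (cov.liftPath_lifts γ.toContinuousMap (pt _ ez1).1 hs) t
    have h00 : Γ 0 = (pt _ ez1).1 := cov.liftPath_zero γ.toContinuousMap (pt _ ez1).1 hs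
    have hv : ∀ t : I, (Γ t).1.1 = (-1 * gx (th t), 0) ∧ RR (Γ t).1 = 0 := by
      intro t
      have h : TH (Γ t).1 = ((-1 * gx (th t), 0), 0) := congrArg Subtype.val (hl t)
      exact ⟨congrArg Prod.fst h, congrArg Prod.snd h⟩
    have hR : ∀ t : I, RR ((-1 * gx (th t), 0), (Γ t).1.2) = 0 := by
      intro t
      have := (hv t).2
      rwa [show (Γ t).1 = ((-1 * gx (th t), 0), (Γ t).1.2) from Prod.ext (hv t).1 rfl] at this
    have hnc := fun t => no_cross _ _ (gx_re t) (hR t)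
    have cz : Continuous fun t => (Γ t).1.2 := continuous_snd.comp (continuous_subtype_val.comp Γ.continuous)
    have z0 : (Γ 0).1.2 = ez 1 := by rw [h00]
    have r1 := re_pos_path (fun t => ((Γ t).1.2).re) (Complex.continuous_re.comp cz) (fun t => (hnc t).1) (by simp only [z0]; exact p1)
    have r2 := re_pos_path (fun t => ((Γ t).1.2).im) (Complex.continuous_im.comp cz) (fun t => (hnc t).2 (r1 t)) (by simp only [z0]; exact p2)
    have e1 : (Γ 1).1.2 ^ 4 = -12 := by
      have := hR 1
      rw [RR_x0] at this
      simp [gx_end.2] at this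
      linear_combination this
    have e2 : (Γ 1).1.2 = ez 1 := q1_unique _ _ e1 ez1 (r1 1) (r2 1) p1 p2
    apply Subtype.ext
    change Γ 1 = (pt _ ez1).1
    apply Subtype.ext
    refine Prod.ext ?_ e2
    rw [(hv 1).1]
    change ((-1 * gx (th 1), 0) : ℂ × ℂ) = (0, 0)
    rw [gx_end.2, mul_zero]
  have heq' := congrArg (fun g => g (pt _ ez1)) heq
  have l3 : (cov.monodromyPerm b0) (FundamentalGroup.map toS x0 (FundamentalGroup.fromPath (.mk (gp h0 1 (by simp))))) (pt _ ez1) = pt _ ez1 := 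
    heq'.trans l2
  have h5 : pt _ ez0 = pt _ ez1 := Equiv.injective _ (l1.trans l3.symm)
  have h6 : ez 0 = ez 1 := congrArg (fun z : T => z.1.1.2) h5
  rw [h6] at p3
  linarith

set_option linter.unusedVariables false
open Complex
open unitInterval Topology Set

theorem fin_contra {G P : Type*} [Group G] [Group P] [Finite P] (a b : G) (hab : Subgroup.closure {a, b} = ⊤)
    (g g' h : G) (ψ : P → P → (G →* P)) (h1 : ∀ x y, ψ x y g = x) (h2 : ∀ x y, ψ x y g' = x)
    (h3 : ∀ x y, ψ x y h = y) (ρ : G →* P) (hρ : ρ g ≠ ρ g') : False := by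
  let ev : (G →* P) → P × P := fun φ => (φ a, φ b)
  have ev_inj : Function.Injective ev := by
    intro φ φ' he
    refine MonoidHom.eq_of_eqOn_dense hab ?_
    rintro x (rfl | rfl)
    · exact congrArg Prod.fst he
    · exact congrArg Prod.snd he
  let Ψ : P × P → (G →* P) := fun q => ψ q.1 q.2
  have Ψ_inj : Function.Injective Ψ := by
    intro q q' he
    refine Prod.ext ?_ ?_
    · rw [← h1 q.1 q.2, ← h1 q'.1 q'.2]; exact congrArg (fun φ => φ g) he
    · rw [← h3 q.1 q.2, ← h3 q'.1 q'.2]; exact congrArg (fun φ => φ h) he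
  have surj : Function.Surjective (ev ∘ Ψ) := Finite.injective_iff_surjective.1 (ev_inj.comp Ψ_inj)
  obtain ⟨q, hq⟩ := surj (ev ρ)
  have : Ψ q = ρ := ev_inj hq
  apply hρ
  rw [← this]
  exact (h1 _ _).trans (h2 _ _).symm

/-- For `B₁ = {4, -4}` and `B₂ = {4, 4i}`, the fundamental groups of `U_{B₁}` and `U_{B₂}`
(at any basepoints) are not isomorphic. -/
theorem stmt3 (x : U ({4, -4} : Set ℂ)) (y : U ({4, 4 * Complex.I} : Set ℂ)) :
    IsEmpty (FundamentalGroup (U ({4, -4} : Set ℂ)) x ≃*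
      FundamentalGroup (U ({4, 4 * Complex.I} : Set ℂ)) y) := by
  refine ⟨fun e => ?_⟩
  have n1 : (0:ℂ) ∉ ({4, -4} : Set ℂ) := by simp
  have n2 : (0:ℂ) ∉ ({4, 4 * Complex.I} : Set ℂ) := by simp
  have h1 : (0:ℂ × ℂ) ∈ U {4, -4} := U_zero n1
  have h2 : (0:ℂ × ℂ) ∈ U {4, 4 * Complex.I} := U_zero n2
  haveI := U_pc {4, -4} (by simp) n1
  haveI := U_pc {4, 4 * Complex.I} (by simp) n2
  let e' := ((FundamentalGroup.fundamentalGroupMulEquivOfPathConnected (⟨0, h1⟩ : U ({4, -4} : Set ℂ)) x).trans e).trans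
    (FundamentalGroup.fundamentalGroupMulEquivOfPathConnected y (⟨0, h2⟩ : U ({4, 4 * Complex.I} : Set ℂ)))
  obtain ⟨g1, g2, hg⟩ := G2_gen h2
  obtain ⟨T, hT, ρ, hρ⟩ := rho_ex h1
  choose ψ a1 a2 a3 using fun ς τ : Equiv.Perm T => psi_gp h1 ς τ
  refine fin_contra (e'.symm g1) (e'.symm g2) ?_ _ _ _ ψ a1 a2 a3 ρ hρ
  have := congrArg (Subgroup.map e'.symm.toMonoidHom) hg
  rw [MonoidHom.map_closure, Set.image_pair, Subgroup.map_top_of_surjective _ e'.symm.surjective] at this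
  exact this
end

section
/- The set of critical values of f, namely {f(x,y) : (x,y) ∈ ℂ², 6x⁵ + 6y = 0 and 6y⁵ + 6x = 0}, is exactly {0, 4, −4, 4i, −4i}. -/
open Complex

theorem crit_aux (w : ℂ) (hw : w ^ 4 = 1) :
    ∃ p : ℂ × ℂ, 6 * p.1 ^ 5 + 6 * p.2 = 0 ∧ 6 * p.2 ^ 5 + 6 * p.1 = 0 ∧ f p = -4 * w := by
  obtain ⟨x, rfl⟩ := IsAlgClosed.exists_pow_nat_eq w (n := 6) (by norm_num)
  refine ⟨(x, -x ^ 5), ?_, ?_, ?_⟩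
  · simp only
    ring
  · simp only
    linear_combination (-6 * x) * hw
  · simp only [f]
    linear_combination (x ^ 6) * hw

/-- The set of critical values of `f` is exactly `{0, 4, -4, 4i, -4i}`. -/
theorem stmt8 :
    {z : ℂ | ∃ p : ℂ × ℂ, 6 * p.1 ^ 5 + 6 * p.2 = 0 ∧ 6 * p.2 ^ 5 + 6 * p.1 = 0 ∧ f p = z}
      = ({0, 4, -4, 4 * Complex.I, -(4 * Complex.I)} : Set ℂ) := by
  ext z
  simp only [Set.mem_setOf_eq, Set.mem_insert_iff, Set.mem_singleton_iff]
  constructor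
  · rintro ⟨⟨x, y⟩, h1, h2, rfl⟩
    simp only [f] at h1 h2 ⊢
    obtain rfl : y = -x ^ 5 := by linear_combination h1 / 6
    have hx : x * ((x ^ 6 - 1) * ((x ^ 6 + 1) * ((x ^ 6 - I) * (x ^ 6 + I)))) = 0 := by
      linear_combination (-1 / 6) * h2 - (x * (x ^ 12 - 1)) * I_sq
    have hv : x ^ 6 + (-x ^ 5) ^ 6 + 6 * x * (-x ^ 5) = -4 * x ^ 6 := by
      linear_combination (-x ^ 5 / 6) * h2
    rw [hv]
    rcases mul_eq_zero.1 hx with h | h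
    · left
      simp [h]
    rcases mul_eq_zero.1 h with h | h
    · right; right; left
      linear_combination -4 * h
    rcases mul_eq_zero.1 h with h | h
    · right; left
      linear_combination -4 * h
    rcases mul_eq_zero.1 h with h | h
    · right; right; right; right
      linear_combination -4 * h
    · right; right; right; left
      linear_combination -4 * h
  · rintro (rfl | rfl | rfl | rfl | rfl)
    · exact ⟨(0, 0), by simp, by simp, by simp [f]⟩
    · simpa using crit_aux (-1) (by norm_num)
    · simpa using crit_aux 1 (by norm_num)
    · simpa using crit_aux (-I) (by rw [neg_pow, I_pow_four]; norm_num)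
    · simpa using crit_aux I I_pow_four
end

section
/- For each λ ∈ {4, −4, 4i, −4i}, the set of singular points of the fiber f⁻¹(λ), i.e. {(x,y) ∈ ℂ² : f(x,y) = λ, 6x⁵ + 6y = 0, 6y⁵ + 6x = 0}, has exactly 6 elements; for λ = 0 this set has exactly one element, namely the origin (0,0). -/
open Complex

/-- The set of singular points of the fiber `f⁻¹(λ)`: the points of the fiber where
both partial derivatives `6x⁵ + 6y` and `6y⁵ + 6x` of `f` vanish. -/
def SingFiber (lam : ℂ) : Set (ℂ × ℂ) :=
  {p | f p = lam ∧ 6 * p.1 ^ 5 + 6 * p.2 = 0 ∧ 6 * p.2 ^ 5 + 6 * p.1 = 0}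

lemma card_aux (lam c : ℂ) (hl : lam = -4 * c) (hc : c ^ 4 = 1) :
    (SingFiber lam).ncard = 6 := by
  classical
  have hc0 : c ≠ 0 := by
    rintro rfl
    norm_num at hc
  have hS : SingFiber lam =
      (((Polynomial.nthRoots 6 c).toFinset.image (fun x : ℂ => (x, -x ^ 5)) : Finset (ℂ × ℂ)) :
        Set (ℂ × ℂ)) := by
    ext ⟨x, y⟩
    simp only [SingFiber, f, Set.mem_setOf_eq, Finset.coe_image, Set.mem_image, Finset.mem_coe,
      Multiset.mem_toFinset, Polynomial.mem_nthRoots (show 0 < 6 by norm_num), Prod.mk.injEq]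
    constructor
    · rintro ⟨h1, h2, h3⟩
      have hy : y = -x ^ 5 := by linear_combination h2 / 6
      subst hy
      refine ⟨x, ?_, rfl, rfl⟩
      have h4 : x * x ^ 24 = x := by linear_combination -h3 / 6
      subst hl
      linear_combination (-1 / 4 : ℂ) * h1 + (1 / 4 : ℂ) * x ^ 5 * h4
    · rintro ⟨z, hz, rfl, rfl⟩
      have h24 : z ^ 24 = 1 := by
        rw [show z ^ 24 = (z ^ 6) ^ 4 by ring, hz, hc]
      subst hl
      refine ⟨?_, by ring, ?_⟩
      · linear_combination z ^ 6 * h24 - 4 * hz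
      · linear_combination -6 * z * h24
  have hp := Complex.isPrimitiveRoot_exp 6 (by norm_num)
  have hex : ∃ α : ℂ, α ^ 6 = c := IsAlgClosed.exists_pow_nat_eq c (by norm_num)
  rw [hS, Set.ncard_coe_finset, Finset.card_image_of_injective,
    Multiset.toFinset_card_of_nodup (hp.nthRoots_nodup hc0), hp.card_nthRoots, if_pos hex]
  intro a b h
  exact (Prod.mk.inj h).1

/-- For each `λ ∈ {4, -4, 4i, -4i}` the fiber `f⁻¹(λ)` has exactly 6 singular points,
while the fiber `f⁻¹(0)` has exactly one singular point, namely the origin. -/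
theorem stmt9 :
    (∀ lam ∈ ({4, -4, 4 * Complex.I, -(4 * Complex.I)} : Set ℂ), (SingFiber lam).ncard = 6) ∧
    SingFiber 0 = {((0 : ℂ), (0 : ℂ))} := by
  constructor
  · intro lam h
    simp only [Set.mem_insert_iff, Set.mem_singleton_iff] at h
    rcases h with rfl | rfl | rfl | rfl
    · exact card_aux _ (-1) (by norm_num) (by norm_num)
    · exact card_aux _ 1 (by norm_num) (by norm_num)
    · exact card_aux _ (-Complex.I) (by ring) (by rw [neg_pow, Complex.I_pow_four]; norm_num)
    · exact card_aux _ Complex.I (by ring) Complex.I_pow_four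
  · ext ⟨x, y⟩
    simp only [SingFiber, f, Set.mem_setOf_eq, Set.mem_singleton_iff, Prod.mk.injEq]
    constructor
    · rintro ⟨h1, h2, h3⟩
      have hy : y = -x ^ 5 := by linear_combination h2 / 6
      subst hy
      have h4 : x * x ^ 24 = x := by linear_combination -h3 / 6
      have h6 : x ^ 6 = 0 := by
        linear_combination (-1 / 4 : ℂ) * h1 + (1 / 4 : ℂ) * x ^ 5 * h4
      have hx : x = 0 := pow_eq_zero_iff (by norm_num) |>.1 h6
      subst hx
      simp
    · rintro ⟨rfl, rfl⟩
      norm_num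
end

section
/- Let S₁ = {(x,y) ∈ ℂ² : f(x,y) ∈ {4, −4}, 6x⁵ + 6y = 0, 6y⁵ + 6x = 0} be the set of nodes of the curve F_{B₁} = f⁻¹({4,−4}). Then S₁ has exactly 12 elements, and there exist three complex affine lines L₁, L₂, L₃ ⊂ ℂ² such that S₁ ⊆ L₁ ∪ L₂ ∪ L₃ and each L_i contains exactly 4 points of S₁. -/
open Complex

/-- The set of nodes of the curve `f⁻¹(B)`: the points of the curve where both partial
derivatives `6x⁵ + 6y` and `6y⁵ + 6x` of `f` vanish. -/
def Nodes (B : Set ℂ) : Set (ℂ × ℂ) :=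
  {p | f p ∈ B ∧ 6 * p.1 ^ 5 + 6 * p.2 = 0 ∧ 6 * p.2 ^ 5 + 6 * p.1 = 0}

/-- `L` is a complex affine line in `ℂ²`. -/
def IsAffineLine (L : Set (ℂ × ℂ)) : Prop :=
  ∃ a b c : ℂ, (a, b) ≠ (0, 0) ∧ L = {p | a * p.1 + b * p.2 = c}

theorem ncard_roots_aux (n : ℕ) (hn : 0 < n) (a : ℂ) (ha : a ≠ 0) :
    {x : ℂ | x ^ n = a}.ncard = n := by
  have hp := Complex.isPrimitiveRoot_exp n hn.ne'
  have h1 : {x : ℂ | x ^ n = a} = ((Polynomial.nthRoots n a).toFinset : Set ℂ) := by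
    ext x
    simp [Polynomial.mem_nthRoots hn]
  have hex : ∃ α : ℂ, α ^ n = a := IsAlgClosed.exists_pow_nat_eq a hn
  rw [h1, Set.ncard_coe_finset, Multiset.toFinset_card_of_nodup (hp.nthRoots_nodup ha),
    hp.card_nthRoots, if_pos hex]

theorem nodes_eq_aux :
    Nodes {4, -4} = (fun x : ℂ => (x, -x ^ 5)) '' {x : ℂ | x ^ 12 = 1} := by
  ext ⟨x, y⟩
  simp only [Nodes, f, Set.mem_setOf_eq, Set.mem_image, Set.mem_insert_iff,
    Set.mem_singleton_iff, Prod.mk.injEq]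
  constructor
  · rintro ⟨h, h1, h2⟩
    have hy : y = -x ^ 5 := by linear_combination h1 / 6
    subst hy
    have h3 : x ^ 25 = x := by linear_combination -h2 / 6
    have h4 : x ^ 30 = x ^ 6 := by linear_combination x ^ 5 * h3
    refine ⟨x, ?_, rfl, rfl⟩
    have h5 : (x ^ 6 - 1) * (x ^ 6 + 1) = 0 := by
      rcases h with h | h
      · have : x ^ 6 + 1 = 0 := by linear_combination (-h + h4) / 4
        rw [this, mul_zero]
      · have : x ^ 6 - 1 = 0 := by linear_combination (-h + h4) / 4
        rw [this, zero_mul]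
    linear_combination h5
  · rintro ⟨z, hz, rfl, rfl⟩
    have h4 : z ^ 30 = z ^ 6 := by linear_combination (z ^ 18 + z ^ 6) * hz
    refine ⟨?_, by ring, by linear_combination (-6 * z ^ 13 - 6 * z) * hz⟩
    have h5 : (z ^ 6 - 1) * (z ^ 6 + 1) = 0 := by linear_combination hz
    rcases mul_eq_zero.mp h5 with h | h
    · right; linear_combination h4 - 4 * h
    · left; linear_combination h4 - 4 * h

theorem inj_aux : Function.Injective (fun x : ℂ => (x, -x ^ 5)) := by
  intro a b h
  exact (Prod.mk.inj h).1

theorem line_aux (w : ℂ) (hw : w ^ 3 = 1) :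
    (Nodes {4, -4} ∩ {p : ℂ × ℂ | w * p.1 + 1 * p.2 = 0}).ncard = 4 := by
  have hw0 : w ≠ 0 := by
    rintro rfl
    norm_num at hw
  have : Nodes {4, -4} ∩ {p : ℂ × ℂ | w * p.1 + 1 * p.2 = 0}
      = (fun x : ℂ => (x, -x ^ 5)) '' {x : ℂ | x ^ 4 = w} := by
    rw [nodes_eq_aux]
    ext p
    constructor
    · rintro ⟨⟨x, hx, rfl⟩, h⟩
      refine ⟨x, ?_, rfl⟩
      simp only [Set.mem_setOf_eq] at hx h ⊢
      have hx0 : x ≠ 0 := by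
        rintro rfl
        norm_num at hx
      apply mul_left_cancel₀ hx0
      linear_combination -h
    · rintro ⟨x, hx, rfl⟩
      simp only [Set.mem_setOf_eq] at hx
      refine ⟨⟨x, ?_, rfl⟩, ?_⟩
      · simp only [Set.mem_setOf_eq]
        rw [← hw, ← hx]; ring
      · simp only [Set.mem_setOf_eq]
        rw [← hx]; ring
  rw [this, Set.ncard_image_of_injective _ inj_aux, ncard_roots_aux 4 (by norm_num) w hw0]

/-- The set `S₁` of nodes of `F_{B₁} = f⁻¹({4, -4})` has exactly 12 elements, and there
are three complex affine lines covering `S₁`, each containing exactly 4 of its points. -/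
theorem stmt10 :
    (Nodes {4, -4}).ncard = 12 ∧
    ∃ L₁ L₂ L₃ : Set (ℂ × ℂ), IsAffineLine L₁ ∧ IsAffineLine L₂ ∧ IsAffineLine L₃ ∧
      Nodes {4, -4} ⊆ L₁ ∪ L₂ ∪ L₃ ∧
      (Nodes {4, -4} ∩ L₁).ncard = 4 ∧ (Nodes {4, -4} ∩ L₂).ncard = 4 ∧
      (Nodes {4, -4} ∩ L₃).ncard = 4 := by
  refine ⟨?_, ?_⟩
  · rw [nodes_eq_aux, Set.ncard_image_of_injective _ inj_aux,
      ncard_roots_aux 12 (by norm_num) 1 one_ne_zero]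
  have hp := Complex.isPrimitiveRoot_exp 3 (by norm_num)
  obtain ⟨ζ, hζ⟩ : ∃ ζ : ℂ, IsPrimitiveRoot ζ 3 := ⟨_, hp⟩
  have h3 : ζ ^ 3 = 1 := hζ.pow_eq_one
  have h1 : ζ - 1 ≠ 0 := sub_ne_zero.mpr (hζ.ne_one (by norm_num))
  have hs : ζ ^ 2 + ζ + 1 = 0 := by
    apply mul_left_cancel₀ h1
    linear_combination h3
  refine ⟨{p | 1 * p.1 + 1 * p.2 = 0}, {p | ζ * p.1 + 1 * p.2 = 0},
    {p | ζ ^ 2 * p.1 + 1 * p.2 = 0}, ⟨1, 1, 0, by simp, rfl⟩, ⟨ζ, 1, 0, by simp, rfl⟩,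
    ⟨ζ ^ 2, 1, 0, by simp, rfl⟩, ?_, line_aux 1 (by norm_num), line_aux ζ h3,
    line_aux (ζ ^ 2) (by linear_combination (ζ ^ 3 + 1) * h3)⟩
  rw [nodes_eq_aux]
  rintro _ ⟨x, hx, rfl⟩
  simp only [Set.mem_setOf_eq] at hx
  have key : (x ^ 4 - 1) * ((x ^ 4 - ζ) * (x ^ 4 - ζ ^ 2)) = 0 := by
    linear_combination hx + (-x ^ 8 + x ^ 4) * hs + (x ^ 4 - 1) * h3
  simp only [Set.mem_union, Set.mem_setOf_eq]
  rcases mul_eq_zero.mp key with h | h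
  · left; left; linear_combination -x * h
  rcases mul_eq_zero.mp h with h | h
  · left; right; linear_combination -x * h
  · right; linear_combination -x * h
end

section
/- Let S₂ = {(x,y) ∈ ℂ² : f(x,y) ∈ {4, 4i}, 6x⁵ + 6y = 0, 6y⁵ + 6x = 0} be the set of nodes of the curve F_{B₂} = f⁻¹({4, 4i}). Then S₂ has exactly 12 elements and no three distinct points of S₂ lie on a common complex affine line. -/
open Complex

lemma nodes_iff (p : ℂ × ℂ) : p ∈ Nodes {4, 4 * Complex.I} ↔
    (p.1 ^ 6 = -1 ∨ p.1 ^ 6 = -I) ∧ p.2 = -p.1 ^ 5 := by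
  obtain ⟨x, y⟩ := p
  simp only [Nodes, f, Set.mem_setOf_eq, Set.mem_insert_iff, Set.mem_singleton_iff]
  have hI : I ^ 2 = -1 := I_sq
  constructor
  · rintro ⟨h, h1, h2⟩
    have hy : y = -x ^ 5 := by linear_combination h1 / 6
    subst hy
    have h25 : x ^ 25 = x := by linear_combination -h2 / 6
    have h30 : x ^ 30 = x ^ 6 := by linear_combination x ^ 5 * h25
    refine ⟨?_, rfl⟩
    rcases h with h | h
    · left; linear_combination -(h - h30) / 4
    · right; linear_combination -(h - h30) / 4
  · rintro ⟨h, rfl⟩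
    have h24 : x ^ 24 = 1 := by
      have : x ^ 24 = (x ^ 6) ^ 4 := by ring
      rw [this]
      rcases h with h | h <;> rw [h]
      · norm_num
      · rw [neg_pow, I_pow_four]; norm_num
    refine ⟨?_, by ring, by linear_combination -6 * x * h24⟩
    rcases h with h | h
    · left; linear_combination -4 * h + x ^ 6 * h24
    · right; linear_combination -4 * h + x ^ 6 * h24

lemma conj_mul_self {x : ℂ} (h : x ^ 6 = -1 ∨ x ^ 6 = -I) : (starRingEnd ℂ) x * x = 1 := by
  have h1 : ‖x‖ = 1 := by
    have : ‖x‖ ^ 6 = 1 := by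
      rw [← norm_pow]; rcases h with h | h <;> rw [h] <;> simp
    exact (pow_eq_one_iff_of_nonneg (norm_nonneg _) (by norm_num)).1 this
  rw [mul_comm, Complex.mul_conj, Complex.normSq_eq_norm_sq, h1]; simp

lemma key {s t u e : ℂ} (hs : (starRingEnd ℂ) s * s = 1) (ht : (starRingEnd ℂ) t * t = 1)
    (hu : (starRingEnd ℂ) u * u = 1) (he : (starRingEnd ℂ) e = -e) (he2 : e ^ 2 = -1)
    (h : u ^ 2 + e * s * t = (s + t) * u) : u ^ 2 = e * s ^ 2 := by
  have h' := congrArg (starRingEnd ℂ) h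
  simp only [map_add, map_mul, map_pow, he] at h'
  set s' := (starRingEnd ℂ) s
  set t' := (starRingEnd ℂ) t
  set u' := (starRingEnd ℂ) u
  have h2 : s * t - e * u ^ 2 = (s + t) * u := by
    have a1 : s * t * u ^ 2 * (u' ^ 2 + -e * s' * t') = s * t - e * u ^ 2 := by
      have : s * t * u ^ 2 * (u' ^ 2 + -e * s' * t')
        = s * t * (u' * u) ^ 2 - e * u ^ 2 * (s' * s) * (t' * t) := by ring
      rw [this, hs, ht, hu]; ring
    have a2 : s * t * u ^ 2 * ((s' + t') * u') = (s + t) * u := by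
      have : s * t * u ^ 2 * ((s' + t') * u')
        = ((s' * s) * t + (t' * t) * s) * (u' * u) * u := by ring
      rw [this, hs, ht, hu]; ring
    rw [← a1, ← a2, h']
  have h3 : u ^ 2 = - e * s * t := by
    linear_combination (1 - e) / 2 * (h - h2) + (u ^ 2 + s * t) / 2 * he2
  have hu0 : u ≠ 0 := right_ne_zero_of_mul_eq_one hu
  have h4 : (s + t) * u = 0 := by linear_combination h3 - h
  have h5 : s + t = 0 := (mul_eq_zero.1 h4).resolve_right hu0
  linear_combination h3 - e * s * h5

lemma det_zero {a b c : ℂ} (hab : (a, b) ≠ (0, 0)) {x1 y1 x2 y2 x3 y3 : ℂ}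
    (h1 : a * x1 + b * y1 = c) (h2 : a * x2 + b * y2 = c) (h3 : a * x3 + b * y3 = c) :
    (x2 - x1) * (y3 - y1) = (x3 - x1) * (y2 - y1) := by
  have ha : a * ((x2 - x1) * (y3 - y1) - (x3 - x1) * (y2 - y1)) = 0 := by
    linear_combination (y3 - y1) * (h2 - h1) - (y2 - y1) * (h3 - h1)
  have hb : b * ((x2 - x1) * (y3 - y1) - (x3 - x1) * (y2 - y1)) = 0 := by
    linear_combination (x2 - x1) * (h3 - h1) - (x3 - x1) * (h2 - h1)
  by_contra hne
  have hne' := sub_ne_zero.2 hne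
  exact hab (Prod.ext ((mul_eq_zero.1 ha).resolve_right hne')
    ((mul_eq_zero.1 hb).resolve_right hne'))

/-- three points on the same conic -/
lemma same {k s t u y1 y2 y3 : ℂ} (hk : k ≠ 0) (h1 : s * y1 = k) (h2 : t * y2 = k)
    (h3 : u * y3 = k) (hst : s ≠ t) (hsu : s ≠ u) (htu : t ≠ u)
    (h : (t - s) * (y3 - y1) = (u - s) * (y2 - y1)) : False := by
  have : k * ((t - s) * (u - s) * (t - u)) = 0 := by
    linear_combination (-s * t * u) * h - (t*u*(t-s) - t*u*(u-s)) * h1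
      - s * u * (u - s) * h2 + s * t * (t - s) * h3
  simp [hk, sub_eq_zero, hst.symm, hsu.symm, htu] at this

/-- two points on one conic, the third on the other -/
lemma mixed {k l s t u y1 y2 y3 : ℂ} (hk : k ≠ 0) (h1 : s * y1 = k) (h2 : t * y2 = k)
    (h3 : u * y3 = l) (hst : s ≠ t)
    (h : (t - s) * (y3 - y1) = (u - s) * (y2 - y1)) :
    k * u ^ 2 + l * s * t = k * ((s + t) * u) := by
  have : (t - s) * (k * u ^ 2 + l * s * t - k * ((s + t) * u)) = 0 := by
    linear_combination (s * t * u) * h + (t*u*(t-s) - t*u*(u-s)) * h1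
      + s * u * (u - s) * h2 - s * t * (t - s) * h3
  exact sub_eq_zero.1 ((mul_eq_zero.1 this).resolve_left (sub_ne_zero.2 hst.symm))

lemma one_one_I {s t u y1 y2 y3 : ℂ} (hs : s ^ 6 = -1) (ht : t ^ 6 = -1) (hu : u ^ 6 = -I)
    (h1 : s * y1 = 1) (h2 : t * y2 = 1) (h3 : u * y3 = I) (hst : s ≠ t)
    (h : (t - s) * (y3 - y1) = (u - s) * (y2 - y1)) : False := by
  have h4 := mixed one_ne_zero h1 h2 h3 hst h
  have h5 := key (conj_mul_self (.inl hs)) (conj_mul_self (.inl ht)) (conj_mul_self (.inr hu))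
    conj_I I_sq (by linear_combination h4)
  have h6 : u ^ 6 = I := by
    have : u ^ 6 = I ^ 2 * I * s ^ 6 := by
      rw [show u ^ 6 = (u ^ 2) ^ 3 by ring, h5]; ring
    rw [this, hs, I_sq]; ring
  rw [hu] at h6
  have := congrArg Complex.im h6
  norm_num at this

lemma I_I_one {s t u y1 y2 y3 : ℂ} (hs : s ^ 6 = -I) (ht : t ^ 6 = -I) (hu : u ^ 6 = -1)
    (h1 : s * y1 = I) (h2 : t * y2 = I) (h3 : u * y3 = 1) (hst : s ≠ t)
    (h : (t - s) * (y3 - y1) = (u - s) * (y2 - y1)) : False := by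
  have h4 := mixed I_ne_zero h1 h2 h3 hst h
  have hI := I_sq
  have h5 := key (e := -I) (conj_mul_self (.inr hs)) (conj_mul_self (.inr ht))
    (conj_mul_self (.inl hu)) (by simp) (by simp)
    (by linear_combination -I * h4 + (u ^ 2 - (s + t) * u) * hI)
  have h6 : u ^ 6 = 1 := by
    have : u ^ 6 = - (I ^ 2 * I) * s ^ 6 := by
      rw [show u ^ 6 = (u ^ 2) ^ 3 by ring, h5]; ring
    rw [this, hs, I_sq]; linear_combination -hI
  rw [hu] at h6
  norm_num at h6

lemma card_aux_s11 {a : ℂ} (ha : ∃ z : ℂ, z ^ 6 = a) (h0 : a ≠ 0) :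
    (Polynomial.nthRoots 6 a).toFinset.card = 6 := by
  have hp := Complex.isPrimitiveRoot_exp 6 (by norm_num)
  rw [Multiset.toFinset_card_of_nodup (hp.nthRoots_nodup h0), hp.card_nthRoots, if_pos ha]

theorem stmt11 :
    (Nodes {4, 4 * Complex.I}).ncard = 12 ∧
    ∀ L : Set (ℂ × ℂ), IsAffineLine L →
      ∀ p q r : ℂ × ℂ, p ∈ Nodes {4, 4 * Complex.I} → q ∈ Nodes {4, 4 * Complex.I} →
        r ∈ Nodes {4, 4 * Complex.I} → p ≠ q → p ≠ r → q ≠ r →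
        ¬(p ∈ L ∧ q ∈ L ∧ r ∈ L) := by
  have hI := I_sq
  constructor
  · have hS : Nodes {4, 4 * Complex.I} = (fun x : ℂ => (x, -x ^ 5)) ''
        (((Polynomial.nthRoots 6 (-1 : ℂ)).toFinset ∪
          (Polynomial.nthRoots 6 (-I : ℂ)).toFinset : Finset ℂ) : Set ℂ) := by
      ext ⟨x, y⟩
      rw [nodes_iff]
      simp [Polynomial.mem_nthRoots, eq_comm]
    rw [hS, Set.ncard_image_of_injective _ (fun x y h => (Prod.ext_iff.1 h).1),
      Set.ncard_coe_finset, Finset.card_union_of_disjoint,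
      card_aux_s11 (IsAlgClosed.exists_pow_nat_eq _ (by norm_num)) (by simp),
      card_aux_s11 (IsAlgClosed.exists_pow_nat_eq _ (by norm_num)) (by simp)]
    rw [Finset.disjoint_left]
    intro x hx hx'
    simp only [Multiset.mem_toFinset, Polynomial.mem_nthRoots (show 0 < 6 by norm_num)] at hx hx'
    rw [hx] at hx'
    have := congrArg Complex.re hx'
    norm_num at this
  · rintro L ⟨a, b, c, hab, rfl⟩ ⟨s, y1⟩ ⟨t, y2⟩ ⟨u, y3⟩ hp hq hr hpq hpr hqr ⟨h1, h2, h3⟩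
    rw [nodes_iff] at hp hq hr
    simp only [Set.mem_setOf_eq] at h1 h2 h3 hp hq hr
    have hst : s ≠ t := by rintro rfl; exact hpq (by rw [hp.2, hq.2])
    have hsu : s ≠ u := by rintro rfl; exact hpr (by rw [hp.2, hr.2])
    have htu : t ≠ u := by rintro rfl; exact hqr (by rw [hq.2, hr.2])
    have A : ∀ x y k : ℂ, y = -x ^ 5 → x ^ 6 = -k → x * y = k := by
      intro x y k h h'; subst h; linear_combination -h'
    obtain ⟨hs, hp⟩ := hp
    obtain ⟨ht, hq⟩ := hq
    obtain ⟨hu, hr⟩ := hr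
    have d := det_zero hab h1 h2 h3
    have d2 := det_zero hab h1 h3 h2
    have d3 := det_zero hab h2 h3 h1
    rcases hs with hs | hs <;> rcases ht with ht | ht <;> rcases hu with hu | hu <;>
      have B1 := A _ _ _ hp hs <;> have B2 := A _ _ _ hq ht <;> have B3 := A _ _ _ hr hu
    · exact same one_ne_zero B1 B2 B3 hst hsu htu d
    · exact one_one_I hs ht hu B1 B2 B3 hst d
    · exact one_one_I hs hu ht B1 B3 B2 hsu d2
    · exact I_I_one ht hu hs B2 B3 B1 htu d3
    · exact one_one_I ht hu hs B2 B3 B1 htu d3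
    · exact I_I_one hs hu ht B1 B3 B2 hsu d2
    · exact I_I_one hs ht hu B1 B2 B3 hst d
    · exact same I_ne_zero B1 B2 B3 hst hsu htu d
end

section
/- The fundamental groups π₁(U_{{4,−4}}) and π₁(U_{{4i,−4i}}) are isomorphic. -/
open Complex

theorem U_line_finite (B : Set ℂ) (hB : B.Finite) (p q : ℂ × ℂ) (hp : p ∈ U B) :
    {t : ℂ | p + t • (q - p) ∉ U B}.Finite := by
  let P : Polynomial ℂ := (.C p.1 + .X * .C (q.1 - p.1)) ^ 6 + (.C p.2 + .X * .C (q.2 - p.2)) ^ 6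
    + 6 * (.C p.1 + .X * .C (q.1 - p.1)) * (.C p.2 + .X * .C (q.2 - p.2))
  have hP : ∀ t, P.eval t = f (p + t • (q - p)) := by
    intro t
    simp [P, f]
  have : {t : ℂ | p + t • (q - p) ∉ U B} = ⋃ b ∈ B, {t | (P - .C b).IsRoot t} := by
    ext t
    simp [U, hP, sub_eq_zero]
  rw [this]
  refine hB.biUnion fun b hb => Polynomial.finite_setOfPred_isRoot ?_
  intro h
  apply hp
  have h0 : (P - .C b).eval 0 = 0 := by rw [h]; simp
  rw [Polynomial.eval_sub, hP] at h0
  simp [sub_eq_zero] at h0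
  rwa [h0]

theorem U_joined (B : Set ℂ) (hB : B.Finite) (p q : U B) : Joined p q := by
  have hfin := U_line_finite B hB p q p.2
  have hpc := hfin.countable.isPathConnected_compl_of_one_lt_rank (by
    rw [Complex.rank_real_complex]; norm_num)
  have hj := hpc.joinedIn 0 (by simp) 1 (by simp)
  have hc : Continuous fun t : ℂ => (p : ℂ × ℂ) + t • ((q : ℂ × ℂ) - p) := by fun_prop
  have := hj.joined_subtype.map (f := fun t : ({t : ℂ | (p : ℂ × ℂ) + t • ((q : ℂ × ℂ) - p) ∉ U B}ᶜ : Set ℂ) => (⟨(p : ℂ × ℂ) + (t : ℂ) • ((q : ℂ × ℂ) - p),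
    not_not.1 t.2⟩ : U B)) (by fun_prop)
  simpa using this

/-- The fundamental groups of `U_{{4,-4}}` and `U_{{4i,-4i}}` (at any basepoints) are
isomorphic. -/
theorem stmt12 (x : U ({4, -4} : Set ℂ))
    (y : U ({4 * Complex.I, -(4 * Complex.I)} : Set ℂ)) :
    Nonempty (FundamentalGroup (U ({4, -4} : Set ℂ)) x ≃*
      FundamentalGroup (U ({4 * Complex.I, -(4 * Complex.I)} : Set ℂ)) y) := by
  obtain ⟨a, ha⟩ := IsAlgClosed.exists_pow_nat_eq I (n := 6) (by norm_num)
  have ha0 : a ≠ 0 := by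
    rintro rfl
    simp at ha
    exact I_ne_zero ha.symm
  have hb0 : I / a ≠ 0 := div_ne_zero I_ne_zero ha0
  let e : ℂ × ℂ ≃ₜ ℂ × ℂ := (Homeomorph.mulLeft₀ a ha0).prodCongr (Homeomorph.mulLeft₀ (I / a) hb0)
  have he : ∀ p, f (e p) = I * f p := by
    intro p
    have h1 : (I / a) ^ 6 = I := by
      rw [div_pow, ha, div_eq_iff I_ne_zero]
      linear_combination (I ^ 4 - I ^ 2 + 1 - 1) * I_sq
    have h2 : a * (I / a) = I := by field_simp
    simp only [e, f, Homeomorph.coe_prodCongr, Homeomorph.coe_mulLeft₀, Prod.map]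
    linear_combination p.1 ^ 6 * ha + p.2 ^ 6 * h1 + 6 * p.1 * p.2 * h2
  let E : U ({4, -4} : Set ℂ) ≃ₜ U ({4 * Complex.I, -(4 * Complex.I)} : Set ℂ) :=
    e.subtype (by
      intro p
      show f p ∉ _ ↔ f (e p) ∉ _
      rw [he]
      have h1 : I * f p = 4 * I ↔ f p = 4 := by
        rw [mul_comm, mul_left_inj' I_ne_zero]
      have h2 : I * f p = -(4 * I) ↔ f p = -4 := by
        rw [← neg_mul, mul_comm, mul_left_inj' I_ne_zero]
      simp [h1, h2])
  obtain ⟨γ⟩ := U_joined {4 * Complex.I, -(4 * Complex.I)} (by simp) (E x) y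
  let G : CategoryTheory.Equivalence (FundamentalGroupoid (U ({4, -4} : Set ℂ)))
      (FundamentalGroupoid (U ({4 * Complex.I, -(4 * Complex.I)} : Set ℂ))) :=
    FundamentalGroupoidFunctor.equivOfHomotopyEquiv E.toHomotopyEquiv
  have e1 : FundamentalGroup (U ({4, -4} : Set ℂ)) x ≃* FundamentalGroup _ (E x) :=
    G.fullyFaithfulFunctor.mulEquivEnd (FundamentalGroupoid.mk x)
  exact ⟨e1.trans (FundamentalGroup.fundamentalGroupMulEquivOfPath γ)⟩
end
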